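/- Let sigma be a weight of K. Then: for every n >= 1, S_-(f_n) = c_- * f_n where c_- = sum over nonidentity (x,t) in L_{q^{4-t_K}} of chi_sigma(h(t)); for every n >= 1, S_K(f_{-n}) = d * f_{-n} where d = sum over nonidentity (x,t) in L_{q^{t_K}} of chi_sigma(h(t)); and S_K(f_0) = d_0 * f_0, where d_0 = -chi_sigma(h(tt)) if sigma is isomorphic to a twist of the Steinberg weight by a character, and d_0 = 0 otherwise. -/

import Mathlib

open scoped Classical

noncomputable section

namespace U21

/-- The arithmetic setting: `E` is the unramified quadratic extension of a non-archimedean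
local field `F` of odd residue characteristic `p`, with residue field of `F` of cardinality
`q = p ^ fdeg`.  The field `E` is encoded through its valuation subring `O = o_E`, a
uniformizer `ϖ`, the maximal ideal `mI` (so that `p_E^k` is `ϖ ^ k * O`), and the nontrivial
`F`-automorphism `conj` of `E` (which induces the `q`-power Frobenius on the residue field
of `E`, of cardinality `q ^ 2`). -/
structure Setting where
  p : ℕ
  q : ℕ
  fdeg : ℕ
  hp : p.Prime
  hodd : p ≠ 2
  hfdeg : 0 < fdeg
  hq : q = p ^ fdeg
  E : Type
  [fieldE : Field E]
  conj : E →+* E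
  conj_invol : ∀ x, conj (conj x) = x
  conj_ne : conj ≠ RingHom.id E
  O : Subring E
  val_ring : ∀ x : E, x ≠ 0 → x ∈ O ∨ x⁻¹ ∈ O
  conj_O : ∀ x, x ∈ O → conj x ∈ O
  ϖ : E
  unif_mem : ϖ ∈ O
  unif_ne : ϖ ≠ 0
  unif_conj : conj ϖ = ϖ
  unif_not_unit : ¬ IsUnit (⟨ϖ, unif_mem⟩ : O)
  disc : ∀ x : E, x ≠ 0 → ∃ (n : ℤ) (u : Oˣ), x = (u : O) * ϖ ^ n
  mI : Ideal O
  hmI : ∀ x : O, x ∈ mI ↔ ∃ y ∈ O, (x : E) = ϖ * y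
  [fin_res : Fintype (O ⧸ mI)]
  card_res : Fintype.card (O ⧸ mI) = q ^ 2
  res_frob : ∀ x : O, Ideal.Quotient.mk mI ⟨conj x, conj_O x x.2⟩ = (Ideal.Quotient.mk mI x) ^ q
  complete : ∀ a : ℕ → E,
    (∀ k : ℕ, ∃ N, ∀ m ≥ N, ∀ n ≥ N, ∃ w ∈ O, a m - a n = ϖ ^ k * w) →
    ∃ L : E, ∀ k : ℕ, ∃ N, ∀ n ≥ N, ∃ w ∈ O, a n - L = ϖ ^ k * w

attribute [instance] Setting.fieldE Setting.fin_res

namespace Setting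

variable (S : Setting)

/-- 3×3 matrices over `E`. -/
abbrev M3 := Matrix (Fin 3) (Fin 3) S.E

/-- The antidiagonal matrix `β` of the Hermitian form. -/
def betaM : S.M3 := !![0,0,1;0,1,0;1,0,0]

/-- The fractional ideal `p_E ^ k ⊆ E` (for `k : ℤ`). -/
def pE (k : ℤ) : Set S.E := {z | ∃ w ∈ S.O, z = S.ϖ ^ k * w}

/-- The unramified unitary group `G = U(2,1)(E/F)`, as a subgroup of `GL₃(E)`:
`g ∈ G` iff `g.transpose * β * conj g = β`. -/
def Gsub : Subgroup (Matrix.GeneralLinearGroup (Fin 3) S.E) where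
  carrier := {g | ((g : S.M3)).transpose * S.betaM * ((g : S.M3).map S.conj) = S.betaM}
  one_mem' := by
    simp [Matrix.map_one (⇑S.conj) (map_zero S.conj) (map_one S.conj)]
  mul_mem' := by
    intro a b ha hb
    simp only [Set.mem_setOf_eq, Units.val_mul, Matrix.transpose_mul, Matrix.map_mul] at ha hb ⊢
    calc ((b : S.M3)).transpose * ((a : S.M3)).transpose * S.betaM * ((a : S.M3).map S.conj * (b : S.M3).map S.conj)
        = ((b : S.M3)).transpose * (((a : S.M3)).transpose * S.betaM * (a : S.M3).map S.conj) * ((b : S.M3).map S.conj) := by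
          simp only [mul_assoc]
      _ = S.betaM := by rw [ha]; exact hb
  inv_mem' := by
    intro a ha
    simp only [Set.mem_setOf_eq] at ha ⊢
    have hA : IsUnit ((a : S.M3)) := a.isUnit
    have hdet : IsUnit ((a : S.M3)).det := (Matrix.isUnit_iff_isUnit_det _).mp hA
    have hAc : IsUnit (((a : S.M3)).map ⇑S.conj) := by
      rw [← RingHom.mapMatrix_apply]; exact hA.map _
    have hdetc : IsUnit ((((a : S.M3)).map ⇑S.conj).det) := (Matrix.isUnit_iff_isUnit_det _).mp hAc
    have hdetT : IsUnit ((((a : S.M3)).transpose).det) := by rw [Matrix.det_transpose]; exact hdet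
    have hmapinv : ((a : S.M3)⁻¹).map ⇑S.conj = (((a : S.M3)).map ⇑S.conj)⁻¹ := by
      symm
      apply Matrix.inv_eq_left_inv
      rw [← Matrix.map_mul, Matrix.nonsing_inv_mul _ hdet,
        Matrix.map_one (⇑S.conj) (map_zero S.conj) (map_one S.conj)]
    rw [Matrix.coe_units_inv, Matrix.transpose_nonsing_inv, hmapinv]
    conv_lhs => rw [← ha]
    calc (((a:S.M3)).transpose)⁻¹ * (((a:S.M3)).transpose * S.betaM * ((a:S.M3)).map ⇑S.conj) * (((a:S.M3)).map ⇑S.conj)⁻¹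
        = (((a:S.M3)).transpose)⁻¹ * ((a:S.M3)).transpose * S.betaM *
            (((a:S.M3)).map ⇑S.conj * (((a:S.M3)).map ⇑S.conj)⁻¹) := by simp only [mul_assoc]
      _ = S.betaM := by
          rw [Matrix.nonsing_inv_mul _ hdetT, Matrix.mul_nonsing_inv _ hdetc, one_mul, mul_one]

/-- The group `G = U(2,1)(E/F)`. -/
abbrev GG := ↥S.Gsub

/-- The matrix of an element of `G`. -/
def mat (g : S.GG) : S.M3 := ((g : Matrix.GeneralLinearGroup (Fin 3) S.E) : S.M3)

/-- The upper unipotent matrix `n(x,y)`. -/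
def nM (x y : S.E) : S.M3 := !![1, x, y; 0, 1, -S.conj x; 0, 0, 1]

/-- The lower unipotent matrix `n'(x,y)`. -/
def n'M (x y : S.E) : S.M3 := !![1, 0, 0; x, 1, 0; y, -S.conj x, 1]

/-- The diagonal matrix `h(x) = diag(x, -x̄x⁻¹, x̄⁻¹)`. -/
def hM (x : S.E) : S.M3 := !![x, 0, 0; 0, -S.conj x * x⁻¹, 0; 0, 0, (S.conj x)⁻¹]

/-- The subgroup `N` of `G` (unipotent radical of the upper triangular Borel), as a set. -/
def Nset : Set S.GG := {g | ∃ x y : S.E, x * S.conj x + y + S.conj y = 0 ∧ S.mat g = S.nM x y}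

/-- The subgroup `N_k = {n(x,y) : y ∈ p_E^k}`, as a set. -/
def Nk (k : ℤ) : Set S.GG :=
  {g | ∃ x y : S.E, x * S.conj x + y + S.conj y = 0 ∧ y ∈ S.pE k ∧ S.mat g = S.nM x y}

/-- The subgroup `N'` of `G`, as a set. -/
def N'set : Set S.GG := {g | ∃ x y : S.E, x * S.conj x + y + S.conj y = 0 ∧ S.mat g = S.n'M x y}

/-- The subgroup `N'_k = {n'(x,y) : y ∈ p_E^k}`, as a set. -/
def N'k (k : ℤ) : Set S.GG :=
  {g | ∃ x y : S.E, x * S.conj x + y + S.conj y = 0 ∧ y ∈ S.pE k ∧ S.mat g = S.n'M x y}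

/-- The diagonal subgroup `H` of `G`, as a set. -/
def Hset : Set S.GG := {g | ∃ a b c : S.E, S.mat g = !![a,0,0;0,b,0;0,0,c]}

/-- The hyperspecial maximal compact subgroup `K₀ = G ∩ GL₃(o_E)`, as a set. -/
def K0set : Set S.GG := {g | ∀ i j, S.mat g i j ∈ S.O}

/-- The special (non-hyperspecial) maximal compact subgroup `K₁`, as a set. -/
def K1set : Set S.GG :=
  {g | S.mat g 0 0 ∈ S.O ∧ S.mat g 0 1 ∈ S.O ∧ S.mat g 0 2 ∈ S.pE (-1) ∧
       S.mat g 1 0 ∈ S.pE 1 ∧ S.mat g 1 1 ∈ S.O ∧ S.mat g 1 2 ∈ S.O ∧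
       S.mat g 2 0 ∈ S.pE 1 ∧ S.mat g 2 1 ∈ S.pE 1 ∧ S.mat g 2 2 ∈ S.O}

/-- The Iwahori subgroup `I_{K₀}` (preimage of the Borel of `Γ_{K₀}`), as a set. -/
def IK0 : Set S.GG :=
  {g | g ∈ S.K0set ∧ S.mat g 1 0 ∈ S.pE 1 ∧ S.mat g 2 0 ∈ S.pE 1 ∧ S.mat g 2 1 ∈ S.pE 1}

/-- The pro-p Iwahori subgroup `I_{1,K₀}`, as a set. -/
def I1K0 : Set S.GG :=
  {g | g ∈ S.IK0 ∧ S.mat g 0 0 - 1 ∈ S.pE 1 ∧ S.mat g 1 1 - 1 ∈ S.pE 1 ∧ S.mat g 2 2 - 1 ∈ S.pE 1}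

/-- The opposite pro-p Iwahori subgroup `I'_{1,K₀}`, as a set. -/
def I1'K0 : Set S.GG :=
  {g | g ∈ S.K0set ∧ S.mat g 0 1 ∈ S.pE 1 ∧ S.mat g 0 2 ∈ S.pE 1 ∧ S.mat g 1 2 ∈ S.pE 1 ∧
       S.mat g 0 0 - 1 ∈ S.pE 1 ∧ S.mat g 1 1 - 1 ∈ S.pE 1 ∧ S.mat g 2 2 - 1 ∈ S.pE 1}

/-- The maximal normal pro-p subgroup `K₀¹` of `K₀` (principal congruence subgroup), as a set. -/
def Kone0 : Set S.GG := {g | ∀ i j, S.mat g i j - (1 : S.M3) i j ∈ S.pE 1}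

/-- The Iwahori subgroup `I_{K₁}`, as a set. -/
def IK1 : Set S.GG := {g | g ∈ S.K1set ∧ S.mat g 2 0 ∈ S.pE 2}

/-- The pro-p Iwahori subgroup `I_{1,K₁}`, as a set. -/
def I1K1 : Set S.GG :=
  {g | g ∈ S.IK1 ∧ S.mat g 0 0 - 1 ∈ S.pE 1 ∧ S.mat g 1 1 - 1 ∈ S.pE 1 ∧ S.mat g 2 2 - 1 ∈ S.pE 1}

/-- The opposite pro-p Iwahori subgroup `I'_{1,K₁}`, as a set. -/
def I1'K1 : Set S.GG :=
  {g | g ∈ S.K1set ∧ S.mat g 0 2 ∈ S.O ∧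
       S.mat g 0 0 - 1 ∈ S.pE 1 ∧ S.mat g 1 1 - 1 ∈ S.pE 1 ∧ S.mat g 2 2 - 1 ∈ S.pE 1}

/-- The maximal normal pro-p subgroup `K₁¹` of `K₁`, as a set. -/
def Kone1 : Set S.GG :=
  {g | g ∈ S.K1set ∧ S.mat g 0 2 ∈ S.O ∧ S.mat g 2 0 ∈ S.pE 2 ∧
       S.mat g 0 0 - 1 ∈ S.pE 1 ∧ S.mat g 1 1 - 1 ∈ S.pE 1 ∧ S.mat g 2 2 - 1 ∈ S.pE 1}

/-- The congruence subgroup of level `n` (used to express smoothness), as a set. -/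
def cong (n : ℕ) : Set S.GG := {g | ∀ i j, S.mat g i j - (1 : S.M3) i j ∈ S.pE n}

def alphaM : S.M3 := !![S.ϖ⁻¹, 0, 0; 0, 1, 0; 0, 0, S.ϖ]

def alphaMinv : S.M3 := !![S.ϖ, 0, 0; 0, 1, 0; 0, 0, S.ϖ⁻¹]

lemma alpha_mul_inv : S.alphaM * S.alphaMinv = 1 := by
  ext i j
  fin_cases i <;> fin_cases j <;>
    simp [alphaM, alphaMinv, Matrix.mul_apply, Fin.sum_univ_three, Matrix.one_apply,
      Matrix.vecHead, Matrix.vecTail, inv_mul_cancel₀ S.unif_ne, mul_inv_cancel₀ S.unif_ne]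

lemma alpha_inv_mul : S.alphaMinv * S.alphaM = 1 := by
  ext i j
  fin_cases i <;> fin_cases j <;>
    simp [alphaM, alphaMinv, Matrix.mul_apply, Fin.sum_univ_three, Matrix.one_apply,
      Matrix.vecHead, Matrix.vecTail, inv_mul_cancel₀ S.unif_ne, mul_inv_cancel₀ S.unif_ne]

def alphaU : Matrix.GeneralLinearGroup (Fin 3) S.E :=
  ⟨S.alphaM, S.alphaMinv, S.alpha_mul_inv, S.alpha_inv_mul⟩

lemma alphaU_mem : S.alphaU ∈ S.Gsub := by
  show ((S.alphaU : S.M3)).transpose * S.betaM * ((S.alphaU : S.M3).map S.conj) = S.betaM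
  have : (S.alphaU : S.M3) = S.alphaM := rfl
  rw [this]
  ext i j
  fin_cases i <;> fin_cases j <;>
    simp [alphaM, betaM, Matrix.mul_apply, Fin.sum_univ_three, Matrix.map_apply,
      Matrix.transpose_apply, Matrix.vecHead, Matrix.vecTail, map_inv₀, S.unif_conj,
      inv_mul_cancel₀ S.unif_ne, mul_inv_cancel₀ S.unif_ne]

/-- The element `α = diag(ϖ⁻¹, 1, ϖ)` of `G`. -/
def alphaE : S.GG := ⟨S.alphaU, S.alphaU_mem⟩

lemma beta_mul_beta : S.betaM * S.betaM = 1 := by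
  ext i j
  fin_cases i <;> fin_cases j <;>
    simp [betaM, Matrix.mul_apply, Fin.sum_univ_three, Matrix.one_apply,
      Matrix.vecHead, Matrix.vecTail]

def betaU : Matrix.GeneralLinearGroup (Fin 3) S.E :=
  ⟨S.betaM, S.betaM, S.beta_mul_beta, S.beta_mul_beta⟩

lemma betaU_mem : S.betaU ∈ S.Gsub := by
  show ((S.betaU : S.M3)).transpose * S.betaM * ((S.betaU : S.M3).map S.conj) = S.betaM
  have : (S.betaU : S.M3) = S.betaM := rfl
  rw [this]
  ext i j
  fin_cases i <;> fin_cases j <;>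
    simp [betaM, Matrix.mul_apply, Fin.sum_univ_three, Matrix.map_apply, Matrix.transpose_apply,
      Matrix.vecHead, Matrix.vecTail]

/-- The element `β` of `G`. -/
def betaE : S.GG := ⟨S.betaU, S.betaU_mem⟩

/-- The element `β' = β * α⁻¹` of `G`. -/
def betaPr : S.GG := S.betaE * S.alphaE⁻¹

/-- A finite set `U` is a set of representatives for the cosets `A/B`. -/
def IsReps (A B : Set S.GG) (U : Finset S.GG) : Prop :=
  (↑U : Set S.GG) ⊆ A ∧ ∀ a ∈ A, ∃! u, u ∈ U ∧ a⁻¹ * u ∈ B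

/-- The residue field `k_E` of `E`. -/
abbrev kE := S.O ⧸ S.mI

/-- The residue map `o_E → k_E`. -/
def resmap : S.O →+* S.kE := Ideal.Quotient.mk S.mI

/-- The group `L_{q³} = {(x,t) ∈ k_E² : x x̄ + t + t̄ = 0}` (where `x̄ = x^q`). -/
def Lbig : Set (S.kE × S.kE) := {z | z.1 * z.1 ^ S.q + z.2 + z.2 ^ S.q = 0}

/-- The group `L_q = {(0,t) ∈ k_E² : t + t̄ = 0}`. -/
def Lsmall : Set (S.kE × S.kE) := {z | z.1 = 0 ∧ z.2 + z.2 ^ S.q = 0}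

/-- `L_{q^t}` for `t ∈ {1,3}`. -/
def Lof (t : ℕ) : Set (S.kE × S.kE) := if t = 3 then S.Lbig else S.Lsmall

end Setting

/-- A choice of one of the two maximal compact open subgroups `K ∈ {K₀, K₁}` of `G`,
together with its maximal normal pro-p subgroup `K¹`, the (pro-p) Iwahori subgroups
`I_K ⊇ I_{1,K}`, the opposite pro-p Iwahori `I'_{1,K}`, the element
`β_K ∈ K ∩ {β, β'}`, and the integers `n_K, m_K, t_K`. -/
structure Chamber (S : Setting) where
  K : Subgroup S.GG
  KoneS : Set S.GG
  IK : Set S.GG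
  I1 : Set S.GG
  I1' : Set S.GG
  βK : S.GG
  nK : ℤ
  mK : ℤ
  tK : ℕ
  cases :
    ((K : Set S.GG) = S.K0set ∧ KoneS = S.Kone0 ∧ IK = S.IK0 ∧ I1 = S.I1K0 ∧ I1' = S.I1'K0 ∧
      βK = S.betaE ∧ nK = 0 ∧ mK = 1 ∧ tK = 3) ∨
    ((K : Set S.GG) = S.K1set ∧ KoneS = S.Kone1 ∧ IK = S.IK1 ∧ I1 = S.I1K1 ∧ I1' = S.I1'K1 ∧
      βK = S.betaPr ∧ nK = -1 ∧ mK = 2 ∧ tK = 1)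

namespace Chamber

variable {S : Setting} (C : Chamber S)

/-- `H₀ = H ∩ I_K`. -/
def H0 : Set S.GG := S.Hset ∩ C.IK

/-- `H₁ = H ∩ I_{1,K}`. -/
def H1 : Set S.GG := S.Hset ∩ C.I1

end Chamber

section RepTheory

variable {S : Setting} (C : Chamber S)
variable (𝔽 : Type) [Field 𝔽]

section Generic

variable {G₀ : Type} [Monoid G₀] {V : Type} [AddCommGroup V] [Module 𝔽 V]

/-- A submodule is invariant under a representation. -/
def Invt (ρ : Representation 𝔽 G₀ V) (Ssub : Submodule 𝔽 V) : Prop :=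
  ∀ g v, v ∈ Ssub → ρ g v ∈ Ssub

/-- The subrepresentation generated by a vector (the span of its orbit). -/
def orbitSpan (ρ : Representation 𝔽 G₀ V) (v : V) : Submodule 𝔽 V :=
  Submodule.span 𝔽 {w | ∃ g, w = ρ g v}

/-- The subrepresentation generated by a vector under a subset `A` of the group. -/
def orbitSpanOn (ρ : Representation 𝔽 G₀ V) (A : Set G₀) (v : V) : Submodule 𝔽 V :=
  Submodule.span 𝔽 {w | ∃ g ∈ A, w = ρ g v}

/-- The quotient of a representation by an invariant submodule `N` is irreducible:
equivalently (by the lattice correspondence), `N ≠ ⊤` and any invariant submodule lying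
between `N` and `⊤` equals `N` or `⊤`. -/
def QuotientIrreducible (ρ : Representation 𝔽 G₀ V) (N : Submodule 𝔽 V) : Prop :=
  N ≠ ⊤ ∧ ∀ Ssub : Submodule 𝔽 V, Invt 𝔽 ρ Ssub → N ≤ Ssub → Ssub = N ∨ Ssub = ⊤

/-- The submodule of vectors invariant under all elements of the subset `A`. -/
def invariantsOn (ρ : Representation 𝔽 G₀ V) (A : Set G₀) : Submodule 𝔽 V where
  carrier := {v | ∀ g ∈ A, ρ g v = v}
  add_mem' := by
    intro a b ha hb g hg
    rw [map_add, ha g hg, hb g hg]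
  zero_mem' := by
    intro g hg
    rw [map_zero]
  smul_mem' := by
    intro c a ha g hg
    rw [map_smul, ha g hg]

/-- The space `Hom_G(ρ₁, ρ₂)` of equivariant linear maps, as a submodule of the linear maps. -/
def EquivHomSub {V₂ : Type} [AddCommGroup V₂] [Module 𝔽 V₂]
    (ρ₁ : Representation 𝔽 G₀ V) (ρ₂ : Representation 𝔽 G₀ V₂) :
    Submodule 𝔽 (V →ₗ[𝔽] V₂) where
  carrier := {φ | ∀ g x, φ (ρ₁ g x) = ρ₂ g (φ x)}
  add_mem' := by
    intro a b ha hb g x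
    simp only [LinearMap.add_apply, ha g x, hb g x, map_add]
  zero_mem' := by
    intro g x
    simp only [LinearMap.zero_apply, map_zero]
  smul_mem' := by
    intro c a ha g x
    simp only [LinearMap.smul_apply, ha g x, map_smul]

end Generic

section Weight

variable (W : Type) [AddCommGroup W] [Module 𝔽 W]
variable (σ : Representation 𝔽 ↥C.K W)

/-- Extension of `σ` to all of `G` (by `1` outside `K`); used to avoid coercion issues. -/
def sigma' : S.GG → Module.End 𝔽 W := fun g => if h : g ∈ C.K then σ ⟨g, h⟩ else 1

/-- `σ` is a weight of `K`: an irreducible smooth representation of `K` over `𝔽`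
factoring through `Γ_K = K / K¹` (automatically finite dimensional). -/
def IsWeight : Prop :=
  Nontrivial W ∧ FiniteDimensional 𝔽 W ∧
  (∀ Ssub : Submodule 𝔽 W, (∀ (k : ↥C.K) (w : W), w ∈ Ssub → σ k w ∈ Ssub) → Ssub = ⊥ ∨ Ssub = ⊤) ∧
  (∀ (g : S.GG) (hg : g ∈ C.K), g ∈ C.KoneS → σ ⟨g, hg⟩ = LinearMap.id)

/-- `σ` is one dimensional of the form `χ ∘ det`. -/
def IsDetWeight : Prop :=
  Module.finrank 𝔽 W = 1 ∧
  ∃ c : S.E → 𝔽, ∀ (g : S.GG) (hg : g ∈ C.K) (w : W), σ ⟨g, hg⟩ w = c ((S.mat g).det) • w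

/-- `j_σ : σ → σ` is the composition of the coinvariant projection `σ → σ_{I'_{1,K}}`
with the inverse of the natural isomorphism `σ^{I_{1,K}} ≅ σ_{I'_{1,K}}`:
it restricts to the identity on `σ^{I_{1,K}}` and kills the augmentation part of
`σ` with respect to `I'_{1,K}`. -/
def IsJ (jσ : W →ₗ[𝔽] W) : Prop :=
  (∀ w : W, (∀ g ∈ C.I1, sigma' C 𝔽 W σ g w = w) → jσ w = w) ∧
  (∀ (w : W) (g : S.GG), g ∈ C.I1' → jσ (sigma' C 𝔽 W σ g w - w) = 0)

/-- The defining conditions of the compact induction `ind_K^G σ`: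
`K`-equivariance on the left and compact support (finitely many cosets `K g`). -/
def IndCarrier : Set (S.GG → W) :=
  {f | (∀ (k : S.GG) (hk : k ∈ C.K) (g : S.GG), f (k * g) = σ ⟨k, hk⟩ (f g)) ∧
       ∃ s : Finset S.GG, ∀ g : S.GG, f g ≠ 0 → ∃ k ∈ C.K, ∃ t ∈ s, g = k * t}

/-- The compact induction `ind_K^G σ`, as a submodule of `G → W`. -/
def IndSub : Submodule 𝔽 (S.GG → W) where
  carrier := IndCarrier C 𝔽 W σ
  add_mem' := by
    rintro f g ⟨hf1, sf, hf2⟩ ⟨hg1, sg, hg2⟩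
    refine ⟨fun k hk x => by simp [hf1 k hk x, hg1 k hk x], sf ∪ sg, fun x hx => ?_⟩
    by_cases h : f x ≠ 0
    · obtain ⟨k, hk, t, ht, rfl⟩ := hf2 x h
      exact ⟨k, hk, t, Finset.mem_union_left _ ht, rfl⟩
    · push_neg at h
      have hgx : g x ≠ 0 := by
        intro h0
        apply hx
        simp [Pi.add_apply, h, h0]
      obtain ⟨k, hk, t, ht, rfl⟩ := hg2 x hgx
      exact ⟨k, hk, t, Finset.mem_union_right _ ht, rfl⟩
  zero_mem' := ⟨fun k hk g => by simp, ∅, fun g hg => absurd rfl hg⟩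
  smul_mem' := by
    rintro c f ⟨hf1, sf, hf2⟩
    refine ⟨fun k hk g => by simp [hf1 k hk g], sf, fun x hx => ?_⟩
    refine hf2 x ?_
    intro h0
    apply hx
    simp [h0]

lemma indAct_mem (g : S.GG) {f : S.GG → W} (hf : f ∈ IndCarrier C 𝔽 W σ) :
    (fun x => f (x * g)) ∈ IndCarrier C 𝔽 W σ := by
  obtain ⟨h1, s, h2⟩ := hf
  refine ⟨fun k hk x => ?_, s.image (· * g⁻¹), ?_⟩
  · show f (k * x * g) = _
    rw [mul_assoc]
    exact h1 k hk (x * g)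
  intro x hx
  obtain ⟨k, hk, t, ht, hxg⟩ := h2 (x * g) hx
  refine ⟨k, hk, t * g⁻¹, Finset.mem_image_of_mem _ ht, ?_⟩
  rw [← mul_assoc, ← hxg, mul_assoc, mul_inv_cancel, mul_one]

/-- The representation of `G` on `ind_K^G σ` by right translation. -/
def indRep : Representation 𝔽 S.GG ↥(IndSub C 𝔽 W σ) where
  toFun g :=
    { toFun := fun f => ⟨fun x => (f : S.GG → W) (x * g), indAct_mem C 𝔽 W σ g f.2⟩
      map_add' := fun f1 f2 => Subtype.ext (funext fun x => rfl)
      map_smul' := fun c f => Subtype.ext (funext fun x => rfl) }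
  map_one' := LinearMap.ext fun f => Subtype.ext (funext fun x => by simp [mul_one])
  map_mul' g h := LinearMap.ext fun f => Subtype.ext (funext fun x => by simp [mul_assoc])

/-- The function `[g, v] ∈ ind_K^G σ`: supported on `K g⁻¹`, with value `v` at `g⁻¹`. -/
def stdFn (g : S.GG) (v : W) : S.GG → W :=
  fun x => if h : x * g ∈ C.K then σ ⟨x * g, h⟩ v else 0

/-- The characterization of the family `f_n` (`n ∈ ℤ`) of `I_{1,K}`-invariant elements of
`ind_K^G σ`: `f_n` is supported on `K α⁻ⁿ I_{1,K}` and has value at `α⁻ⁿ` equal to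
`σ(β_K) v₀` for `n > 0` and `v₀` for `n ≤ 0`, where `v₀` is a fixed nonzero vector of
`σ^{I_{1,K}}`. -/
def IsFFamily (v0 : W) (ff : ℤ → ↥(IndSub C 𝔽 W σ)) : Prop :=
  v0 ≠ 0 ∧ (∀ g ∈ C.I1, sigma' C 𝔽 W σ g v0 = v0) ∧
  (∀ (n : ℤ) (g : S.GG), g ∈ C.I1 → indRep C 𝔽 W σ g (ff n) = ff n) ∧
  (∀ (n : ℤ) (x : S.GG), (ff n : S.GG → W) x ≠ 0 →
    ∃ k ∈ C.K, ∃ i ∈ C.I1, x = k * S.alphaE ^ (-n) * i) ∧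
  (∀ n : ℤ, 0 < n → (ff n : S.GG → W) (S.alphaE ^ (-n)) = sigma' C 𝔽 W σ C.βK v0) ∧
  (∀ n : ℤ, n ≤ 0 → (ff n : S.GG → W) (S.alphaE ^ (-n)) = v0)

/-- The characterization of the Hecke operator `T ∈ End_G(ind_K^G σ)`:
it is `G`-equivariant and satisfies
`T [1, v] = ∑_{u ∈ N_{n_K}/N_{n_K+2}} [u α⁻¹, j_σ σ(u⁻¹) v]
  + ∑_{u ∈ N_{n_K+1}/N_{n_K+2}} [β_K u α⁻¹, j_σ σ(β_K) v]`. -/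
def IsHeckeT (jσ : W →ₗ[𝔽] W) (T : Module.End 𝔽 ↥(IndSub C 𝔽 W σ)) : Prop :=
  (∀ (g : S.GG) (x : ↥(IndSub C 𝔽 W σ)),
    T (indRep C 𝔽 W σ g x) = indRep C 𝔽 W σ g (T x)) ∧
  (∀ (v : W) (x : ↥(IndSub C 𝔽 W σ)), (x : S.GG → W) = stdFn C 𝔽 W σ 1 v →
    ∀ (U2 U1 : Finset S.GG),
      S.IsReps (S.Nk C.nK) (S.Nk (C.nK + 2)) U2 →
      S.IsReps (S.Nk (C.nK + 1)) (S.Nk (C.nK + 2)) U1 →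
      ((T x : S.GG → W)) =
        (∑ u ∈ U2, stdFn C 𝔽 W σ (u * S.alphaE⁻¹) (jσ (sigma' C 𝔽 W σ u⁻¹ v))) +
        ∑ u ∈ U1, stdFn C 𝔽 W σ (C.βK * u * S.alphaE⁻¹) (jσ (sigma' C 𝔽 W σ C.βK v)))

/-- The eigencharacter `χ_σ` of `H₀/H₁` afforded by the (one-dimensional) space
`σ^{I_{1,K}}` with chosen basis vector `v₀`. -/
def IsChi (v0 : W) (χ : S.GG → 𝔽) : Prop :=
  (∀ h ∈ C.H0, sigma' C 𝔽 W σ h v0 = χ h • v0)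

/-- Right translation on functions `K → 𝔽` (the action on a (finite) principal series). -/
def PSact (k : ↥C.K) (f : ↥C.K → 𝔽) : ↥C.K → 𝔽 := fun x => f (x * k)

/-- The (inflation to `K` of the) finite principal series `Ind_𝔹^{Γ_K} χ`:
functions on `K`, invariant under right translation by `K¹`, left `I_{1,K}`-invariant and
left `(H₀, χ)`-equivariant. -/
def PSchiSub (χ : S.GG → 𝔽) : Submodule 𝔽 (↥C.K → 𝔽) where
  carrier := {f | (∀ b : ↥C.K, (b : S.GG) ∈ C.I1 → ∀ x, f (b * x) = f x) ∧
                  (∀ h : ↥C.K, (h : S.GG) ∈ C.H0 → ∀ x, f (h * x) = χ (h : S.GG) * f x) ∧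
                  (∀ z : ↥C.K, (z : S.GG) ∈ C.KoneS → ∀ x, f (x * z) = f x)}
  add_mem' := by
    rintro f g ⟨hf1, hf2, hf3⟩ ⟨hg1, hg2, hg3⟩
    exact ⟨fun b hb x => by simp [hf1 b hb x, hg1 b hb x],
           fun h hh x => by simp [hf2 h hh x, hg2 h hh x, mul_add],
           fun z hz x => by simp [hf3 z hz x, hg3 z hz x]⟩
  zero_mem' := ⟨fun b hb x => rfl, fun h hh x => by simp, fun z hz x => rfl⟩
  smul_mem' := by
    rintro c f ⟨hf1, hf2, hf3⟩
    refine ⟨fun b hb x => by simp [hf1 b hb x], fun h hh x => ?_, fun z hz x => by simp [hf3 z hz x]⟩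
    simp only [Pi.smul_apply, hf2 h hh x, smul_eq_mul]
    ring

/-- The principal series `Ind_𝔹^{Γ_K} 1` for the trivial character. -/
def PS1sub : Submodule 𝔽 (↥C.K → 𝔽) := PSchiSub C 𝔽 (fun _ => 1)

/-- `σ_{st}` is the Steinberg weight `st = (Ind_𝔹^{Γ_K} 1)/1`: there is a surjective
`K`-equivariant linear map from `Ind_𝔹^{Γ_K} 1` to it whose kernel is exactly the
constant functions. -/
def IsSteinberg {Wst : Type} [AddCommGroup Wst] [Module 𝔽 Wst]
    (σst : Representation 𝔽 ↥C.K Wst) : Prop :=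
  ∃ φ : ↥(PS1sub C 𝔽) →ₗ[𝔽] Wst, Function.Surjective φ ∧
    (∀ f : ↥(PS1sub C 𝔽), φ f = 0 ↔ ∃ c : 𝔽, (f : ↥C.K → 𝔽) = fun _ => c) ∧
    (∀ (k : ↥C.K) (f f' : ↥(PS1sub C 𝔽)),
      (f' : ↥C.K → 𝔽) = PSact C 𝔽 k (f : ↥C.K → 𝔽) → φ f' = σst k (φ f))

/-- `σ` is isomorphic to a twist of the Steinberg weight by a character. -/
def IsTwistSteinberg : Prop :=
  ∃ (c : ↥C.K →* 𝔽ˣ) (φ : ↥(PS1sub C 𝔽) →ₗ[𝔽] W), Function.Surjective φ ∧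
    (∀ f : ↥(PS1sub C 𝔽), φ f = 0 ↔ ∃ cc : 𝔽, (f : ↥C.K → 𝔽) = fun _ => cc) ∧
    (∀ (k : ↥C.K) (f f' : ↥(PS1sub C 𝔽)),
      (f' : ↥C.K → 𝔽) = PSact C 𝔽 k (f : ↥C.K → 𝔽) →
        φ f' = (c k : 𝔽) • σ k (φ f))


/-- The `K`-subrepresentation of the quotient `(ind_K^G σ) / (range T)` generated by the
image of a vector `v`. -/
def genQuot (T : Module.End 𝔽 ↥(IndSub C 𝔽 W σ)) (v : ↥(IndSub C 𝔽 W σ)) :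
    Submodule 𝔽 (↥(IndSub C 𝔽 W σ) ⧸ LinearMap.range T) :=
  Submodule.span 𝔽 {w | ∃ k ∈ C.K, w = Submodule.Quotient.mk (indRep C 𝔽 W σ k v)}

end Weight

/-- Smoothness of a representation of `G`: every vector is fixed by some congruence
subgroup (equivalently, has open stabilizer). -/
def SmoothRep {V : Type} [AddCommGroup V] [Module 𝔽 V] (ρ : Representation 𝔽 S.GG V) : Prop :=
  ∀ v : V, ∃ n : ℕ, ∀ g ∈ S.cong n, ρ g v = v

end RepTheory

end U21

namespace U21

namespace Setting

variable {S : Setting}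

lemma zpow_unif_mul (j k : ℤ) : S.ϖ ^ j * S.ϖ ^ k = S.ϖ ^ (j + k) := (zpow_add₀ S.unif_ne j k).symm

lemma zpow_unif_ne (k : ℤ) : S.ϖ ^ k ≠ 0 := zpow_ne_zero k S.unif_ne

lemma conj_zpow_unif (k : ℤ) : S.conj (S.ϖ ^ k) = S.ϖ ^ k := by
  rw [map_zpow₀, S.unif_conj]

lemma conj_ne_zero {x : S.E} (h : x ≠ 0) : S.conj x ≠ 0 := (map_ne_zero S.conj).2 h

lemma pE_zero {z : S.E} : z ∈ S.pE 0 ↔ z ∈ S.O := by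
  simp [pE]

lemma pE_zero_mem (k : ℤ) : (0 : S.E) ∈ S.pE k := ⟨0, S.O.zero_mem, by simp⟩

lemma pE_add {k : ℤ} {x y : S.E} (hx : x ∈ S.pE k) (hy : y ∈ S.pE k) : x + y ∈ S.pE k := by
  obtain ⟨a, ha, rfl⟩ := hx
  obtain ⟨b, hb, rfl⟩ := hy
  exact ⟨a + b, S.O.add_mem ha hb, by ring⟩

lemma pE_neg {k : ℤ} {x : S.E} (hx : x ∈ S.pE k) : -x ∈ S.pE k := by
  obtain ⟨a, ha, rfl⟩ := hx
  exact ⟨-a, S.O.neg_mem ha, by ring⟩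

lemma pE_neg_iff {k : ℤ} {x : S.E} : -x ∈ S.pE k ↔ x ∈ S.pE k :=
  ⟨fun h => by simpa using pE_neg h, pE_neg⟩

lemma pE_sub {k : ℤ} {x y : S.E} (hx : x ∈ S.pE k) (hy : y ∈ S.pE k) : x - y ∈ S.pE k := by
  rw [sub_eq_add_neg]; exact pE_add hx (pE_neg hy)

lemma pE_mul {j k l : ℤ} {x y : S.E} (hx : x ∈ S.pE j) (hy : y ∈ S.pE k) (h : l = j + k) :
    x * y ∈ S.pE l := by
  obtain ⟨a, ha, rfl⟩ := hx
  obtain ⟨b, hb, rfl⟩ := hy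
  exact ⟨a * b, S.O.mul_mem ha hb, by rw [h, ← zpow_unif_mul]; ring⟩

lemma zpow_unif_mem (k : ℤ) : S.ϖ ^ k ∈ S.pE k := ⟨1, S.O.one_mem, by simp⟩

lemma pE_mono {j k : ℤ} (h : j ≤ k) {x : S.E} (hx : x ∈ S.pE k) : x ∈ S.pE j := by
  obtain ⟨a, ha, rfl⟩ := hx
  obtain ⟨n, rfl⟩ := Int.le.dest h
  refine ⟨S.ϖ ^ n * a, S.O.mul_mem (S.O.pow_mem S.unif_mem n) ha, ?_⟩
  rw [← zpow_unif_mul, zpow_natCast]; ring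

lemma pE_mul_le {j k l : ℤ} {x y : S.E} (hx : x ∈ S.pE j) (hy : y ∈ S.pE k) (h : l ≤ j + k) :
    x * y ∈ S.pE l :=
  pE_mono h (pE_mul hx hy rfl)

lemma pE_conj {k : ℤ} {x : S.E} (hx : x ∈ S.pE k) : S.conj x ∈ S.pE k := by
  obtain ⟨a, ha, rfl⟩ := hx
  exact ⟨S.conj a, S.conj_O a ha, by rw [map_mul, conj_zpow_unif]⟩

lemma pE_conj_iff {k : ℤ} {x : S.E} : S.conj x ∈ S.pE k ↔ x ∈ S.pE k :=
  ⟨fun h => by simpa [S.conj_invol] using pE_conj h, pE_conj⟩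

lemma one_mem_pE : (1 : S.E) ∈ S.pE 0 := pE_zero.2 S.O.one_mem

lemma one_not_mem_pE : (1 : S.E) ∉ S.pE 1 := by
  rintro ⟨w, hw, h⟩
  refine S.unif_not_unit (IsUnit.of_mul_eq_one ⟨w, hw⟩ (Subtype.ext ?_))
  simpa using h.symm

lemma le_zero_of_one_mem {k : ℤ} (h : (1 : S.E) ∈ S.pE k) : k ≤ 0 := by
  by_contra hk
  exact one_not_mem_pE (pE_mono (by omega) h)

lemma exists_val {x : S.E} (hx : x ≠ 0) : ∃ n : ℤ, x ∈ S.pE n ∧ x⁻¹ ∈ S.pE (-n) := by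
  obtain ⟨n, u, rfl⟩ := S.disc x hx
  have hu : ((u : S.O) : S.E) * ((u⁻¹ : S.Oˣ) : S.O) = 1 := by
    exact_mod_cast congrArg (Subtype.val) (u.mul_inv)
  refine ⟨n, ⟨_, (u : S.O).2, mul_comm _ _⟩, ⟨_, ((u⁻¹ : S.Oˣ) : S.O).2, ?_⟩⟩
  rw [mul_inv, zpow_neg, eq_comm, mul_comm, ← eq_inv_of_mul_eq_one_right hu]

lemma le_of_inv_mem {x : S.E} (hx : x ≠ 0) {m n : ℤ} (h : x⁻¹ ∈ S.pE (-n)) (h' : x ∈ S.pE m) :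
    m ≤ n := by
  have := pE_mul h' h rfl
  rw [mul_inv_cancel₀ hx] at this
  have := le_zero_of_one_mem this
  omega

lemma ne_zero_of_not_mem {x : S.E} {k : ℤ} (h : x ∉ S.pE k) : x ≠ 0 := by
  rintro rfl; exact h (pE_zero_mem k)

lemma inv_mem_of_not_mem {x : S.E} {n : ℤ} (h : x ∉ S.pE (n + 1)) : x⁻¹ ∈ S.pE (-n) := by
  obtain ⟨m, hm, hm'⟩ := exists_val (ne_zero_of_not_mem h)
  refine pE_mono ?_ hm'
  by_contra hlt
  exact h (pE_mono (by omega) hm)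

lemma not_mem_of_inv_mem {x : S.E} (hx : x ≠ 0) {n : ℤ} (h : x⁻¹ ∈ S.pE (-n)) :
    x ∉ S.pE (n + 1) := fun h' => by
  have := le_of_inv_mem hx h h'
  omega

lemma pE_of_norm {x : S.E} {k : ℤ} (h : x * S.conj x ∈ S.pE (2 * k - 1)) : x ∈ S.pE k := by
  by_contra hx
  have hx' : x ∉ S.pE (k - 1 + 1) := by simpa using hx
  have h0 := ne_zero_of_not_mem hx
  have h1 := inv_mem_of_not_mem hx'
  have h2 := pE_conj h1
  rw [map_inv₀] at h2
  have h3 := pE_mul h1 h2 rfl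
  rw [← mul_inv] at h3
  have := le_of_inv_mem (mul_ne_zero h0 (conj_ne_zero h0)) (n := 2 * k - 2)
    (by convert h3 using 2; ring) h
  omega

/-- An element congruent to a unit modulo the maximal ideal is a unit. -/
lemma unit_of_sub_one {x : S.E} (h : x - 1 ∈ S.pE 1) :
    x ∈ S.pE 0 ∧ x ≠ 0 ∧ x⁻¹ ∈ S.pE 0 ∧ x⁻¹ - 1 ∈ S.pE 1 := by
  have hx : x ∈ S.pE 0 := by
    have := pE_add (pE_mono (by norm_num : (0 : ℤ) ≤ 1) h) one_mem_pE
    simpa using this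
  have hx1 : x ∉ S.pE (0 + 1) := fun hx1 => by
    have := pE_sub hx1 h
    simp at this
    exact one_not_mem_pE this
  have h0 := ne_zero_of_not_mem hx1
  have hi : x⁻¹ ∈ S.pE 0 := by simpa using inv_mem_of_not_mem hx1
  refine ⟨hx, h0, hi, ?_⟩
  have := pE_neg (pE_mul hi h (l := 1) (by norm_num))
  convert this using 1
  field_simp
  ring

lemma mem_mI {x : S.O} : x ∈ S.mI ↔ (x : S.E) ∈ S.pE 1 := by
  rw [S.hmI]
  simp [pE]

lemma resmap_eq_zero {x : S.O} : S.resmap x = 0 ↔ (x : S.E) ∈ S.pE 1 := by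
  rw [resmap, Ideal.Quotient.eq_zero_iff_mem, mem_mI]

lemma resmap_eq {x y : S.O} : S.resmap x = S.resmap y ↔ (x : S.E) - y ∈ S.pE 1 := by
  rw [← sub_eq_zero, ← map_sub, resmap_eq_zero]; rfl

lemma resmap_conj (x : S.O) : S.resmap ⟨S.conj x, S.conj_O x x.2⟩ = S.resmap x ^ S.q :=
  S.res_frob x

instance isMaximal_mI : S.mI.IsMaximal := by
  refine Ideal.isMaximal_iff.2 ⟨fun h => one_not_mem_pE (by simpa using mem_mI.1 h), ?_⟩
  intro J x hJ hx hxJ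
  have hx1 : (x : S.E) ∉ S.pE (0 + 1) := fun h => hx (mem_mI.2 h)
  have hi := inv_mem_of_not_mem hx1
  simp only [neg_zero, pE_zero] at hi
  have : (1 : S.O) = ⟨(x : S.E)⁻¹, hi⟩ * x :=
    Subtype.ext (by simp [inv_mul_cancel₀ (ne_zero_of_not_mem hx1)])
  rw [this]
  exact J.mul_mem_left _ hxJ

instance fieldkE : Field S.kE := Ideal.Quotient.field S.mI

lemma card_kE : Fintype.card S.kE = S.q ^ 2 := S.card_res

lemma one_lt_q : 1 < S.q := by
  rw [S.hq]; exact Nat.one_lt_pow S.hfdeg.ne' S.hp.one_lt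

lemma cast_p_kE : (S.p : S.kE) = 0 := by
  have h : ((Fintype.card S.kE : ℕ) : S.kE) = 0 := FiniteField.cast_card_eq_zero S.kE
  rw [card_kE, S.hq, Nat.cast_pow, Nat.cast_pow] at h
  exact pow_eq_zero_iff (two_ne_zero) |>.1 h |> fun h => (pow_eq_zero_iff S.hfdeg.ne').1 h

lemma p_mem_pE : (S.p : S.E) ∈ S.pE 1 := by
  have h : S.resmap (S.p : S.O) = 0 := by rw [map_natCast, cast_p_kE]
  simpa using resmap_eq_zero.1 h

lemma two_ne_and_inv : (2 : S.E) ≠ 0 ∧ (2 : S.E)⁻¹ ∈ S.O := by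
  have h2 : (2 : S.E) ∉ S.pE (0 + 1) := by
    intro h
    obtain ⟨k, hk⟩ := S.hp.odd_of_ne_two S.hodd
    have hp := S.p_mem_pE
    rw [hk] at hp
    have := pE_sub hp (pE_mul (l := 1) h (pE_zero.2 (natCast_mem S.O k)) (by norm_num))
    push_cast at this
    simp at this
    exact one_not_mem_pE this
  exact ⟨ne_zero_of_not_mem h2, by simpa [pE_zero] using inv_mem_of_not_mem h2⟩

/-- There is a unit of trace zero. -/
lemma exists_trace_zero_unit : ∃ t : S.E, t ∈ S.pE 0 ∧ t ∉ S.pE 1 ∧ S.conj t = -t := by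
  obtain ⟨x, hx⟩ : ∃ x, S.conj x ≠ x := by
    by_contra! h
    exact S.conj_ne (RingHom.ext h)
  have h0 : x - S.conj x ≠ 0 := sub_ne_zero.2 hx.symm
  obtain ⟨n, h1, h2⟩ := exists_val h0
  have h3 := not_mem_of_inv_mem h0 h2
  refine ⟨S.ϖ ^ (-n) * (x - S.conj x), pE_mul (zpow_unif_mem _) h1 (by ring), fun h => h3 ?_, ?_⟩
  · have := pE_mul (l := n + 1) (zpow_unif_mem n) h rfl
    rwa [← mul_assoc, zpow_unif_mul, add_neg_cancel, zpow_zero, one_mul] at this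
  · rw [map_mul, conj_zpow_unif, map_sub, S.conj_invol]; ring

end Setting
end U21

namespace U21

namespace Setting

variable {S : Setting}

lemma mat_mul (g h : S.GG) : S.mat (g * h) = S.mat g * S.mat h := rfl

lemma mat_one : S.mat 1 = 1 := rfl

lemma mat_inj {g h : S.GG} (H : S.mat g = S.mat h) : g = h :=
  Subtype.ext (Units.ext H)

lemma mat_rel (g : S.GG) : (S.mat g).transpose * S.betaM * (S.mat g).map S.conj = S.betaM := g.2

/-- The element of `G` with a given matrix. -/
def mkG (M : S.M3) (h : M.transpose * S.betaM * M.map S.conj = S.betaM) : S.GG :=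
  ⟨Matrix.GeneralLinearGroup.mkOfDetNeZero M (fun h0 => by
    have h1 := congrArg Matrix.det h
    have h2 := congrArg Matrix.det S.beta_mul_beta
    rw [Matrix.det_mul, Matrix.det_mul, Matrix.det_transpose, h0, zero_mul, zero_mul] at h1
    rw [Matrix.det_mul, ← h1, zero_mul, Matrix.det_one] at h2
    exact zero_ne_one h2), h⟩

lemma mat_inv (g : S.GG) :
    S.mat g⁻¹ = S.betaM * ((S.mat g).map S.conj).transpose * S.betaM := by
  have h1 : S.betaM * ((S.mat g).map S.conj).transpose * S.betaM * S.mat g = 1 := by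
    have h := congrArg (fun M : S.M3 => (M.map S.conj)) (S.mat_rel g)
    simp only [Matrix.map_mul, Matrix.map_map] at h
    have hb : S.betaM.map S.conj = S.betaM := by
      ext i j; fin_cases i <;> fin_cases j <;> simp [betaM]
    have hc : (S.mat g).map (⇑S.conj ∘ ⇑S.conj) = S.mat g := by
      ext i j; simp [S.conj_invol]
    rw [hb, hc, Matrix.transpose_map] at h
    rw [mul_assoc, mul_assoc, ← mul_assoc (Matrix.transpose _), h, S.beta_mul_beta]
  have h2 : S.mat g * S.mat g⁻¹ = 1 := by rw [← mat_mul, mul_inv_cancel, mat_one]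
  calc S.mat g⁻¹ = (S.betaM * ((S.mat g).map S.conj).transpose * S.betaM * S.mat g) * S.mat g⁻¹ := by
        rw [h1, one_mul]
    _ = _ := by rw [mul_assoc _ (S.mat g), h2, mul_one]

lemma mat_inv_apply (g : S.GG) (i j : Fin 3) :
    S.mat g⁻¹ i j = S.conj (S.mat g (Fin.rev j) (Fin.rev i)) := by
  rw [mat_inv]
  fin_cases i <;> fin_cases j <;>
    simp [betaM, Matrix.mul_apply, Fin.sum_univ_three, Fin.rev, Matrix.vecMul, dotProduct]

lemma col_rel (g : S.GG) (i j : Fin 3) :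
    S.mat g 0 i * S.conj (S.mat g 2 j) + S.mat g 1 i * S.conj (S.mat g 1 j)
      + S.mat g 2 i * S.conj (S.mat g 0 j) = S.betaM i j := by
  have h := congrFun (congrFun (S.mat_rel g) i) j
  simp only [Matrix.mul_apply, Fin.sum_univ_three, Matrix.transpose_apply, Matrix.map_apply] at h
  rw [← h]
  simp [betaM]
  ring

lemma row_rel (g : S.GG) (i j : Fin 3) :
    S.mat g i 0 * S.conj (S.mat g j 2) + S.mat g i 1 * S.conj (S.mat g j 1)
      + S.mat g i 2 * S.conj (S.mat g j 0) = S.betaM i j := by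
  have h : S.mat g * S.mat g⁻¹ = 1 := by rw [← mat_mul, mul_inv_cancel, mat_one]
  have h := congrFun (congrFun h i) (Fin.rev j)
  simp only [Matrix.mul_apply, Fin.sum_univ_three, mat_inv_apply, Fin.rev_rev] at h
  have e : (1 : S.M3) i (Fin.rev j) = S.betaM i j := by
    revert i j
    intro i j _
    fin_cases i <;> fin_cases j <;> simp [betaM, Matrix.one_apply, Fin.ext_iff]
  rw [← e, ← h]
  simp [Fin.rev]

/-- The relation defining the unipotent elements `n(x,y)` and `n'(x,y)`. -/
def Rel (x y : S.E) : Prop := x * S.conj x + y + S.conj y = 0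

lemma Rel.mem {x y : S.E} (h : S.Rel x y) {k m : ℤ} (hy : y ∈ S.pE k) (hm : 2 * m - 1 ≤ k) :
    x ∈ S.pE m := by
  apply pE_of_norm
  have : x * S.conj x = -(y + S.conj y) := by unfold Rel at h; linear_combination h
  rw [this]
  exact pE_mono hm (pE_neg (pE_add hy (pE_conj hy)))

/-- The element `n(x,y)` of `G`. -/
def nE (x y : S.E) (h : S.Rel x y) : S.GG := mkG (S.nM x y) (by
  unfold Rel at h
  ext i j
  fin_cases i <;> fin_cases j <;>
    simp [nM, betaM, Matrix.mul_apply, Fin.sum_univ_three, S.conj_invol]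
  linear_combination h)

/-- The element `n'(x,y)` of `G`. -/
def nE' (x y : S.E) (h : S.Rel x y) : S.GG := mkG (S.n'M x y) (by
  unfold Rel at h
  ext i j
  fin_cases i <;> fin_cases j <;>
    simp [n'M, betaM, Matrix.mul_apply, Fin.sum_univ_three, S.conj_invol]
  linear_combination h)

@[simp] lemma mat_nE (x y : S.E) (h) : S.mat (nE x y h) = S.nM x y := rfl

@[simp] lemma mat_nE' (x y : S.E) (h) : S.mat (nE' x y h) = S.n'M x y := rfl

lemma nE_mem {x y : S.E} (h : S.Rel x y) {k : ℤ} (hy : y ∈ S.pE k) : nE x y h ∈ S.Nk k :=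
  ⟨x, y, h, hy, rfl⟩

lemma nE'_mem {x y : S.E} (h : S.Rel x y) {k : ℤ} (hy : y ∈ S.pE k) : nE' x y h ∈ S.N'k k :=
  ⟨x, y, h, hy, rfl⟩

lemma mat_nE_inv (x y : S.E) (h : S.Rel x y) :
    S.mat (nE x y h)⁻¹ = !![1, -x, S.conj y; 0, 1, S.conj x; 0, 0, 1] := by
  ext i j
  rw [mat_inv_apply]
  fin_cases i <;> fin_cases j <;> simp [nM, Fin.rev, S.conj_invol]

lemma mat_nE'_inv (x y : S.E) (h : S.Rel x y) :
    S.mat (nE' x y h)⁻¹ = !![1, 0, 0; -x, 1, 0; S.conj y, S.conj x, 1] := by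
  ext i j
  rw [mat_inv_apply]
  fin_cases i <;> fin_cases j <;> simp [n'M, Fin.rev, S.conj_invol]

lemma eq_nE {g : S.GG} {k : ℤ} (hg : g ∈ S.Nk k) : ∃ x y, ∃ h : S.Rel x y, y ∈ S.pE k ∧ g = nE x y h := by
  obtain ⟨x, y, h, hy, hm⟩ := hg
  exact ⟨x, y, h, hy, mat_inj hm⟩

lemma eq_nE' {g : S.GG} {k : ℤ} (hg : g ∈ S.N'k k) :
    ∃ x y, ∃ h : S.Rel x y, y ∈ S.pE k ∧ g = nE' x y h := by
  obtain ⟨x, y, h, hy, hm⟩ := hg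
  exact ⟨x, y, h, hy, mat_inj hm⟩

lemma Nk_mono {j k : ℤ} (h : j ≤ k) : S.Nk k ⊆ S.Nk j := by
  rintro g ⟨x, y, h1, h2, h3⟩
  exact ⟨x, y, h1, pE_mono h h2, h3⟩

lemma N'k_mono {j k : ℤ} (h : j ≤ k) : S.N'k k ⊆ S.N'k j := by
  rintro g ⟨x, y, h1, h2, h3⟩
  exact ⟨x, y, h1, pE_mono h h2, h3⟩

/-- `N_k` as a subgroup of `G`. -/
def NS (S : Setting) (k : ℤ) : Subgroup S.GG where
  carrier := S.Nk k
  one_mem' := ⟨0, 0, by simp, pE_zero_mem k, by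
    rw [mat_one]; ext i j; fin_cases i <;> fin_cases j <;> simp [nM]⟩
  mul_mem' := by
    rintro a b ⟨x, y, h, hy, hm⟩ ⟨x', y', h', hy', hm'⟩
    have hx : x ∈ S.pE ((k + 1) / 2) := Rel.mem h hy (by omega)
    have hx' : x' ∈ S.pE ((k + 1) / 2) := Rel.mem h' hy' (by omega)
    refine ⟨x + x', y + y' - x * S.conj x', ?_, ?_, ?_⟩
    · simp only [map_add, map_sub, map_mul, S.conj_invol]
      linear_combination h + h'
    · exact pE_sub (pE_add hy hy') (pE_mul_le hx (pE_conj hx') (by omega))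
    · rw [mat_mul, hm, hm']
      ext i j
      fin_cases i <;> fin_cases j <;> simp [nM, Matrix.mul_apply, Fin.sum_univ_three] <;> ring
  inv_mem' := by
    intro g hg
    obtain ⟨x, y, h, hy, rfl⟩ := eq_nE hg
    refine ⟨-x, S.conj y, ?_, pE_conj hy, ?_⟩
    · unfold Rel at h
      simp only [map_neg, S.conj_invol]
      linear_combination h
    · rw [mat_nE_inv, nM, map_neg, neg_neg]

lemma NS_mono {j k : ℤ} (h : j ≤ k) : S.NS k ≤ S.NS j := Nk_mono h

lemma mem_Nk_iff {j k : ℤ} {g : S.GG} (hg : g ∈ S.Nk j) : g ∈ S.Nk k ↔ S.mat g 0 2 ∈ S.pE k := by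
  obtain ⟨x, y, h, hy, hm⟩ := hg
  rw [hm]
  constructor
  · rintro ⟨x', y', h', hy', hm'⟩
    rw [← hm, hm']
    simpa [nM] using hy'
  · intro h2
    exact ⟨x, y, h, by simpa [nM] using h2, hm⟩

lemma mem_Nk_mk {x y : S.E} {h : S.Rel x y} {k : ℤ} : nE x y h ∈ S.Nk k ↔ y ∈ S.pE k := by
  refine ⟨?_, nE_mem h⟩
  rintro ⟨x', y', -, hy', hm'⟩
  have := congrFun (congrFun hm' 0) 2
  simp [nM] at this
  rwa [this]

/-- A diagonal element of `G`. -/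
def dE (a m : S.E) (ha : a ≠ 0) (hm : m * S.conj m = 1) : S.GG :=
  mkG !![a, 0, 0; 0, m, 0; 0, 0, (S.conj a)⁻¹] (by
    have := conj_ne_zero ha
    ext i j
    fin_cases i <;> fin_cases j <;>
      simp [betaM, Matrix.mul_apply, Fin.sum_univ_three, S.conj_invol, ha, hm, this])

@[simp] lemma mat_dE (a m : S.E) (ha hm) :
    S.mat (dE a m ha hm) = !![a, 0, 0; 0, m, 0; 0, 0, (S.conj a)⁻¹] := rfl

/-- Elements of `G` with trivial first row and column off the diagonal are diagonal. -/
lemma eq_dE {g : S.GG} (h1 : S.mat g 1 0 = 0) (h2 : S.mat g 2 0 = 0) (h3 : S.mat g 0 1 = 0)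
    (h4 : S.mat g 0 2 = 0) :
    ∃ (ha : S.mat g 0 0 ≠ 0) (hm : S.mat g 1 1 * S.conj (S.mat g 1 1) = 1),
      g = dE (S.mat g 0 0) (S.mat g 1 1) ha hm := by
  have c02 := col_rel g 0 2
  have c01 := col_rel g 0 1
  have c11 := col_rel g 1 1
  have r01 := row_rel g 0 1
  simp only [h1, h2, h3, h4, betaM, map_zero, mul_zero, zero_mul, add_zero, zero_add] at c02 c01 c11 r01
  simp at c02 c01 c11 r01
  have ha : S.mat g 0 0 ≠ 0 := by
    intro h; rw [h, zero_mul] at c02; exact zero_ne_one c02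
  have c21 : S.mat g 2 1 = 0 := by simpa [ha] using c01
  have c12 : S.mat g 1 2 = 0 := by simpa [ha] using r01
  have c22 : S.mat g 2 2 = (S.conj (S.mat g 0 0))⁻¹ := by
    have := congrArg S.conj c02
    rw [map_mul, S.conj_invol, map_one] at this
    exact eq_inv_of_mul_eq_one_right this
  refine ⟨ha, by simpa using c11, mat_inj ?_⟩
  rw [mat_dE]
  ext i j
  fin_cases i <;> fin_cases j <;> simp [h1, h2, h3, h4, c21, c12, c22]

/-- Factorization of elements of `G` in the big cell `N' H N`. -/
lemma exists_ldu (g : S.GG) (ha : S.mat g 0 0 ≠ 0) :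
    ∃ (h' : S.Rel (S.mat g 1 0 / S.mat g 0 0) (S.mat g 2 0 / S.mat g 0 0))
      (h : S.Rel (S.mat g 0 1 / S.mat g 0 0) (S.mat g 0 2 / S.mat g 0 0))
      (m : S.E) (hm : m * S.conj m = 1),
      (S.mat g).det = S.mat g 0 0 * m * (S.conj (S.mat g 0 0))⁻¹ ∧
      g = nE' _ _ h' * dE (S.mat g 0 0) m ha hm * nE _ _ h := by
  have ha' := conj_ne_zero ha
  have c00 := col_rel g 0 0
  have r00 := row_rel g 0 0
  simp [betaM] at c00 r00
  have h' : S.Rel (S.mat g 1 0 / S.mat g 0 0) (S.mat g 2 0 / S.mat g 0 0) := by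
    unfold Rel
    rw [map_div₀, map_div₀]
    field_simp
    linear_combination c00
  have h : S.Rel (S.mat g 0 1 / S.mat g 0 0) (S.mat g 0 2 / S.mat g 0 0) := by
    unfold Rel
    rw [map_div₀, map_div₀]
    field_simp
    linear_combination r00
  set k : S.GG := (nE' _ _ h')⁻¹ * g * (nE _ _ h)⁻¹ with hk
  have h'' := h'
  have h0 := h
  unfold Rel at h'' h0
  rw [map_div₀, map_div₀] at h'' h0
  field_simp at h'' h0
  have k00 : S.mat k 0 0 = S.mat g 0 0 := by
    simp [hk, mat_mul, mat_nE_inv, mat_nE'_inv, Matrix.mul_apply, Fin.sum_univ_three,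
      Matrix.vecMul, dotProduct]
  have k10 : S.mat k 1 0 = 0 := by
    simp [hk, mat_mul, mat_nE_inv, mat_nE'_inv, Matrix.mul_apply, Fin.sum_univ_three,
      Matrix.vecMul, dotProduct]
    field_simp; ring
  have k20 : S.mat k 2 0 = 0 := by
    simp [hk, mat_mul, mat_nE_inv, mat_nE'_inv, Matrix.mul_apply, Fin.sum_univ_three,
      Matrix.vecMul, dotProduct]
    field_simp
    linear_combination h''
  have k01 : S.mat k 0 1 = 0 := by
    simp [hk, mat_mul, mat_nE_inv, mat_nE'_inv, Matrix.mul_apply, Fin.sum_univ_three,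
      Matrix.vecMul, dotProduct]
    field_simp; ring
  have k02 : S.mat k 0 2 = 0 := by
    simp [hk, mat_mul, mat_nE_inv, mat_nE'_inv, Matrix.mul_apply, Fin.sum_univ_three,
      Matrix.vecMul, dotProduct]
    field_simp
    linear_combination h0
  obtain ⟨ha1, hm, hd⟩ := eq_dE k10 k20 k01 k02
  refine ⟨h', h, S.mat k 1 1, hm, ?_⟩
  have : dE (S.mat g 0 0) (S.mat k 1 1) ha hm = k := by
    refine Eq.trans (mat_inj ?_) hd.symm
    rw [mat_dE, mat_dE, k00]
  have e : g = nE' _ _ h' * dE (S.mat g 0 0) (S.mat k 1 1) ha hm * nE _ _ h := by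
    rw [this, hk]
    group
  refine ⟨?_, e⟩
  have hd := congrArg (fun z => (S.mat z).det) e
  simp only [mat_mul, Matrix.det_mul] at hd
  rw [hd]
  simp [Matrix.det_fin_three, nM, n'M]

/-- `α ^ j`, written as a diagonal element. -/
lemma mat_alpha_zpow (j : ℤ) :
    S.mat (S.alphaE ^ j) = !![S.ϖ ^ (-j), 0, 0; 0, 1, 0; 0, 0, S.ϖ ^ j] := by
  have key : ∀ j : ℤ, S.alphaE ^ j = dE (S.ϖ ^ (-j)) 1 (zpow_unif_ne _) (by simp) := by
    intro j
    have h1 : S.alphaE = dE (S.ϖ ^ (-(1 : ℤ))) 1 (zpow_unif_ne _) (by simp) := mat_inj (by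
      rw [mat_dE, conj_zpow_unif]
      show S.alphaM = _
      simp [alphaM])
    have hmul : ∀ i k : ℤ, dE (S.ϖ ^ (-(i + k))) 1 (zpow_unif_ne _) (by simp)
        = dE (S.ϖ ^ (-i)) 1 (zpow_unif_ne _) (by simp) *
          dE (S.ϖ ^ (-k)) 1 (zpow_unif_ne _) (by simp) := by
      intro i k
      refine mat_inj ?_
      have := S.unif_ne
      rw [mat_mul, mat_dE, mat_dE, mat_dE, conj_zpow_unif, conj_zpow_unif, conj_zpow_unif]
      ext a b
      fin_cases a <;> fin_cases b <;> simp [Matrix.mul_apply, Fin.sum_univ_three, zpow_add₀ this]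
      ring
    have hz : dE (S.ϖ ^ (-(0 : ℤ))) 1 (zpow_unif_ne _) (by simp) = (1 : S.GG) := mat_inj (by
      rw [mat_dE, mat_one]
      ext a b
      fin_cases a <;> fin_cases b <;> simp)
    induction j using Int.induction_on with
    | zero => rw [zpow_zero, hz]
    | succ i ih => rw [zpow_add, zpow_one, hmul, ih, ← h1]
    | pred i ih =>
      have := hmul (-(i : ℤ) - 1) 1
      rw [sub_add_cancel, ← h1] at this
      rw [zpow_sub, zpow_one, ih, this]
      group
  rw [key, mat_dE, conj_zpow_unif, zpow_neg, inv_inv]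

/-- The element `β * α ^ (-r)`. -/
def bE (S : Setting) (r : ℤ) : S.GG := S.betaE * S.alphaE ^ (-r)

lemma mat_bE (r : ℤ) : S.mat (S.bE r) = !![0, 0, S.ϖ ^ (-r); 0, 1, 0; S.ϖ ^ r, 0, 0] := by
  rw [bE, mat_mul, mat_alpha_zpow]
  have : S.mat S.betaE = S.betaM := rfl
  rw [this]
  ext a b
  fin_cases a <;> fin_cases b <;> simp [betaM, Matrix.mul_apply, Fin.sum_univ_three]

lemma bE_mul_bE (r : ℤ) : S.bE r * S.bE r = 1 := by
  refine mat_inj ?_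
  have := zpow_unif_ne (S := S) r
  rw [mat_mul, mat_bE, mat_one]
  ext a b
  fin_cases a <;> fin_cases b <;> simp [Matrix.mul_apply, Fin.sum_univ_three, this]

lemma bE_inv (r : ℤ) : (S.bE r)⁻¹ = S.bE r := inv_eq_of_mul_eq_one_right (bE_mul_bE r)

lemma bE_zero : S.bE 0 = S.betaE := by simp [bE]

lemma bE_mul_alpha (r j : ℤ) : S.bE r * S.alphaE ^ j = S.bE (r - j) := by
  rw [bE, bE, mul_assoc, ← zpow_add]; congr 2; ring

lemma alpha_mul_bE (r j : ℤ) : S.alphaE ^ j * S.bE r = S.bE (r + j) := by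
  have h : S.bE r * S.alphaE ^ (-j) = S.bE (r + j) := by rw [bE_mul_alpha]; congr 1; ring
  rw [← bE_inv (r + j), ← h, mul_inv_rev, bE_inv, zpow_neg, inv_inv]

lemma alpha_conj_n' {k : ℤ} (j : ℤ) {g : S.GG} (hg : g ∈ S.N'k k) :
    S.alphaE ^ j * g * S.alphaE ^ (-j) ∈ S.N'k (k + 2 * j) := by
  obtain ⟨x, y, h, hy, hm⟩ := hg
  have hw := zpow_unif_ne (S := S) j
  refine ⟨S.ϖ ^ j * x, S.ϖ ^ (2 * j) * y, ?_, pE_mul (zpow_unif_mem _) hy (by ring), ?_⟩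
  · rw [map_mul, map_mul, conj_zpow_unif, conj_zpow_unif, two_mul, ← zpow_unif_mul]
    linear_combination (S.ϖ ^ j * S.ϖ ^ j) * h
  · rw [mat_mul, mat_mul, mat_alpha_zpow, mat_alpha_zpow, hm]
    ext a b
    fin_cases a <;> fin_cases b <;> simp [n'M, Matrix.mul_apply, Fin.sum_univ_three, hw,
      map_zpow₀, S.unif_conj, two_mul, ← zpow_unif_mul] <;> ring

lemma bE_conj_n {k : ℤ} (r : ℤ) {g : S.GG} (hg : g ∈ S.Nk k) :
    S.bE r * g * S.bE r ∈ S.N'k (k + 2 * r) := by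
  obtain ⟨x, y, h, hy, hm⟩ := hg
  have hw := zpow_unif_ne (S := S) r
  refine ⟨-(S.ϖ ^ r * S.conj x), S.ϖ ^ (2 * r) * y, ?_, pE_mul (zpow_unif_mem _) hy (by ring), ?_⟩
  · rw [map_neg, map_mul, map_mul, conj_zpow_unif, conj_zpow_unif, two_mul, ← zpow_unif_mul,
      S.conj_invol]
    linear_combination (S.ϖ ^ r * S.ϖ ^ r) * h
  · rw [mat_mul, mat_mul, mat_bE, hm]
    ext a b
    fin_cases a <;> fin_cases b <;> simp [n'M, nM, Matrix.mul_apply, Fin.sum_univ_three, hw,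
      map_zpow₀, S.unif_conj, two_mul, ← zpow_unif_mul, S.conj_invol] <;> ring

lemma bE_conj_n' {k : ℤ} (r : ℤ) {g : S.GG} (hg : g ∈ S.N'k k) :
    S.bE r * g * S.bE r ∈ S.Nk (k - 2 * r) := by
  obtain ⟨x, y, h, hy, hm⟩ := hg
  have hw := zpow_unif_ne (S := S) r
  refine ⟨-(S.ϖ ^ (-r) * S.conj x), S.ϖ ^ (-(2 * r)) * y, ?_,
    pE_mul (zpow_unif_mem _) hy (by ring), ?_⟩
  · have e : -(2 * r) = -r + -r := by ring
    rw [map_neg, map_mul, map_mul, conj_zpow_unif, conj_zpow_unif, e, ← zpow_unif_mul,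
      S.conj_invol]
    linear_combination (S.ϖ ^ (-r) * S.ϖ ^ (-r)) * h
  · have e : -(2 * r) = -r + -r := by ring
    rw [mat_mul, mat_mul, mat_bE, hm, e, ← zpow_unif_mul]
    ext a b
    fin_cases a <;> fin_cases b <;> simp [n'M, nM, Matrix.mul_apply, Fin.sum_univ_three, hw,
      map_zpow₀, S.unif_conj, S.conj_invol] <;> ring

lemma hM_norm {a : S.E} (ha : a ≠ 0) :
    (-S.conj a * a⁻¹) * S.conj (-S.conj a * a⁻¹) = 1 := by
  have := conj_ne_zero ha
  simp only [map_mul, map_neg, map_inv₀, S.conj_invol]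
  field_simp

/-- The element `h(a)` of `G` (and `1` for `a = 0`). -/
def hE (a : S.E) : S.GG := if ha : a = 0 then 1 else dE a (-S.conj a * a⁻¹) ha (hM_norm ha)

lemma mat_hE {a : S.E} (ha : a ≠ 0) : S.mat (hE a) = S.hM a := by
  rw [hE, dif_neg ha, mat_dE, hM]

/-- The rank one relation: `u β_r = n' h(a) n` for `u = n(x,y)` with `y` of valuation `-r`. -/
lemma rank_one_rel {r : ℤ} {u : S.GG} (hu : u ∈ S.Nk (-r)) (hu1 : u ∉ S.Nk (1 - r)) :
    ∃ n' ∈ S.N'k r, ∃ n ∈ S.Nk (-r), n' ∉ S.N'k (r + 1) ∧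
      u * S.bE r = n' * hE (S.ϖ ^ r * S.mat u 0 2) * n := by
  obtain ⟨x, y, h, hy, rfl⟩ := eq_nE hu
  have hy1 : y ∉ S.pE (1 - r) := fun h' => hu1 (mem_Nk_mk.2 h')
  have hy0 : y ≠ 0 := ne_zero_of_not_mem hy1
  have hyi : y⁻¹ ∈ S.pE r := by
    have := inv_mem_of_not_mem (n := -r) (x := y) (by rwa [neg_add_eq_sub])
    rwa [neg_neg] at this
  have hw := zpow_unif_ne (S := S) r
  set g := nE x y h * S.bE r with hg
  have g00 : S.mat g 0 0 = S.ϖ ^ r * y := by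
    simp [hg, mat_mul, mat_bE, nM, Matrix.mul_apply, Fin.sum_univ_three, mul_comm]
  have g20 : S.mat g 2 0 = S.ϖ ^ r := by
    simp [hg, mat_mul, mat_bE, nM, Matrix.mul_apply, Fin.sum_univ_three]
  have g02 : S.mat g 0 2 = S.ϖ ^ (-r) := by
    simp [hg, mat_mul, mat_bE, nM, Matrix.mul_apply, Fin.sum_univ_three]
  have ha : S.mat g 0 0 ≠ 0 := by rw [g00]; exact mul_ne_zero hw hy0
  obtain ⟨h', h2, m, hm, hd, e⟩ := exists_ldu g ha
  have hmv : m = -S.conj (S.mat g 0 0) * (S.mat g 0 0)⁻¹ := by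
    have hd1 : (S.mat g).det = -1 := by
      rw [hg, mat_mul, mat_bE, mat_nE]
      simp [Matrix.det_fin_three, nM, hw]
    rw [hd1] at hd
    have := conj_ne_zero ha
    field_simp at hd ⊢
    linear_combination -hd
  have q1 : S.mat g 2 0 / S.mat g 0 0 = y⁻¹ := by rw [g20, g00]; field_simp
  have q2 : S.mat g 0 2 / S.mat g 0 0 ∈ S.pE (-r) := by
    rw [g02, g00, div_eq_mul_inv, mul_inv, ← zpow_neg, ← mul_assoc, zpow_unif_mul]
    exact pE_mul (zpow_unif_mem _) hyi (by ring)
  refine ⟨_, nE'_mem h' (by rw [q1]; exact hyi), _, nE_mem h2 q2, ?_, ?_⟩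
  · rintro ⟨x', y', -, hy', hm'⟩
    have := congrFun (congrFun hm' 2) 0
    simp [n'M] at this
    rw [← this, q1] at hy'
    have := le_of_inv_mem (inv_ne_zero hy0) (n := r) (by rwa [inv_inv]) hy'
    omega
  · have : hE (S.ϖ ^ r * S.mat (nE x y h) 0 2) = dE (S.mat g 0 0) m ha hm := by
      apply mat_inj
      have : S.ϖ ^ r * S.mat (nE x y h) 0 2 = S.mat g 0 0 := by rw [g00]; simp [nM]
      rw [this, mat_hE ha, mat_dE, hM, hmv]
    rw [this, ← e]

end Setting
end U21

namespace U21

namespace Chamber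

open Setting

variable {S : Setting} (C : Chamber S)

/-- The level of the chamber: `0` for `K₀` and `1` for `K₁`. -/
def s : ℤ := -C.nK

lemma s_cases : C.s = 0 ∨ C.s = 1 := by
  rcases C.cases with h | h
  · left; simp [s, h]
  · right; simp [s, h]

lemma s_nonneg : 0 ≤ C.s := by rcases C.s_cases with h | h <;> omega

lemma s_le_one : C.s ≤ 1 := by rcases C.s_cases with h | h <;> omega

lemma nK_eq : C.nK = -C.s := by simp [s]

lemma mK_eq : C.mK = C.s + 1 := by
  rcases C.cases with h | h <;> simp [s, h]

lemma βK_eq : C.βK = S.bE C.s := by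
  rcases C.cases with ⟨-, -, -, -, -, h, h', -⟩ | ⟨-, -, -, -, -, h, h', -⟩
  · simp [s, h, h', bE_zero]
  · simp [s, h, h', bE, betaPr]

lemma mem_K {g : S.GG} : g ∈ C.K ↔
    S.mat g 0 0 ∈ S.pE 0 ∧ S.mat g 0 1 ∈ S.pE 0 ∧ S.mat g 0 2 ∈ S.pE (-C.s) ∧
    S.mat g 1 0 ∈ S.pE C.s ∧ S.mat g 1 1 ∈ S.pE 0 ∧ S.mat g 1 2 ∈ S.pE 0 ∧
    S.mat g 2 0 ∈ S.pE C.s ∧ S.mat g 2 1 ∈ S.pE C.s ∧ S.mat g 2 2 ∈ S.pE 0 := by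
  rcases C.cases with ⟨h, -, -, -, -, -, h', -⟩ | ⟨h, -, -, -, -, -, h', -⟩
  · rw [← SetLike.mem_coe, h]
    simp [s, h', K0set, pE_zero, Fin.forall_fin_succ]
    tauto
  · rw [← SetLike.mem_coe, h]
    simp [s, h', K1set, pE_zero]

lemma mem_Kone {g : S.GG} : g ∈ C.KoneS ↔
    S.mat g 0 0 - 1 ∈ S.pE 1 ∧ S.mat g 0 1 ∈ S.pE (1 - C.s) ∧ S.mat g 0 2 ∈ S.pE (1 - C.s) ∧
    S.mat g 1 0 ∈ S.pE 1 ∧ S.mat g 1 1 - 1 ∈ S.pE 1 ∧ S.mat g 1 2 ∈ S.pE (1 - C.s) ∧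
    S.mat g 2 0 ∈ S.pE (C.s + 1) ∧ S.mat g 2 1 ∈ S.pE 1 ∧ S.mat g 2 2 - 1 ∈ S.pE 1 := by
  have hO : ∀ x : S.E, x - 1 ∈ S.pE 1 → x ∈ S.O := fun x h => pE_zero.1 (unit_of_sub_one h).1
  have h1 : ∀ x : S.E, x ∈ S.O → x ∈ S.pE (-1) := fun x h => pE_mono (by norm_num) (pE_zero.2 h)
  have h2 : ∀ x : S.E, x ∈ S.pE 2 → x ∈ S.pE 1 := fun x h => pE_mono (by norm_num) h
  rcases C.cases with ⟨-, h, -, -, -, -, h', -⟩ | ⟨-, h, -, -, -, -, h', -⟩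
  · rw [h]
    simp [s, h', Kone0, Fin.forall_fin_succ, Matrix.one_apply]
    tauto
  · rw [h]
    simp [s, h', Kone1, K1set, pE_zero]
    constructor
    · tauto
    · rintro ⟨a, b, c, d, e, f, g, i, j⟩
      have := hO _ a
      have := hO _ e
      have := hO _ j
      have := h1 _ c
      have := h2 _ g
      tauto

lemma mem_IK {g : S.GG} : g ∈ C.IK ↔ g ∈ C.K ∧
    S.mat g 1 0 ∈ S.pE 1 ∧ S.mat g 2 0 ∈ S.pE (C.s + 1) ∧ S.mat g 2 1 ∈ S.pE 1 := by
  rcases C.cases with ⟨h1, -, h, -, -, -, h', -⟩ | ⟨h1, -, h, -, -, -, h', -⟩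
  · rw [h, ← SetLike.mem_coe, h1]
    simp [s, h', IK0]
    tauto
  · rw [h, ← SetLike.mem_coe, h1]
    simp [s, h', IK1, K1set]
    tauto

lemma mem_I1 {g : S.GG} : g ∈ C.I1 ↔ g ∈ C.IK ∧
    S.mat g 0 0 - 1 ∈ S.pE 1 ∧ S.mat g 1 1 - 1 ∈ S.pE 1 ∧ S.mat g 2 2 - 1 ∈ S.pE 1 := by
  rcases C.cases with ⟨-, -, h, h', -⟩ | ⟨-, -, h, h', -⟩
  · rw [h, h', I1K0, Set.mem_ofPred_eq]
  · rw [h, h', I1K1, Set.mem_ofPred_eq]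

variable {C}

lemma mem_K_of_IK {g : S.GG} (h : g ∈ C.IK) : g ∈ C.K := (C.mem_IK.1 h).1

lemma mem_IK_of_I1 {g : S.GG} (h : g ∈ C.I1) : g ∈ C.IK := (C.mem_I1.1 h).1

lemma mem_K_of_I1 {g : S.GG} (h : g ∈ C.I1) : g ∈ C.K := mem_K_of_IK (mem_IK_of_I1 h)

lemma N_mem_I1 {g : S.GG} (hg : g ∈ S.Nk (-C.s)) : g ∈ C.I1 := by
  obtain ⟨x, y, h, hy, rfl⟩ := eq_nE hg
  have hx : x ∈ S.pE 0 := h.mem hy (by have := C.s_le_one; omega)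
  rw [mem_I1, mem_IK, mem_K, mat_nE, nM]
  simp [pE_zero_mem, one_mem_pE, pE_neg_iff, pE_conj_iff, hx, hy]

lemma N_mem_Kone {g : S.GG} (hg : g ∈ S.Nk (1 - C.s)) : g ∈ C.KoneS := by
  obtain ⟨x, y, h, hy, rfl⟩ := eq_nE hg
  have hx : x ∈ S.pE (1 - C.s) := h.mem hy (by have := C.s_nonneg; omega)
  rw [mem_Kone, mat_nE, nM]
  simp [pE_zero_mem, pE_neg_iff, pE_conj_iff, hx, hy]

lemma N'_mem_I1 {g : S.GG} (hg : g ∈ S.N'k (C.s + 1)) : g ∈ C.I1 := by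
  obtain ⟨x, y, h, hy, rfl⟩ := eq_nE' hg
  have hx : x ∈ S.pE 1 := h.mem hy (by have := C.s_nonneg; omega)
  have hx' : x ∈ S.pE C.s := pE_mono C.s_le_one hx
  have hy' : y ∈ S.pE C.s := pE_mono (by omega) hy
  rw [mem_I1, mem_IK, mem_K, mat_nE', n'M]
  simp [pE_zero_mem, one_mem_pE, pE_neg_iff, pE_conj_iff, hx, hy, hx', hy']

lemma bE_mem_K : S.bE C.s ∈ C.K := by
  rw [mem_K, mat_bE]
  have h := zpow_unif_mem (S := S) (-C.s)
  rw [zpow_neg] at h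
  simp [pE_zero_mem, one_mem_pE, zpow_unif_mem, h]

lemma βK_mem_K : C.βK ∈ C.K := by rw [C.βK_eq]; exact bE_mem_K

lemma norm_one_mem {m : S.E} (hm : m * S.conj m = 1) : m ∈ S.pE 0 :=
  pE_of_norm (by rw [hm]; exact pE_mono (by norm_num) one_mem_pE)

lemma dE_mem_H0 {a m : S.E} (ha : a ≠ 0) (hm : m * S.conj m = 1) (h : a ∈ S.pE 0)
    (h' : a⁻¹ ∈ S.pE 0) : dE a m ha hm ∈ C.H0 := by
  have hc : (S.conj a)⁻¹ ∈ S.pE 0 := by rw [← map_inv₀]; exact pE_conj h'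
  refine ⟨⟨a, m, _, mat_dE a m ha hm⟩, ?_⟩
  have z := pE_zero_mem (S := S)
  rw [mem_IK, mem_K, mat_dE]
  exact ⟨⟨h, z _, z _, z _, norm_one_mem hm, z _, z _, z _, hc⟩, z _, z _, z _⟩

lemma dE_mem_H1 {a m : S.E} (ha : a ≠ 0) (hm : m * S.conj m = 1) (h : a - 1 ∈ S.pE 1)
    (h' : m - 1 ∈ S.pE 1) : dE a m ha hm ∈ C.H1 := by
  obtain ⟨h1, -, h2, h3⟩ := unit_of_sub_one h
  obtain ⟨h4, h5⟩ := dE_mem_H0 (C := C) ha hm h1 h2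
  refine ⟨h4, C.mem_I1.2 ⟨h5, ?_⟩⟩
  rw [mat_dE]
  have e : (S.conj a)⁻¹ - 1 = S.conj (a⁻¹ - 1) := by simp
  have h6 : (S.conj a)⁻¹ - 1 ∈ S.pE 1 := by rw [e]; exact pE_conj h3
  exact ⟨h, h', h6⟩

lemma mem_I1_of_H1 {g : S.GG} (h : g ∈ C.H1) : g ∈ C.I1 := h.2

lemma mem_H0_of_H1 {g : S.GG} (h : g ∈ C.H1) : g ∈ C.H0 := ⟨h.1, mem_IK_of_I1 h.2⟩

/-- Diagonal elements of `K` are the `diag(a, m, ā⁻¹)` with `a` a unit. -/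
lemma eq_dE_of_H0 {g : S.GG} (h : g ∈ C.H0) :
    ∃ a m ha hm, a ∈ S.pE 0 ∧ a⁻¹ ∈ S.pE 0 ∧ g = dE a m ha hm := by
  obtain ⟨⟨a, b, c, hm⟩, hK⟩ := h
  obtain ⟨ha, hm', e⟩ := eq_dE (g := g) (by simp [hm]) (by simp [hm]) (by simp [hm]) (by simp [hm])
  have h1 := (C.mem_K.1 (mem_K_of_IK hK)).1
  have h2 := (C.mem_K.1 (C.K.inv_mem (mem_K_of_IK hK))).1
  refine ⟨_, _, ha, hm', h1, ?_, e⟩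
  rw [e, mat_inv_apply, mat_dE] at h2
  simpa [Fin.rev, S.conj_invol] using h2

lemma mem_IK_iff {g : S.GG} : g ∈ C.IK ↔ g ∈ C.K ∧ S.mat g 2 0 ∈ S.pE (C.s + 1) := by
  refine ⟨fun h => ⟨mem_K_of_IK h, (C.mem_IK.1 h).2.2.1⟩, fun ⟨h, h'⟩ => ?_⟩
  have key : ∀ g ∈ C.K, S.mat g 2 0 ∈ S.pE (C.s + 1) → S.mat g 1 0 ∈ S.pE 1 := by
    intro g h h'
    apply pE_of_norm
    have c := col_rel g 0 0
    have h2 : S.mat g 2 0 ∈ S.pE 1 := pE_mono (by have := C.s_nonneg; omega) h'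
    have h0 := (C.mem_K.1 h).1
    have e : S.mat g 1 0 * S.conj (S.mat g 1 0) =
      -(S.mat g 0 0 * S.conj (S.mat g 2 0) + S.mat g 2 0 * S.conj (S.mat g 0 0)) := by
      simp [betaM] at c
      linear_combination c
    rw [e]
    exact pE_neg (pE_add (pE_mul h0 (pE_conj h2) (by ring)) (pE_mul h2 (pE_conj h0) (by ring)))
  refine C.mem_IK.2 ⟨h, key g h h', h', ?_⟩
  have h1 := key g⁻¹ (C.K.inv_mem h) (by rw [mat_inv_apply]; simpa [Fin.rev, pE_conj_iff] using h')
  rw [mat_inv_apply] at h1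
  simpa [Fin.rev, pE_conj_iff] using h1

variable (C) in
/-- The Iwahori subgroup `I_K`. -/
def ISub : Subgroup S.GG where
  carrier := C.IK
  one_mem' := mem_IK_of_I1 (N_mem_I1 (S.NS _).one_mem)
  mul_mem' := by
    intro a b ha hb
    refine mem_IK_iff.2 ⟨C.K.mul_mem (mem_K_of_IK ha) (mem_K_of_IK hb), ?_⟩
    have ha1 := C.mem_K.1 (mem_K_of_IK ha)
    have hb1 := C.mem_K.1 (mem_K_of_IK hb)
    have ha2 := (C.mem_IK.1 ha).2
    have hb2 := (C.mem_IK.1 hb).2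
    rw [mat_mul, Matrix.mul_apply, Fin.sum_univ_three]
    exact pE_add (pE_add (pE_mul ha2.2.1 hb1.1 (by ring)) (pE_mul ha1.2.2.2.2.2.2.2.1 hb2.1 rfl))
      (pE_mul ha1.2.2.2.2.2.2.2.2 hb2.2.1 (by ring))
  inv_mem' := by
    intro g hg
    refine mem_IK_iff.2 ⟨C.K.inv_mem (mem_K_of_IK hg), ?_⟩
    rw [mat_inv_apply]
    simpa [Fin.rev, pE_conj_iff] using (C.mem_IK.1 hg).2.2.1

lemma mem_IK_of_H0 {g : S.GG} (h : g ∈ C.H0) : g ∈ C.IK := h.2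

lemma unit00_of_IK {g : S.GG} (h : g ∈ C.IK) :
    S.mat g 0 0 ≠ 0 ∧ (S.mat g 0 0)⁻¹ ∈ S.pE 0 := by
  have h1 := C.mem_K.1 (mem_K_of_IK h)
  have h2 := (C.mem_IK.1 h).2
  have hn : S.mat g 0 0 ∉ S.pE (0 + 1) := by
    intro h0
    rw [zero_add] at h0
    refine one_not_mem_pE (S := S) ?_
    have c := col_rel g 0 2
    have : (1 : S.E) = S.betaM 0 2 := by simp [betaM]
    rw [this, ← c]
    refine pE_add (pE_add (pE_mul h0 (pE_conj h1.2.2.2.2.2.2.2.2) (by ring))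
      (pE_mul h2.1 (pE_conj h1.2.2.2.2.2.1) (by ring))) (pE_mul h2.2.1 (pE_conj h1.2.2.1) (by ring))
  exact ⟨ne_zero_of_not_mem hn, by simpa using inv_mem_of_not_mem hn⟩

/-- The Iwahori factorization. -/
lemma IK_dec {g : S.GG} (hg : g ∈ C.IK) :
    ∃ n' ∈ S.N'k (C.s + 1), ∃ h ∈ C.H0, ∃ n ∈ S.Nk (-C.s), g = n' * h * n := by
  obtain ⟨h0, h0'⟩ := unit00_of_IK hg
  have h1 := C.mem_K.1 (mem_K_of_IK hg)
  obtain ⟨r', r, m, hm, -, e⟩ := exists_ldu g h0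
  refine ⟨_, nE'_mem r' ?_, _, dE_mem_H0 h0 hm h1.1 h0', _, nE_mem r ?_, e⟩
  · rw [div_eq_mul_inv]
    exact pE_mul (C.mem_IK.1 hg).2.2.1 h0' (add_zero _).symm
  · rw [div_eq_mul_inv]
    exact pE_mul h1.2.2.1 h0' (add_zero _).symm

lemma I1_dec {g : S.GG} (hg : g ∈ C.I1) :
    ∃ n' ∈ S.N'k (C.s + 1), ∃ h ∈ C.H0, ∃ n ∈ S.Nk (-C.s), g = n' * h * n :=
  IK_dec (mem_IK_of_I1 hg)

/-- The Bruhat decomposition of `K`. -/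
lemma bruhat {g : S.GG} (hg : g ∈ C.K) (hI : g ∉ C.IK) :
    ∃ u ∈ S.Nk (-C.s), ∃ b ∈ C.IK, g = u * S.bE C.s * b := by
  have h1 := C.mem_K.1 hg
  have h20 : S.mat g 2 0 ∉ S.pE (C.s + 1) := fun h => hI (mem_IK_iff.2 ⟨hg, h⟩)
  have h0 := ne_zero_of_not_mem h20
  have hi := inv_mem_of_not_mem h20
  have ha := conj_ne_zero h0
  have c00 := col_rel g 0 0
  simp [betaM] at c00
  have r : S.Rel (-S.conj (S.mat g 1 0 / S.mat g 2 0)) (S.mat g 0 0 / S.mat g 2 0) := by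
    unfold Setting.Rel
    simp only [map_neg, map_div₀, S.conj_invol]
    field_simp
    linear_combination c00
  have hu : nE _ _ r ∈ S.Nk (-C.s) := nE_mem r (by
    rw [div_eq_mul_inv]; exact pE_mul h1.1 hi (zero_add _).symm)
  have huK : nE _ _ r ∈ C.K := mem_K_of_I1 (N_mem_I1 hu)
  refine ⟨_, hu, S.bE C.s * ((nE _ _ r)⁻¹ * g), ?_, ?_⟩
  · refine mem_IK_iff.2 ⟨C.K.mul_mem bE_mem_K (C.K.mul_mem (C.K.inv_mem huK) hg), ?_⟩
    have : S.mat (S.bE C.s * ((nE _ _ r)⁻¹ * g)) 2 0 = 0 := by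
      simp [mat_mul, mat_bE, mat_nE_inv, Matrix.mul_apply, Fin.sum_univ_three, Matrix.vecMul,
        dotProduct, S.conj_invol]
      right
      field_simp
      linear_combination c00
    rw [this]
    exact pE_zero_mem _
  · have := bE_mul_bE (S := S) C.s
    calc g = nE _ _ r * (S.bE C.s * S.bE C.s) * ((nE _ _ r)⁻¹ * g) := by rw [this]; group
      _ = _ := by group

lemma bE_not_mem_IK : S.bE C.s ∉ C.IK := by
  intro h
  have := (mem_IK_iff.1 h).2
  rw [mat_bE] at this
  simp at this
  have h2 := pE_mul this (zpow_unif_mem (-C.s)) rfl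
  rw [zpow_unif_mul] at h2
  simp at h2
  have := one_not_mem_pE (S := S)
  contradiction

lemma conj_Kone_mem_IK {k z : S.GG} (hk : k ∈ C.K) (hz : z ∈ C.KoneS) (hzK : z ∈ C.K) :
    k * z * k⁻¹ ∈ C.IK := by
  refine mem_IK_iff.2 ⟨C.K.mul_mem (C.K.mul_mem hk hzK) (C.K.inv_mem hk), ?_⟩
  have hi : k * z * k⁻¹ = k * z * k⁻¹ := rfl
  have hk1 := C.mem_K.1 hk
  have hk2 := C.mem_K.1 (C.K.inv_mem hk)
  have hz1 := C.mem_Kone.1 hz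
  have e1 : S.mat (k * k⁻¹) 2 0 = 0 := by rw [mul_inv_cancel, mat_one]; simp
  have e : S.mat (k * z * k⁻¹) 2 0 =
      ∑ i, ∑ j, S.mat k 2 i * (S.mat z i j - (1 : S.M3) i j) * S.mat k⁻¹ j 0 := by
    rw [mat_mul] at e1
    rw [← sub_zero (S.mat (k * z * k⁻¹) 2 0), ← e1, mat_mul, mat_mul]
    simp [Matrix.mul_apply, Fin.sum_univ_three, Matrix.one_apply]
    ring
  rw [e]
  simp only [Fin.sum_univ_three, Matrix.one_apply]
  have s0 := C.s_nonneg
  have s1 := C.s_le_one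
  obtain ⟨a1, a2, a3, a4, a5, a6, a7, a8, a9⟩ := hk1
  obtain ⟨b1, b2, b3, b4, b5, b6, b7, b8, b9⟩ := hk2
  obtain ⟨c1, c2, c3, c4, c5, c6, c7, c8, c9⟩ := hz1
  have t : ∀ {x y z : S.E} {i j k : ℤ}, x ∈ S.pE i → y ∈ S.pE j → z ∈ S.pE k → C.s + 1 ≤ i + j + k →
      x * y * z ∈ S.pE (C.s + 1) := fun hx hy hz h => pE_mul_le (pE_mul hx hy rfl) hz h
  simp only [reduceIte, sub_zero, show ((0 : Fin 3) = 1) = False by simp, show ((0 : Fin 3) = 2) = False by simp,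
    show ((1 : Fin 3) = 0) = False by simp, show ((1 : Fin 3) = 2) = False by simp,
    show ((2 : Fin 3) = 0) = False by simp, show ((2 : Fin 3) = 1) = False by simp]
  exact pE_add (pE_add (pE_add (pE_add (t a7 c1 b1 (by omega)) (t a7 c2 b4 (by omega)))
      (t a7 c3 b7 (by omega)))
    (pE_add (pE_add (t a8 c4 b1 (by omega)) (t a8 c5 b4 (by omega))) (t a8 c6 b7 (by omega))))
    (pE_add (pE_add (t a9 c7 b1 (by omega)) (t a9 c8 b4 (by omega))) (t a9 c9 b7 (by omega)))

end Chamber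

end U21

namespace U21

namespace Setting

variable {S : Setting}

lemma IsReps.sum_eq {A B : Subgroup S.GG} {U V : Finset S.GG} (hU : S.IsReps A B U)
    (hV : S.IsReps A B V) {M : Type*} [AddCommMonoid M] (φ : S.GG → M)
    (hφ : ∀ a ∈ A, ∀ b ∈ B, φ (a * b) = φ a) : ∑ u ∈ U, φ u = ∑ v ∈ V, φ v := by
  choose i hi hi' using fun (u : S.GG) (hu : u ∈ U) => hV.2 u (hU.1 hu)
  have hsymm : ∀ {a b : S.GG}, a⁻¹ * b ∈ (B : Set S.GG) → b⁻¹ * a ∈ (B : Set S.GG) := by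
    intro a b h
    have := B.inv_mem h
    simpa using this
  refine Finset.sum_bij i (fun u hu => (hi u hu).1) ?_ ?_ ?_
  · intro u hu u' hu' he
    refine (hU.2 (i u hu) (hV.1 (hi u hu).1)).unique ⟨hu, hsymm (hi u hu).2⟩ ⟨hu', ?_⟩
    rw [he]
    exact hsymm (hi u' hu').2
  · intro v hv
    obtain ⟨u, ⟨hu, h⟩, -⟩ := hU.2 v (hV.1 hv)
    exact ⟨u, hu, (hi' u hu v ⟨hv, hsymm h⟩).symm⟩
  · intro u hu
    have := hφ u (hU.1 hu) _ (hi u hu).2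
    rw [← this, mul_inv_cancel_left]

lemma IsReps.map {A B A' B' : Set S.GG} {U : Finset S.GG} (hU : S.IsReps A B U)
    (e : S.GG ≃* S.GG) (hA : ∀ g, e g ∈ A' ↔ g ∈ A) (hB : ∀ g, e g ∈ B' ↔ g ∈ B) :
    S.IsReps A' B' (U.image e) := by
  refine ⟨?_, ?_⟩
  · intro g hg
    obtain ⟨u, hu, rfl⟩ := Finset.mem_image.1 (Finset.mem_coe.1 hg)
    exact (hA u).2 (hU.1 hu)
  · intro a ha
    obtain ⟨a, rfl⟩ := e.surjective a
    obtain ⟨u, ⟨hu, h⟩, hun⟩ := hU.2 a ((hA a).1 ha)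
    refine ⟨e u, ⟨Finset.mem_image_of_mem _ hu, ?_⟩, ?_⟩
    · rw [← map_inv, ← map_mul]
      exact (hB _).2 h
    · rintro v ⟨hv, hv'⟩
      obtain ⟨v, hvU, rfl⟩ := Finset.mem_image.1 hv
      rw [← map_inv, ← map_mul, hB] at hv'
      rw [hun v ⟨hvU, hv'⟩]

lemma IsReps.translate {A B : Subgroup S.GG} {U : Finset S.GG} (hU : S.IsReps A B U) {a : S.GG}
    (ha : a ∈ A) : S.IsReps A B (U.image (a * ·)) := by
  refine ⟨?_, ?_⟩
  · intro g hg
    obtain ⟨u, hu, rfl⟩ := Finset.mem_image.1 (Finset.mem_coe.1 hg)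
    exact A.mul_mem ha (hU.1 hu)
  · intro b hb
    obtain ⟨u, ⟨hu, h⟩, hun⟩ := hU.2 (a⁻¹ * b) (A.mul_mem (A.inv_mem ha) hb)
    have e : ∀ v, b⁻¹ * (a * v) = (a⁻¹ * b)⁻¹ * v := fun v => by group
    refine ⟨a * u, ⟨Finset.mem_image_of_mem _ hu, by rw [e]; exact h⟩, ?_⟩
    rintro v ⟨hv, hv'⟩
    obtain ⟨v, hvU, rfl⟩ := Finset.mem_image.1 hv
    rw [e] at hv'
    rw [hun v ⟨hvU, hv'⟩]

lemma IsReps.sum_translate {A B : Subgroup S.GG} {U : Finset S.GG} (hU : S.IsReps A B U) {a : S.GG}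
    (ha : a ∈ A) {M : Type*} [AddCommMonoid M] (φ : S.GG → M)
    (hφ : ∀ a ∈ A, ∀ b ∈ B, φ (a * b) = φ a) : ∑ u ∈ U, φ (a * u) = ∑ u ∈ U, φ u := by
  rw [← (hU.translate ha).sum_eq hU φ hφ, Finset.sum_image (fun _ _ _ _ h => mul_left_cancel h)]

lemma NS_conj {k : ℤ} {a b : S.GG} (ha : a ∈ S.NS k) (hb : b ∈ S.NS (k + 1)) :
    a * b * a⁻¹ ∈ S.NS (k + 1) := by
  have hb' : b ∈ S.NS k := NS_mono (by omega) hb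
  have h : a * b * a⁻¹ ∈ S.NS k := (S.NS k).mul_mem ((S.NS k).mul_mem ha hb') ((S.NS k).inv_mem ha)
  refine (mem_Nk_iff h).2 ?_
  obtain ⟨x, y, h1, hy, rfl⟩ := eq_nE ha
  obtain ⟨x', y', h1', hy', rfl⟩ := eq_nE hb
  have hx : x ∈ S.pE ((k + 1) / 2) := Rel.mem h1 hy (by omega)
  have hx' : x' ∈ S.pE ((k + 2) / 2) := Rel.mem h1' hy' (by omega)
  have e : S.mat (nE x y h1 * nE x' y' h1' * (nE x y h1)⁻¹) 0 2
      = y' + (x' * S.conj x - x * S.conj x') := by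
    rw [mat_mul, mat_mul, mat_nE_inv, mat_nE, mat_nE]
    simp [nM, Matrix.mul_apply, Fin.sum_univ_three]
    unfold Rel at h1
    linear_combination h1
  rw [e]
  exact pE_add hy' (pE_sub (pE_mul_le hx' (pE_conj hx) (by omega))
    (pE_mul_le hx (pE_conj hx') (by omega)))

lemma nE_pow {x y : S.E} (h : S.Rel x y) (j : ℕ) :
    S.mat (nE x y h ^ j) = S.nM (j * x) (j * y - (j.choose 2) * (x * S.conj x)) := by
  induction j with
  | zero => ext a b; fin_cases a <;> fin_cases b <;> simp [nM, mat_one]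
  | succ j ih =>
    rw [pow_succ, mat_mul, ih, mat_nE]
    have : (j + 1).choose 2 = j + j.choose 2 := by
      rw [Nat.choose_succ_succ', Nat.choose_one_right]
    rw [this]
    ext a b
    fin_cases a <;> fin_cases b <;> simp [nM, Matrix.mul_apply, Fin.sum_univ_three] <;> ring

lemma NS_pow_p {k : ℤ} {a : S.GG} (ha : a ∈ S.NS k) : a ^ S.p ∈ S.NS (k + 1) := by
  refine (mem_Nk_iff ((S.NS k).pow_mem ha S.p)).2 ?_
  obtain ⟨x, y, h, hy, rfl⟩ := eq_nE ha
  have hx : x ∈ S.pE ((k + 1) / 2) := Rel.mem h hy (by omega)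
  have hxx : x * S.conj x ∈ S.pE k := pE_mul_le hx (pE_conj hx) (by omega)
  have hp := S.hp.two_le
  obtain ⟨c, hc⟩ := S.hp.dvd_choose_self (k := 2) (by norm_num) (lt_of_le_of_ne hp S.hodd.symm)
  rw [nE_pow, hc]
  have hcO : ((c : ℕ) : S.E) ∈ S.pE 0 := pE_zero.2 (natCast_mem S.O c)
  simp only [nM]
  have e : ((S.p * c : ℕ) : S.E) * (x * S.conj x) = S.p * (c * (x * S.conj x)) := by push_cast; ring
  rw [e]
  exact pE_sub (pE_mul p_mem_pE hy (by ring))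
    (pE_mul p_mem_pE (pE_mul hcO hxx (zero_add k).symm) (by ring))

lemma exists_trace_zero (k : ℤ) : ∃ (y : S.E) (_h : S.Rel 0 y), y ∈ S.pE k ∧ y ∉ S.pE (k + 1) := by
  obtain ⟨t, h0, h1, ht⟩ := S.exists_trace_zero_unit
  refine ⟨S.ϖ ^ k * t, ?_, pE_mul (zpow_unif_mem k) h0 (by ring), fun h => h1 ?_⟩
  · unfold Rel
    rw [map_mul, conj_zpow_unif, ht]
    ring
  · have := pE_mul (zpow_unif_mem (-k)) h rfl
    rw [← mul_assoc, zpow_unif_mul] at this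
    simpa using this

lemma IsReps.p_dvd_card {k : ℤ} {U : Finset S.GG} (hU : S.IsReps (S.Nk k) (S.Nk (k + 1)) U) :
    S.p ∣ U.card := by
  let B := (S.NS (k + 1)).subgroupOf (S.NS k)
  have : B.Normal := ⟨fun b hb a => by
    rw [Subgroup.mem_subgroupOf] at hb ⊢
    exact NS_conj a.2 hb⟩
  have hcard : Nat.card (S.NS k ⧸ B) = U.card := by
    rw [← Nat.card_eq_finsetCard]
    symm
    refine Nat.card_congr (Equiv.ofBijective
      (fun u : U => (QuotientGroup.mk (⟨u, hU.1 u.2⟩ : S.NS k) : S.NS k ⧸ B)) ⟨?_, ?_⟩)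
    · intro u v h
      have h := QuotientGroup.eq.1 h
      rw [Subgroup.mem_subgroupOf] at h
      exact Subtype.ext ((hU.2 u (hU.1 u.2)).unique ⟨u.2, by rw [inv_mul_cancel]; exact (S.NS (k + 1)).one_mem⟩
        ⟨v.2, h⟩)
    · intro q
      obtain ⟨a, rfl⟩ := QuotientGroup.mk_surjective q
      obtain ⟨u, ⟨hu, h⟩, -⟩ := hU.2 a a.2
      refine ⟨⟨u, hu⟩, (QuotientGroup.eq.2 ?_).symm⟩
      rw [Subgroup.mem_subgroupOf]
      exact h
  obtain ⟨y, h, h0, h1⟩ := exists_trace_zero (S := S) k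
  have ha : nE 0 y h ∈ S.NS k := nE_mem h h0
  let q : S.NS k ⧸ B := QuotientGroup.mk ⟨nE 0 y h, ha⟩
  have : Fact S.p.Prime := ⟨S.hp⟩
  have ho : orderOf q = S.p := by
    refine orderOf_eq_prime ?_ ?_
    · rw [← QuotientGroup.mk_pow, QuotientGroup.eq_one_iff, Subgroup.mem_subgroupOf]
      exact NS_pow_p ha
    · intro h'
      have h' := (QuotientGroup.eq_one_iff _).1 h'
      rw [Subgroup.mem_subgroupOf] at h'
      exact h1 ((mem_Nk_mk (h := h)).1 h')
  rw [← hcard, ← ho]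
  exact orderOf_dvd_natCard q

lemma alpha_zpow_mul_dE (j : ℤ) (a m : S.E) (ha hm) :
    S.alphaE ^ j * dE a m ha hm = dE a m ha hm * S.alphaE ^ j := by
  refine mat_inj ?_
  rw [mat_mul, mat_mul, mat_alpha_zpow, mat_dE]
  ext i k
  fin_cases i <;> fin_cases k <;> simp [Matrix.mul_apply, Fin.sum_univ_three, mul_comm]

/-- The leading coefficient of an element of `N_{-r} ∖ N_{1-r}` is a unit. -/
lemma lead_unit {r : ℤ} {u : S.GG} (hu : u ∈ S.Nk (-r)) (hu1 : u ∉ S.Nk (1 - r)) :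
    S.ϖ ^ r * S.mat u 0 2 ∈ S.pE 0 ∧ (S.ϖ ^ r * S.mat u 0 2)⁻¹ ∈ S.pE 0 ∧
      S.ϖ ^ r * S.mat u 0 2 ≠ 0 := by
  have hy := (mem_Nk_iff hu).1 hu
  have hy1 : S.mat u 0 2 ∉ S.pE (-r + 1) := by
    rw [neg_add_eq_sub]; exact fun h => hu1 ((mem_Nk_iff hu).2 h)
  have hi := inv_mem_of_not_mem hy1
  refine ⟨pE_mul (zpow_unif_mem r) hy (by ring), ?_,
    mul_ne_zero (zpow_unif_ne r) (ne_zero_of_not_mem hy1)⟩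
  rw [mul_inv, ← zpow_neg]
  exact pE_mul (zpow_unif_mem (-r)) hi (by ring)

end Setting

open Setting

section Hecke

variable {S : Setting} {C : Chamber S} {𝔽 : Type} [Field 𝔽]
  {W : Type} [AddCommGroup W] [Module 𝔽 W] {σ : Representation 𝔽 ↥C.K W}

lemma sigma'_mul {g h : S.GG} (hg : g ∈ C.K) (hh : h ∈ C.K) :
    sigma' C 𝔽 W σ (g * h) = sigma' C 𝔽 W σ g * sigma' C 𝔽 W σ h := by
  rw [sigma', sigma', sigma', dif_pos hg, dif_pos hh, dif_pos (C.K.mul_mem hg hh), ← map_mul]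
  rfl

lemma hE_mem_H0 {a : S.E} (h0 : a ≠ 0) (h : a ∈ S.pE 0) (h' : a⁻¹ ∈ S.pE 0) : hE a ∈ C.H0 := by
  rw [hE, dif_neg h0]
  exact Chamber.dE_mem_H0 _ _ h h'

/-- The key computation: a function on `G` supported on `K αʲ N_{-r}` and invariant under
`N_{-r}` and `N'_{r+1}` is an eigenfunction of the operator attached to `N_{-r} β_r`. -/
lemma hecke_eigen {v0 : W} (hv : ∀ g ∈ C.I1, sigma' C 𝔽 W σ g v0 = v0) {χ : S.GG → 𝔽}
    (hχ : IsChi C 𝔽 W σ v0 χ) (hp : (S.p : 𝔽) = 0) {r j : ℤ} {f : S.GG → W}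
    (hK : ∀ k ∈ C.K, ∀ x, f (k * x) = sigma' C 𝔽 W σ k (f x))
    (hN : ∀ x, ∀ n ∈ S.Nk (-r), f (x * n) = f x)
    (hN' : ∀ x, ∀ n ∈ S.N'k (r + 1), f (x * n) = f x)
    (hsupp : ∀ x, f x ≠ 0 → ∃ k ∈ C.K, ∃ n ∈ S.Nk (-r), x = k * S.alphaE ^ j * n)
    (hval : f (S.alphaE ^ j) = v0) (hj : C.s + 1 ≤ 2 * j + r) {U : Finset S.GG}
    (hU : S.IsReps (S.Nk (-r)) (S.Nk (1 - r)) U) (x : S.GG) :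
    ∑ u ∈ U, f (x * u * S.bE r) =
      (∑ u ∈ U with u ∉ S.Nk (1 - r), χ (hE (S.ϖ ^ r * S.mat u 0 2))) • f x := by
  have hinv : ∀ x, ∀ a ∈ S.NS (-r), ∀ b ∈ S.NS (1 - r), f (x * (a * b) * S.bE r) = f (x * a * S.bE r) := by
    intro x a _ b hb
    have hb' := bE_conj_n r hb
    rw [show 1 - r + 2 * r = r + 1 by ring] at hb'
    rw [← hN' (x * a * S.bE r) _ hb']
    congr 1
    have := bE_mul_bE (S := S) r
    calc x * (a * b) * S.bE r = x * a * 1 * b * S.bE r := by group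
      _ = x * a * (S.bE r * S.bE r) * b * S.bE r := by rw [this]
      _ = _ := by group
  have hU' : S.IsReps (S.NS (-r)) (S.NS (1 - r)) U := hU
  have hbig : ∀ n' ∈ S.N'k r, S.alphaE ^ j * n' * S.alphaE ^ (-j) ∈ C.I1 := fun n' hn' =>
    Chamber.N'_mem_I1 (N'k_mono (by omega) (alpha_conj_n' j hn'))
  have hdec : ∀ n' ∈ S.N'k r, ∀ a m ha hm, ∀ n,
      S.alphaE ^ j * (n' * dE a m ha hm * n) =
        (S.alphaE ^ j * n' * S.alphaE ^ (-j)) * dE a m ha hm * S.alphaE ^ j * n := by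
    intro n' _ a m ha hm n
    rw [mul_assoc (S.alphaE ^ j * n' * S.alphaE ^ (-j)), ← alpha_zpow_mul_dE]
    group
  have hgood : ∀ u ∈ S.Nk (-r), u ∉ S.Nk (1 - r) → ∃ k ∈ C.K, ∃ n ∈ S.Nk (-r),
      S.alphaE ^ j * u * S.bE r = k * S.alphaE ^ j * n ∧
      sigma' C 𝔽 W σ k v0 = χ (hE (S.ϖ ^ r * S.mat u 0 2)) • v0 := by
    intro u hu hu1
    obtain ⟨n', hn', n, hn, -, e⟩ := rank_one_rel hu hu1
    obtain ⟨l1, l2, l0⟩ := lead_unit hu hu1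
    have hH := hE_mem_H0 (C := C) l0 l1 l2
    have hHK := Chamber.mem_K_of_IK (Chamber.mem_IK_of_H0 hH)
    refine ⟨_, C.K.mul_mem (Chamber.mem_K_of_I1 (hbig n' hn')) hHK, n, hn, ?_, ?_⟩
    · rw [mul_assoc, e, hE, dif_neg l0, hdec n' hn']
    · rw [sigma'_mul (Chamber.mem_K_of_I1 (hbig n' hn')) hHK, Module.End.mul_apply, hχ _ hH,
        map_smul, hv _ (hbig n' hn')]
  have hα : ∑ u ∈ U, f (S.alphaE ^ j * u * S.bE r) =
      (∑ u ∈ U with u ∉ S.Nk (1 - r), χ (hE (S.ϖ ^ r * S.mat u 0 2))) • v0 := by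
    rw [Finset.sum_filter, Finset.sum_smul]
    refine Finset.sum_congr rfl fun u hu => ?_
    split_ifs with hu1
    · rw [zero_smul]
      have h1 := hinv (S.alphaE ^ j) 1 (S.NS _).one_mem u hu1
      rw [one_mul, mul_one] at h1
      rw [h1]
      by_contra h0
      obtain ⟨k, hk, n, hn, e⟩ := hsupp _ h0
      rw [alpha_mul_bE] at e
      have e : k * (S.alphaE ^ j * n) = S.bE (r + j) := by rw [e, mul_assoc]
      obtain ⟨a, b, hab, -, rfl⟩ := eq_nE hn
      have e' : k = S.bE (r + j) * (nE a b hab)⁻¹ * S.alphaE ^ (-j) := by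
        rw [← e]; group
      have h2 := (C.mem_K.1 hk).2.2.1
      have h3 : S.mat k 0 2 = S.ϖ ^ (-(r + 2 * j)) := by
        rw [e', mat_mul, mat_mul, mat_bE, mat_alpha_zpow, mat_nE_inv]
        simp [Matrix.mul_apply, Fin.sum_univ_three, -zpow_neg, -neg_add_rev]
        rw [zpow_unif_mul]
        congr 1
        ring
      rw [h3] at h2
      have h4 := pE_mul h2 (zpow_unif_mem (r + 2 * j)) rfl
      rw [zpow_unif_mul, neg_add_cancel, zpow_zero] at h4
      have := le_zero_of_one_mem h4
      omega
    · obtain ⟨k, hk, n, hn, e, h1⟩ := hgood u (hU.1 hu) hu1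
      rw [e, hN _ _ hn, hK k hk, hval, h1]
  by_cases hx : ∃ k ∈ C.K, ∃ n ∈ S.Nk (-r), x = k * S.alphaE ^ j * n
  · obtain ⟨k, hk, n, hn, rfl⟩ := hx
    have h1 := hU'.sum_translate (a := n) hn (fun u => f (k * S.alphaE ^ j * u * S.bE r)) (hinv _)
    simp only [← mul_assoc] at h1
    rw [h1, hN _ _ hn, hK k hk, hval, ← map_smul, ← hα, map_sum]
    refine Finset.sum_congr rfl fun u _ => ?_
    rw [← hK k hk]
    simp only [mul_assoc]
  · have hfx : f x = 0 := by
      by_contra h; exact hx (hsupp x h)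
    rw [hfx, smul_zero]
    by_cases h0 : ∀ u ∈ U, f (x * u * S.bE r) = 0
    · exact Finset.sum_eq_zero h0
    push Not at h0
    obtain ⟨u0, hu0, h0⟩ := h0
    obtain ⟨k, hk, n, hn, e⟩ := hsupp _ h0
    have hbb := bE_mul_bE (S := S) r
    have hu0 := hU.1 hu0
    by_cases hn1 : n ∈ S.Nk (1 - r)
    · have h1 := hU'.sum_translate (a := u0) hu0 (fun u => f (x * u * S.bE r)) (hinv _)
      rw [← h1]
      have h2 : ∀ u ∈ U, f (x * (u0 * u) * S.bE r) = sigma' C 𝔽 W σ k v0 := by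
        intro u hu
        have e1 : x * (u0 * u) * S.bE r = k * (S.alphaE ^ j * (n * (S.bE r * u * S.bE r))) := by
          calc x * (u0 * u) * S.bE r = (x * u0 * 1) * u * S.bE r := by group
            _ = (x * u0 * S.bE r) * S.bE r * u * S.bE r := by rw [← hbb]; group
            _ = _ := by rw [e]; group
        rw [e1, hK k hk]
        congr 1
        have hw := bE_conj_n r (hU.1 hu)
        rw [show -r + 2 * r = r by ring] at hw
        obtain ⟨a, b, hab, hb, hne⟩ := eq_nE hn1
        obtain ⟨a', b', hab', hb', hwe⟩ := eq_nE' hw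
        rw [hne, hwe]
        have ha : a ∈ S.pE ((1 - r + 1) / 2) := hab.mem hb (by omega)
        have ha' : a' ∈ S.pE ((r + 1) / 2) := hab'.mem hb' (by omega)
        set g := nE a b hab * nE' a' b' hab' with hg
        have g00 : S.mat g 0 0 - 1 ∈ S.pE 1 := by
          have : S.mat g 0 0 - 1 = a * a' + b * b' := by
            rw [hg, mat_mul, mat_nE, mat_nE']
            simp [nM, n'M, Matrix.mul_apply, Fin.sum_univ_three]
            ring
          rw [this]
          exact pE_add (pE_mul_le ha ha' (by omega)) (pE_mul hb hb' (by ring))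
        have g20 : S.mat g 2 0 = b' := by
          rw [hg, mat_mul, mat_nE, mat_nE']
          simp [nM, n'M, Matrix.mul_apply, Fin.sum_univ_three]
        have g02 : S.mat g 0 2 = b := by
          rw [hg, mat_mul, mat_nE, mat_nE']
          simp [nM, n'M, Matrix.mul_apply, Fin.sum_univ_three]
        obtain ⟨q1, q2, q3, q4⟩ := unit_of_sub_one g00
        obtain ⟨r1, r2, m, hm, hd, eg⟩ := exists_ldu g q2
        have hm1 : m - 1 ∈ S.pE 1 := by
          have hd1 : (S.mat g).det = 1 := by
            rw [hg, mat_mul, Matrix.det_mul, mat_nE, mat_nE']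
            simp [nM, n'M, Matrix.det_fin_three]
          rw [hd1] at hd
          have hc := conj_ne_zero q2
          have : m - 1 = S.conj (S.mat g 0 0 - 1) * (S.mat g 0 0)⁻¹ +
              ((S.mat g 0 0)⁻¹ - 1) := by
            rw [map_sub, map_one]
            field_simp at hd ⊢
            linear_combination -hd
          rw [this]
          exact pE_add (pE_mul (pE_conj g00) q3 (by ring)) q4
        have n1 : nE' _ _ r1 ∈ S.N'k r := nE'_mem r1 (by
          rw [g20, div_eq_mul_inv]; exact pE_mul hb' q3 (by ring))
        have n2 : nE _ _ r2 ∈ S.Nk (-r) := nE_mem r2 (by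
          rw [g02, div_eq_mul_inv]; exact pE_mul (pE_mono (by omega) hb) q3 (add_zero (-r)).symm)
        have d1 : dE (S.mat g 0 0) m q2 hm ∈ C.I1 :=
          Chamber.mem_I1_of_H1 (Chamber.dE_mem_H1 q2 hm g00 hm1)
        rw [eg, hdec _ n1, hN _ _ n2, mul_assoc, hK _ (Chamber.mem_K_of_I1 (hbig _ n1)),
          hK _ (Chamber.mem_K_of_I1 d1), hval, hv _ d1, hv _ (hbig _ n1)]
      rw [Finset.sum_congr rfl h2, Finset.sum_const, ← Nat.cast_smul_eq_nsmul 𝔽]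
      obtain ⟨c, hc⟩ := IsReps.p_dvd_card (S := S) (k := -r) (by rwa [neg_add_eq_sub])
      rw [hc, Nat.cast_mul, hp, zero_mul, zero_smul]
    · exfalso
      obtain ⟨k', hk', n2, hn2, e', -⟩ := hgood n hn hn1
      refine hx ⟨k * k', C.K.mul_mem hk hk', n2 * u0⁻¹, (S.NS _).mul_mem hn2 ((S.NS _).inv_mem hu0), ?_⟩
      calc x = x * u0 * 1 * u0⁻¹ := by group
        _ = (x * u0 * S.bE r) * S.bE r * u0⁻¹ := by rw [← hbb]; group
        _ = k * (S.alphaE ^ j * n * S.bE r) * u0⁻¹ := by rw [e]; group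
        _ = _ := by rw [e']; group

end Hecke

end U21

namespace U21

namespace Setting

variable {S : Setting}

/-- The residue of an element of `E`, with the value `0` outside `o_E`. -/
def res (a : S.E) : S.kE := if h : a ∈ S.O then S.resmap ⟨a, h⟩ else 0

lemma res_of_mem {a : S.E} (h : a ∈ S.pE 0) : res a = S.resmap ⟨a, pE_zero.1 h⟩ :=
  dif_pos (pE_zero.1 h)

lemma res_eq_iff {a b : S.E} (ha : a ∈ S.pE 0) (hb : b ∈ S.pE 0) :
    res a = res b ↔ a - b ∈ S.pE 1 := by
  rw [res_of_mem ha, res_of_mem hb, resmap_eq]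

@[simp] lemma res_zero : res (0 : S.E) = 0 := by
  rw [res_of_mem (pE_zero_mem 0)]; exact map_zero _

lemma res_eq_zero {a : S.E} (ha : a ∈ S.pE 0) : res a = 0 ↔ a ∈ S.pE 1 := by
  rw [← res_zero, res_eq_iff ha (pE_zero_mem 0), sub_zero]

lemma res_add {a b : S.E} (ha : a ∈ S.pE 0) (hb : b ∈ S.pE 0) : res (a + b) = res a + res b := by
  rw [res_of_mem ha, res_of_mem hb, res_of_mem (pE_add ha hb), ← map_add]; rfl

lemma res_mul {a b : S.E} (ha : a ∈ S.pE 0) (hb : b ∈ S.pE 0) : res (a * b) = res a * res b := by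
  rw [res_of_mem ha, res_of_mem hb, res_of_mem (pE_mul ha hb (by ring)), ← map_mul]; rfl

lemma res_conj {a : S.E} (ha : a ∈ S.pE 0) : res (S.conj a) = res a ^ S.q := by
  rw [res_of_mem ha, res_of_mem (pE_conj ha)]
  exact resmap_conj ⟨a, pE_zero.1 ha⟩

lemma res_surjective (t : S.kE) : ∃ a ∈ S.pE 0, res (a : S.E) = t := by
  obtain ⟨a, rfl⟩ := Ideal.Quotient.mk_surjective t
  have h : (a : S.E) ∈ S.pE 0 := pE_zero.2 a.2
  exact ⟨a, h, res_of_mem h⟩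

/-- The residue group of `N_{-r}/N_{1-r}`. -/
def Lr (S : Setting) (r : ℤ) : Set (S.kE × S.kE) := if Even r then S.Lbig else S.Lsmall

/-- The residue coordinates of an element of `N_{-r}`. -/
def resN (r : ℤ) (u : S.GG) : S.kE × S.kE :=
  (if Even r then res (S.ϖ ^ (r / 2) * S.mat u 0 1) else 0, res (S.ϖ ^ r * S.mat u 0 2))

lemma x_mem {r : ℤ} {x y : S.E} (h : S.Rel x y) (hy : y ∈ S.pE (-r)) (hr : Even r) :
    S.ϖ ^ (r / 2) * x ∈ S.pE 0 := by
  obtain ⟨e, rfl⟩ := hr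
  exact pE_mul (zpow_unif_mem _) (h.mem hy (m := -e) (by omega)) (by omega)

lemma resN_mem {r : ℤ} {u : S.GG} (hu : u ∈ S.Nk (-r)) : resN r u ∈ S.Lr r := by
  obtain ⟨x, y, h, hy, rfl⟩ := eq_nE hu
  have hY : S.ϖ ^ r * y ∈ S.pE 0 := pE_mul (zpow_unif_mem r) hy (by ring)
  have h' := h
  unfold Setting.Rel at h'
  simp only [Lr, resN, mat_nE, nM]
  split_ifs with hr
  · have hX := x_mem h hy hr
    simp only [Lbig, Set.mem_ofPred_eq]
    have e : S.ϖ ^ (r / 2) * S.ϖ ^ (r / 2) = S.ϖ ^ r := by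
      rw [← zpow_add₀ S.unif_ne]; obtain ⟨e, rfl⟩ := hr; congr 1; omega
    simp only [Matrix.of_apply, Matrix.cons_val', Matrix.cons_val_zero, Matrix.cons_val_one,
      Matrix.cons_val]
    rw [← res_conj hX, ← res_conj hY, ← res_mul hX (pE_conj hX),
      ← res_add (pE_mul hX (pE_conj hX) (by ring)) hY,
      ← res_add (pE_add (pE_mul hX (pE_conj hX) (by ring)) hY) (pE_conj hY), ← res_zero]
    congr 1
    simp only [map_mul, conj_zpow_unif]
    linear_combination S.ϖ ^ r * h' + x * S.conj x * e
  · refine ⟨rfl, ?_⟩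
    simp only [Matrix.of_apply, Matrix.cons_val', Matrix.cons_val_zero, 
      Matrix.cons_val]
    rw [← res_conj hY, ← res_add hY (pE_conj hY), res_eq_zero (pE_add hY (pE_conj hY))]
    obtain ⟨e, rfl⟩ := Int.not_even_iff_odd.1 hr
    have hx : x ∈ S.pE (-e) := h.mem hy (by omega)
    have : S.ϖ ^ (2 * e + 1) * y + S.conj (S.ϖ ^ (2 * e + 1) * y)
        = -(S.ϖ ^ (2 * e + 1) * (x * S.conj x)) := by
      simp only [map_mul, conj_zpow_unif]
      linear_combination S.ϖ ^ (2 * e + 1) * h'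
    rw [this]
    exact pE_neg (pE_mul (zpow_unif_mem _) (pE_mul hx (pE_conj hx) rfl) (by ring))

lemma resN_eq_iff {r : ℤ} {u v : S.GG} (hu : u ∈ S.Nk (-r)) (hv : v ∈ S.Nk (-r)) :
    resN r u = resN r v ↔ u⁻¹ * v ∈ S.Nk (1 - r) := by
  have huv : u⁻¹ * v ∈ S.Nk (-r) := (S.NS (-r)).mul_mem ((S.NS (-r)).inv_mem hu) hv
  rw [mem_Nk_iff huv]
  obtain ⟨x, y, h, hy, rfl⟩ := eq_nE hu
  obtain ⟨x', y', h1, hy', rfl⟩ := eq_nE hv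
  have hY : S.ϖ ^ r * y ∈ S.pE 0 := pE_mul (zpow_unif_mem r) hy (by ring)
  have hY' : S.ϖ ^ r * y' ∈ S.pE 0 := pE_mul (zpow_unif_mem r) hy' (by ring)
  have e2 : S.mat ((nE x y h)⁻¹ * nE x' y' h1) 0 2 = (y' - y) + x * S.conj (x' - x) := by
    rw [mat_mul, mat_nE_inv, mat_nE, map_sub]
    unfold Setting.Rel at h
    simp [nM, Matrix.mul_apply, Fin.sum_univ_three]
    linear_combination h
  have e1 : S.mat ((nE x y h)⁻¹ * nE x' y' h1) 0 1 = x' - x := by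
    rw [mat_mul, mat_nE_inv, mat_nE]
    simp [nM, Matrix.mul_apply, Fin.sum_univ_three, sub_eq_add_neg]
  have key : ∀ {k : ℤ} {z : S.E}, S.ϖ ^ k * z ∈ S.pE 1 ↔ z ∈ S.pE (1 - k) := by
    intro k z
    refine ⟨fun hz => ?_, fun hz => pE_mul (zpow_unif_mem k) hz (by ring)⟩
    have := pE_mul (zpow_unif_mem (-k)) hz rfl
    rw [← mul_assoc, zpow_unif_mul] at this
    simpa [neg_add_eq_sub] using this
  have hxm : ∀ {m : ℤ}, 2 * m - 1 ≤ -r → x ∈ S.pE m := fun hm => h.mem hy hm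
  have hxm' : ∀ {m : ℤ}, 2 * m - 1 ≤ -r → x' ∈ S.pE m := fun hm => h1.mem hy' hm
  have hdiff : S.mat ((nE x y h)⁻¹ * nE x' y' h1) 0 2 ∈ S.pE (1 - r) → Even r →
      x' - x ∈ S.pE (1 - r / 2) := by
    intro hm hr
    obtain ⟨a, b, hab, -, hg⟩ := eq_nE huv
    rw [hg] at e1 hm
    rw [← e1]
    refine hab.mem (k := 1 - r) hm ?_
    obtain ⟨e, rfl⟩ := hr
    omega
  rw [resN, resN, Prod.mk.injEq, mat_nE, mat_nE]
  simp only [nM, Matrix.of_apply, Matrix.cons_val', Matrix.cons_val_zero, Matrix.cons_val_one,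
      Matrix.cons_val]
  rw [eq_comm (a := res (S.ϖ ^ r * y)), res_eq_iff hY' hY, ← mul_sub, key]
  rw [e2] at hdiff ⊢
  split_ifs with hr
  · rw [eq_comm, res_eq_iff (x_mem h1 hy' hr) (x_mem h hy hr), ← mul_sub, key]
    have hx : x ∈ S.pE (-(r / 2)) := hxm (by obtain ⟨e, rfl⟩ := hr; omega)
    have hr2 : 1 - r = -(r / 2) + (1 - r / 2) := by obtain ⟨e, rfl⟩ := hr; omega
    constructor
    · rintro ⟨h2, h3⟩
      exact pE_add h3 (pE_mul hx (pE_conj h2) hr2)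
    · intro h2
      refine ⟨hdiff h2 hr, ?_⟩
      have := pE_sub h2 (pE_mul hx (pE_conj (hdiff h2 hr)) hr2)
      rwa [add_sub_cancel_right] at this
  · obtain ⟨e, rfl⟩ := Int.not_even_iff_odd.1 hr
    have hx : x ∈ S.pE (-e) := hxm (by omega)
    have hx' : x' ∈ S.pE (-e) := hxm' (by omega)
    have hxx : x * S.conj (x' - x) ∈ S.pE (1 - (2 * e + 1)) :=
      pE_mul hx (pE_conj (pE_sub hx' hx)) (by ring)
    constructor
    · rintro ⟨-, h3⟩
      exact pE_add h3 hxx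
    · intro h2
      refine ⟨rfl, ?_⟩
      have := pE_sub h2 hxx
      rwa [add_sub_cancel_right] at this

lemma resN_one (r : ℤ) : resN r (1 : S.GG) = 0 := by
  simp [resN, mat_one]

lemma resN_ne_zero {r : ℤ} {u : S.GG} (hu : u ∈ S.Nk (-r)) :
    resN r u ≠ 0 ↔ u ∉ S.Nk (1 - r) := by
  rw [not_iff_not, ← resN_one r, eq_comm, resN_eq_iff (S.NS (-r)).one_mem hu, inv_one, one_mul]

lemma resN_surj {r : ℤ} {z : S.kE × S.kE} (hz : z ∈ S.Lr r) : ∃ u ∈ S.Nk (-r), resN r u = z := by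
  obtain ⟨X, hX, hXz⟩ := res_surjective z.1
  obtain ⟨Y0, hY0, hYz⟩ := res_surjective z.2
  obtain ⟨h2, h2'⟩ := S.two_ne_and_inv
  by_cases hr : Even r
  · rw [Lr, if_pos hr, Lbig, Set.mem_ofPred_eq, ← hXz, ← hYz, ← res_conj hX, ← res_conj hY0,
      ← res_mul hX (pE_conj hX), ← res_add (pE_mul hX (pE_conj hX) (by ring)) hY0,
      ← res_add (pE_add (pE_mul hX (pE_conj hX) (by ring)) hY0) (pE_conj hY0), res_eq_zero
      (pE_add (pE_add (pE_mul hX (pE_conj hX) (by ring)) hY0) (pE_conj hY0))] at hz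
    set e := X * S.conj X + Y0 + S.conj Y0 with he
    have hec : S.conj e = e := by
      rw [he]; simp only [map_add, map_mul, S.conj_invol]; ring
    have h2e : 2⁻¹ * e ∈ S.pE 1 := pE_mul (pE_zero.2 h2') hz (by ring)
    have hY : Y0 - 2⁻¹ * e ∈ S.pE 0 := pE_sub hY0 (pE_mono (by norm_num) h2e)
    have hrel : S.Rel (S.ϖ ^ (-(r / 2)) * X) (S.ϖ ^ (-r) * (Y0 - 2⁻¹ * e)) := by
      unfold Setting.Rel
      have h22 : S.ϖ ^ (-(r / 2)) * S.ϖ ^ (-(r / 2)) = S.ϖ ^ (-r) := by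
        rw [← zpow_add₀ S.unif_ne]; obtain ⟨e, rfl⟩ := hr; congr 1; omega
      simp only [map_mul, map_sub, conj_zpow_unif, map_inv₀, map_ofNat, hec]
      have : (2⁻¹ : S.E) * 2 = 1 := inv_mul_cancel₀ h2
      linear_combination X * S.conj X * h22 - S.ϖ ^ (-r) * e * this + S.ϖ ^ (-r) * he
    refine ⟨nE _ _ hrel, nE_mem _ (pE_mul (zpow_unif_mem _) hY (by ring)), ?_⟩
    rw [resN, mat_nE, if_pos hr]
    simp only [nM, Matrix.of_apply, Matrix.cons_val', Matrix.cons_val_zero, Matrix.cons_val_one,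
      Matrix.cons_val]
    rw [← mul_assoc, ← mul_assoc, zpow_unif_mul, zpow_unif_mul, add_neg_cancel, add_neg_cancel,
      zpow_zero, one_mul, one_mul, hXz, ← Prod.eta z, ← hYz]
    refine Prod.ext rfl ((res_eq_iff hY hY0).2 ?_)
    rw [show Y0 - 2⁻¹ * e - Y0 = -(2⁻¹ * e) by ring]
    exact pE_neg h2e
  · rw [Lr, if_neg hr, Lsmall, Set.mem_ofPred_eq, ← hYz, ← res_conj hY0,
      ← res_add hY0 (pE_conj hY0), res_eq_zero (pE_add hY0 (pE_conj hY0))] at hz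
    obtain ⟨hz1, hz⟩ := hz
    set e := Y0 + S.conj Y0 with he
    have hec : S.conj e = e := by
      rw [he]; simp only [map_add, S.conj_invol]; ring
    have h2e : 2⁻¹ * e ∈ S.pE 1 := pE_mul (pE_zero.2 h2') hz (by ring)
    have hY : Y0 - 2⁻¹ * e ∈ S.pE 0 := pE_sub hY0 (pE_mono (by norm_num) h2e)
    have hrel : S.Rel 0 (S.ϖ ^ (-r) * (Y0 - 2⁻¹ * e)) := by
      unfold Setting.Rel
      simp only [map_mul, map_sub, conj_zpow_unif, map_inv₀, map_ofNat, hec]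
      have : (2⁻¹ : S.E) * 2 = 1 := inv_mul_cancel₀ h2
      linear_combination - S.ϖ ^ (-r) * e * this + S.ϖ ^ (-r) * he
    refine ⟨nE _ _ hrel, nE_mem _ (pE_mul (zpow_unif_mem _) hY (by ring)), ?_⟩
    rw [resN, mat_nE, if_neg hr]
    simp only [nM, Matrix.of_apply, Matrix.cons_val', Matrix.cons_val_zero,
      Matrix.cons_val]
    rw [← mul_assoc, zpow_unif_mul, add_neg_cancel, zpow_zero, one_mul, ← Prod.eta z, ← hYz, hz1]
    refine Prod.ext rfl ((res_eq_iff hY hY0).2 ?_)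
    rw [show Y0 - 2⁻¹ * e - Y0 = -(2⁻¹ * e) by ring]
    exact pE_neg h2e

lemma IsReps.bijOn_resN {r : ℤ} {U : Finset S.GG} (hU : S.IsReps (S.Nk (-r)) (S.Nk (1 - r)) U) :
    Set.BijOn (resN r) ↑(U.filter (· ∉ S.Nk (1 - r))) {z | z ∈ S.Lr r ∧ z ≠ 0} := by
  refine ⟨?_, ?_, ?_⟩
  · intro u hu
    obtain ⟨hu, hu'⟩ := Finset.mem_filter.1 (Finset.mem_coe.1 hu)
    exact ⟨resN_mem (hU.1 hu), (resN_ne_zero (hU.1 hu)).2 hu'⟩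
  · intro u hu v hv h
    have hu := (Finset.mem_filter.1 (Finset.mem_coe.1 hu)).1
    have hv := (Finset.mem_filter.1 (Finset.mem_coe.1 hv)).1
    refine (hU.2 u (hU.1 hu)).unique ⟨hu, ?_⟩ ⟨hv, (resN_eq_iff (hU.1 hu) (hU.1 hv)).1 h⟩
    rw [inv_mul_cancel]
    exact (S.NS _).one_mem
  · rintro z ⟨hz, hz0⟩
    obtain ⟨a, ha, rfl⟩ := resN_surj hz
    obtain ⟨u, ⟨hu, h⟩, -⟩ := hU.2 a ha
    have e := (resN_eq_iff ha (hU.1 hu)).2 h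
    refine ⟨u, Finset.mem_coe.2 (Finset.mem_filter.2 ⟨hu, (resN_ne_zero (hU.1 hu)).1 ?_⟩), e.symm⟩
    rwa [← e]

end Setting
end U21

namespace U21

namespace Setting

variable {S : Setting}

/-- In residue characteristic `p`, the norm equation `x^{q+1} = s` with `s ∈ 𝔽_q` has, modulo `p`,
exactly one solution. -/
lemma card_norm_eq {s : S.kE} (hs : s ^ S.q = s) :
    ((Finset.univ.filter fun x : S.kE => x * x ^ S.q = s).card : S.kE) = 1 := by
  have hq := S.one_lt_q
  have hcard : Fintype.card S.kE = S.q ^ 2 := card_kE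
  have : Fact S.p.Prime := ⟨S.hp⟩
  have : CharP S.kE S.p := (CharP.charP_iff_prime_eq_zero S.hp).2 cast_p_kE
  have hfrob : ∀ x y : S.kE, (x - y) ^ S.q = x ^ S.q - y ^ S.q := by
    intro x y; rw [S.hq]; exact sub_pow_char_pow x y _
  have hind : ∀ x : S.kE, (if x * x ^ S.q = s then (1 : S.kE) else 0)
      = 1 - (x * x ^ S.q - s) ^ (S.q - 1) := by
    intro x
    split_ifs with h
    · rw [h, sub_self, zero_pow (by omega), sub_zero]
    · have hne : x * x ^ S.q - s ≠ 0 := sub_ne_zero.2 h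
      have hf : (x * x ^ S.q - s) ^ S.q = x * x ^ S.q - s := by
        rw [hfrob, hs, mul_pow, ← pow_mul, ← sq, ← hcard, FiniteField.pow_card, mul_comm]
      have : (x * x ^ S.q - s) * (x * x ^ S.q - s) ^ (S.q - 1) = (x * x ^ S.q - s) * 1 := by
        rw [mul_one, ← pow_succ', Nat.sub_add_cancel hq.le, hf]
      rw [mul_left_cancel₀ hne this, sub_self]
  have hsum : ∀ j ∈ Finset.range (S.q - 1 + 1), ∑ x : S.kE, (x * x ^ S.q) ^ j * (-s) ^ (S.q - 1 - j)
      * ((S.q - 1).choose j : S.kE) = if j = S.q - 1 then -1 else 0 := by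
    intro j hj
    have hj := Finset.mem_range.1 hj
    rw [← Finset.sum_mul, ← Finset.sum_mul]
    have e : ∀ x : S.kE, (x * x ^ S.q) ^ j = x ^ ((S.q + 1) * j) := fun x => by
      rw [← pow_succ', ← pow_mul]
    simp only [e]
    have hqq : (S.q + 1) * (S.q - 1) = S.q ^ 2 - 1 := by
      rw [← Nat.sq_sub_sq, one_pow]
    split_ifs with h
    · have hk : ∑ x : S.kE, x ^ ((S.q + 1) * j) = -1 := by
        rw [h, hqq, ← hcard]
        have : ∀ x : S.kE, x ^ (Fintype.card S.kE - 1) = 1 - if x = 0 then 1 else 0 := by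
          intro x
          split_ifs with hx
          · rw [hx, zero_pow, sub_self]
            have := Fintype.one_lt_card (α := S.kE); omega
          · rw [FiniteField.pow_card_sub_one_eq_one x hx, sub_zero]
        simp only [this]
        rw [Finset.sum_sub_distrib, Finset.sum_const, Finset.card_univ, nsmul_eq_mul, mul_one,
          FiniteField.cast_card_eq_zero]
        simp
      rw [hk, h]
      simp
    · have hlt : (S.q + 1) * j < Fintype.card S.kE - 1 := by
        rw [hcard, ← hqq]
        exact Nat.mul_lt_mul_of_pos_left (by omega) (by omega)
      rw [FiniteField.sum_pow_lt_card_sub_one S.kE _ hlt]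
      simp
  have h2 : ∑ x : S.kE, (x * x ^ S.q - s) ^ (S.q - 1) = -1 := by
    simp only [sub_eq_add_neg, add_pow]
    rw [Finset.sum_comm]
    rw [Finset.sum_congr rfl hsum]
    simp
  rw [Finset.card_filter]
  push_cast
  simp only [hind]
  rw [Finset.sum_sub_distrib, h2]
  simp

section Const

variable {𝔽 : Type} [Field 𝔽]

lemma finsum_L (A : Set (S.kE × S.kE)) (θ : S.kE → 𝔽) :
    ∑ᶠ z ∈ {z : S.kE × S.kE | z ∈ A ∧ z ≠ 0}, θ z.2
      = ∑ z : S.kE × S.kE, if z ∈ A ∧ z ≠ 0 then θ z.2 else 0 := by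
  rw [← Finset.sum_filter, ← finsum_mem_coe_finset]
  congr 1
  ext z
  simp

/-- A multiplicative function on `k_E^*` with nonzero sum over `L_{q^t} ∖ 0` is constant there. -/
lemma theta_const (hp : (S.p : 𝔽) = 0) {θ : S.kE → 𝔽} (h1 : θ 1 * θ 1 = 1)
    (hmul : ∀ a b, a ≠ 0 → b ≠ 0 → θ a * θ b = θ (a * b) * θ 1) (r : ℤ)
    (hd : ∑ᶠ z ∈ {z : S.kE × S.kE | z ∈ S.Lr r ∧ z ≠ 0}, θ z.2 ≠ 0) :
    ∀ z ∈ S.Lr r, z ≠ 0 → ∀ z' ∈ S.Lr r, z' ≠ 0 → θ z.2 = θ z'.2 := by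
  have h10 : θ 1 ≠ 0 := fun h => by rw [h, mul_zero] at h1; exact zero_ne_one h1
  have hscale : ∀ a t, a ≠ 0 → t ≠ 0 → θ (a * t) = (θ a * θ 1) * θ t := by
    intro a t ha ht
    have := hmul a t ha ht
    linear_combination (-θ 1) * this - θ (a * t) * h1
  have hconst : (∀ a : S.kE, a ≠ 0 → (¬ Even r → a ^ S.q = a) → θ a * θ 1 = 1) →
      ∀ z ∈ S.Lr r, z ≠ 0 → ∀ z' ∈ S.Lr r, z' ≠ 0 → θ z.2 = θ z'.2 := by
    intro H z hz hz0 z' hz' hz0'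
    have hne : ∀ z ∈ S.Lr r, z ≠ 0 → z.2 ≠ 0 := by
      intro z hz hz0 h
      refine hz0 (Prod.ext ?_ h)
      rw [Lr] at hz
      split_ifs at hz with hr
      · rw [Lbig, Set.mem_ofPred_eq, h, zero_pow (by have := S.one_lt_q; omega), add_zero, add_zero] at hz
        rcases mul_eq_zero.1 hz with h | h
        · exact h
        · exact (pow_eq_zero_iff (by have := S.one_lt_q; omega)).1 h
      · exact hz.1
    have ht := hne z hz hz0
    have ht' := hne z' hz' hz0'
    have e : z.2 = (z.2 / z'.2) * z'.2 := by field_simp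
    rw [e, hscale _ _ (div_ne_zero ht ht') ht', H _ (div_ne_zero ht ht'), one_mul]
    intro hr
    rw [Lr, if_neg hr] at hz hz'
    rw [div_pow, eq_neg_of_add_eq_zero_right hz.2, eq_neg_of_add_eq_zero_right hz'.2, neg_div_neg_eq]
  refine hconst fun a ha har => ?_
  rw [finsum_L] at hd
  by_cases hr : Even r
  · have : Fact S.p.Prime := ⟨S.hp⟩
    have : CharP S.kE S.p := (CharP.charP_iff_prime_eq_zero S.hp).2 cast_p_kE
    have : CharP 𝔽 S.p := (CharP.charP_iff_prime_eq_zero S.hp).2 hp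
    have hqpos : S.q ≠ 0 := by have := S.one_lt_q; omega
    have hsum : (∑ z : S.kE × S.kE, if z ∈ S.Lr r ∧ z ≠ 0 then θ z.2 else 0)
        = ∑ t : S.kE, if t ≠ 0 then θ t else 0 := by
      rw [Fintype.sum_prod_type_right]
      refine Finset.sum_congr rfl fun t _ => ?_
      simp only [Lr, if_pos hr, Lbig, Set.mem_ofPred_eq]
      by_cases ht : t = 0
      · rw [if_neg (not_not.2 ht)]
        refine Finset.sum_eq_zero fun x _ => if_neg ?_
        rintro ⟨h, h0⟩
        refine h0 (Prod.ext ?_ ht)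
        rw [ht, zero_pow hqpos, add_zero, add_zero] at h
        rcases mul_eq_zero.1 h with h | h
        · exact h
        · exact (pow_eq_zero_iff hqpos).1 h
      · rw [if_pos ht]
        have hs : (-(t + t ^ S.q)) ^ S.q = -(t + t ^ S.q) := by
          have hodd : Odd S.q := by rw [S.hq]; exact (S.hp.odd_of_ne_two S.hodd).pow
          have hfrob : (t + t ^ S.q) ^ S.q = t ^ S.q + (t ^ S.q) ^ S.q := by
            conv_lhs => rw [S.hq]
            rw [add_pow_char_pow, ← S.hq]
          rw [hodd.neg_pow, hfrob, ← pow_mul, ← sq, ← card_kE, FiniteField.pow_card, add_comm]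
        have hN := card_norm_eq hs
        have hN' : ((Finset.univ.filter fun x : S.kE => x * x ^ S.q = -(t + t ^ S.q)).card : 𝔽) = 1 := by
          rw [← Nat.cast_one, CharP.cast_eq_iff_mod_eq S.kE S.p] at hN
          rw [← Nat.cast_one, CharP.cast_eq_iff_mod_eq 𝔽 S.p]
          exact hN
        have hiff : ∀ x : S.kE, (x * x ^ S.q + t + t ^ S.q = 0 ∧ (x, t) ≠ 0)
            ↔ x * x ^ S.q = -(t + t ^ S.q) := by
          intro x
          rw [add_assoc, add_eq_zero_iff_eq_neg, and_iff_left]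
          exact fun h => ht (congrArg Prod.snd h)
        simp only [hiff]
        rw [← Finset.sum_filter, Finset.sum_const, nsmul_eq_mul, hN', one_mul]
    rw [hsum] at hd
    have : (∑ t : S.kE, if t ≠ 0 then θ t else 0)
        = (θ a * θ 1) * ∑ t : S.kE, if t ≠ 0 then θ t else 0 := by
      conv_lhs => rw [← Equiv.sum_comp (Equiv.mulLeft₀ a ha)]
      rw [Finset.mul_sum]
      refine Finset.sum_congr rfl fun t _ => ?_
      rw [show Equiv.mulLeft₀ a ha t = a * t from rfl]
      simp only [ne_eq, mul_eq_zero, ha, false_or, mul_ite, mul_zero]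
      split_ifs with ht
      · rfl
      · exact hscale a t ha ht
    exact (mul_right_cancel₀ hd (by rw [one_mul]; exact this)).symm
  · have ha' := har hr
    let e : S.kE × S.kE ≃ S.kE × S.kE := Equiv.prodCongr (Equiv.mulLeft₀ a ha) (Equiv.mulLeft₀ a ha)
    have hsum : (∑ z : S.kE × S.kE, if z ∈ S.Lr r ∧ z ≠ 0 then θ z.2 else 0)
        = (θ a * θ 1) * ∑ z : S.kE × S.kE, if z ∈ S.Lr r ∧ z ≠ 0 then θ z.2 else 0 := by
      conv_lhs => rw [← Equiv.sum_comp e]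
      rw [Finset.mul_sum]
      refine Finset.sum_congr rfl fun z _ => ?_
      have hiff : (e z ∈ S.Lr r ∧ e z ≠ 0) ↔ (z ∈ S.Lr r ∧ z ≠ 0) := by
        have he : e z = (a * z.1, a * z.2) := rfl
        rw [he, Lr, if_neg hr]
        simp only [Lsmall, Set.mem_ofPred_eq, mul_pow, ha', ← mul_add, mul_eq_zero, ha, false_or,
          ne_eq, Prod.ext_iff, Prod.fst_zero, Prod.snd_zero]
      simp only [hiff, mul_ite, mul_zero]
      split_ifs with hz
      · refine hscale a z.2 ha fun h => hz.2 (Prod.ext ?_ h)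
        have := hz.1
        rw [Lr, if_neg hr] at this
        exact this.1
      · rfl
    exact (mul_right_cancel₀ hd (by rw [one_mul]; exact hsum)).symm

end Const

lemma dE_mul (a m b n : S.E) (ha hm hb hn) :
    dE a m ha hm * dE b n hb hn = dE (a * b) (m * n) (mul_ne_zero ha hb)
      (by rw [map_mul, mul_mul_mul_comm, hm, hn, one_mul]) := by
  refine mat_inj ?_
  rw [mat_mul]
  simp only [mat_dE]
  ext i j
  fin_cases i <;> fin_cases j <;> simp [Matrix.mul_apply, Fin.sum_univ_three, mul_comm]

end Setting

open Setting

section Chi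

variable {S : Setting} {C : Chamber S} {𝔽 : Type} [Field 𝔽] {W : Type} [AddCommGroup W] [Module 𝔽 W]
  {σ : Representation 𝔽 ↥C.K W} {v0 : W} (hv0 : v0 ≠ 0)
  (hv : ∀ g ∈ C.I1, sigma' C 𝔽 W σ g v0 = v0) {χ : S.GG → 𝔽} (hχ : IsChi C 𝔽 W σ v0 χ)

include hv0 hχ in
lemma chi_mul {g h : S.GG} (hg : g ∈ C.H0) (hh : h ∈ C.H0) (hgh : g * h ∈ C.H0) :
    χ (g * h) = χ g * χ h := by
  refine smul_left_injective 𝔽 hv0 ?_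
  have hgK := Chamber.mem_K_of_IK hg.2
  have hhK := Chamber.mem_K_of_IK hh.2
  simp only
  rw [← hχ _ hgh, sigma'_mul hgK hhK, Module.End.mul_apply, hχ _ hh, map_smul, hχ _ hg, smul_smul,
    mul_comm]

include hv0 hv hχ in
lemma chi_hE_congr {a b : S.E} (ha : a ∈ S.pE 0) (ha' : a⁻¹ ∈ S.pE 0) (ha0 : a ≠ 0) (hb : b ∈ S.pE 0)
    (hb' : b⁻¹ ∈ S.pE 0) (hb0 : b ≠ 0) (h : a - b ∈ S.pE 1) : χ (hE a) = χ (hE b) := by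
  have hA := conj_ne_zero ha0
  have hB := conj_ne_zero hb0
  have hm : (b * S.conj a * (S.conj b * a)⁻¹) * S.conj (b * S.conj a * (S.conj b * a)⁻¹) = 1 := by
    simp only [map_mul, map_inv₀, S.conj_invol]
    field_simp
  have he : hE a = hE b * dE (b⁻¹ * a) _ (mul_ne_zero (inv_ne_zero hb0) ha0) hm := by
    rw [hE, hE, dif_neg ha0, dif_neg hb0, dE_mul]
    refine mat_inj ?_
    simp only [mat_dE]
    have e1 : b * (b⁻¹ * a) = a := by field_simp
    have e2 : -S.conj b * b⁻¹ * (b * S.conj a * (S.conj b * a)⁻¹) = -S.conj a * a⁻¹ := by field_simp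
    rw [e1, e2]
  have hH1 : dE (b⁻¹ * a) _ (mul_ne_zero (inv_ne_zero hb0) ha0) hm ∈ C.H1 := by
    refine Chamber.dE_mem_H1 _ _ ?_ ?_
    · rw [show b⁻¹ * a - 1 = b⁻¹ * (a - b) by field_simp]
      exact pE_mul hb' h (by ring)
    · have : b * S.conj a * (S.conj b * a)⁻¹ - 1
          = (b * S.conj (a - b) - S.conj b * (a - b)) * (S.conj b⁻¹ * a⁻¹) := by
        rw [map_sub, map_inv₀]; field_simp; ring
      rw [this]
      exact pE_mul (pE_sub (pE_mul (l := 1) hb (pE_conj h) (by ring)) (pE_mul (pE_conj hb) h (by ring)))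
        (pE_mul (l := 0) (pE_conj hb') ha' (by ring)) (by ring)
  have hEb : hE b ∈ C.H0 := hE_mem_H0 hb0 hb hb'
  have h1 : χ (dE (b⁻¹ * a) _ (mul_ne_zero (inv_ne_zero hb0) ha0) hm) = 1 := by
    refine smul_left_injective 𝔽 hv0 ?_
    simp only
    rw [← hχ _ (Chamber.mem_H0_of_H1 hH1), hv _ hH1.2, one_smul]
  have hEa : hE a ∈ C.H0 := hE_mem_H0 ha0 ha ha'
  rw [he] at hEa ⊢
  rw [chi_mul hv0 hχ hEb (Chamber.mem_H0_of_H1 hH1) hEa, h1, mul_one]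

include hv0 hχ in
lemma chi_hE_mul {a b : S.E} (ha : a ∈ S.pE 0) (ha' : a⁻¹ ∈ S.pE 0) (ha0 : a ≠ 0) (hb : b ∈ S.pE 0)
    (hb' : b⁻¹ ∈ S.pE 0) (hb0 : b ≠ 0) : χ (hE a) * χ (hE b) = χ (hE (a * b)) * χ (hE 1) := by
  have hi : (a * b)⁻¹ ∈ S.pE 0 := by rw [mul_inv]; exact pE_mul ha' hb' (by ring)
  have hab : a * b ∈ S.pE 0 := pE_mul ha hb (by ring)
  have h0 := mul_ne_zero ha0 hb0
  have e : hE a * hE b = hE (a * b) * hE 1 := by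
    rw [hE, hE, hE, hE, dif_neg ha0, dif_neg hb0, dif_neg h0, dif_neg one_ne_zero, dE_mul, dE_mul]
    refine mat_inj ?_
    simp only [mat_dE]
    congr 1
    simp [mul_comm, mul_left_comm, mul_assoc]
  have h1 : hE (1 : S.E) ∈ C.H0 := hE_mem_H0 one_ne_zero one_mem_pE (by rw [inv_one]; exact one_mem_pE)
  have hA : hE a ∈ C.H0 := hE_mem_H0 ha0 ha ha'
  have hB : hE b ∈ C.H0 := hE_mem_H0 hb0 hb hb'
  have hAB : hE a * hE b ∈ C.H0 := by
    rw [hE, hE, dif_neg ha0, dif_neg hb0, dE_mul]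
    exact Chamber.dE_mem_H0 _ _ hab hi
  rw [← chi_mul hv0 hχ hA hB hAB, e, chi_mul hv0 hχ (hE_mem_H0 h0 hab hi) h1 (e ▸ hAB)]

include hv0 hχ in
lemma chi_hE_one : χ (hE (1 : S.E)) * χ (hE (1 : S.E)) = 1 := by
  have h1 : hE (1 : S.E) ∈ C.H0 := hE_mem_H0 one_ne_zero one_mem_pE (by rw [inv_one]; exact one_mem_pE)
  have e : hE (1 : S.E) * hE 1 = 1 := by
    refine mat_inj ?_
    rw [mat_mul, mat_hE one_ne_zero, mat_one]
    ext i j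
    fin_cases i <;> fin_cases j <;> simp [hM, Matrix.mul_apply, Fin.sum_univ_three]
  have hone : (1 : S.GG) ∈ C.H0 := by
    refine Chamber.mem_H0_of_H1 ⟨⟨1, 1, 1, ?_⟩, Chamber.N_mem_I1 (S.NS _).one_mem⟩
    rw [mat_one]
    ext i j
    fin_cases i <;> fin_cases j <;> simp
  rw [← chi_mul hv0 hχ h1 h1 (by rw [e]; exact hone), e]
  refine smul_left_injective 𝔽 hv0 ?_
  simp only
  rw [← hχ _ hone, one_smul, sigma', dif_pos C.K.one_mem]; exact LinearMap.congr_fun (map_one σ) v0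

end Chi
end U21

namespace U21

open Setting

section Parts

variable {S : Setting} {C : Chamber S} {𝔽 : Type} [Field 𝔽] {W : Type} [AddCommGroup W] [Module 𝔽 W]
  {σ : Representation 𝔽 ↥C.K W} {v0 : W} (hv0 : v0 ≠ 0)
  (hv : ∀ g ∈ C.I1, sigma' C 𝔽 W σ g v0 = v0) {χ : S.GG → 𝔽} (hχ : IsChi C 𝔽 W σ v0 χ)
  {lift : S.kE → S.O} (hlift : ∀ t, S.resmap (lift t) = t)
  {hmap : S.kE → S.GG} (hhmap : ∀ t : S.kE, t ≠ 0 → S.mat (hmap t) = S.hM ↑(lift t))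

lemma sigma'_one : sigma' C 𝔽 W σ 1 = 1 := by
  rw [sigma', dif_pos C.K.one_mem]; exact map_one σ

lemma unit_of_res_ne {a : S.E} (ha : a ∈ S.pE 0) (h : res a ≠ 0) : a ≠ 0 ∧ a⁻¹ ∈ S.pE 0 := by
  have h1 : a ∉ S.pE (0 + 1) := fun h' => h ((res_eq_zero ha).2 h')
  have := inv_mem_of_not_mem h1
  rw [neg_zero] at this
  exact ⟨ne_zero_of_not_mem h1, this⟩

include hv0 hv hχ hlift hhmap in
lemma chi_hmap_res {a : S.E} (ha : a ∈ S.pE 0) (ha0 : res a ≠ 0) :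
    χ (hmap (res a)) = χ (hE a) := by
  have hl : (lift (res a) : S.E) ∈ S.pE 0 := pE_zero.2 (lift (res a)).2
  have hlr : res (lift (res a) : S.E) = res a := by rw [res_of_mem hl]; exact hlift _
  obtain ⟨h1, h2⟩ := unit_of_res_ne hl (by rwa [hlr])
  obtain ⟨h3, h4⟩ := unit_of_res_ne ha ha0
  have e : hmap (res a) = hE (lift (res a) : S.E) :=
    mat_inj (by rw [hhmap _ ha0, mat_hE h1])
  rw [e]
  exact chi_hE_congr hv0 hv hχ hl h2 h1 ha h4 h3 ((res_eq_iff hl ha).1 hlr)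

lemma resN_snd_ne {r : ℤ} {u : S.GG} (hu : u ∈ S.Nk (-r)) (hu1 : u ∉ S.Nk (1 - r)) :
    S.ϖ ^ r * S.mat u 0 2 ∈ S.pE 0 ∧ res (S.ϖ ^ r * S.mat u 0 2) ≠ 0 := by
  obtain ⟨h1, h2, h3⟩ := lead_unit hu hu1
  refine ⟨h1, fun h => ?_⟩
  have := pE_mul h2 ((res_eq_zero h1).1 h) rfl
  rw [inv_mul_cancel₀ h3] at this
  exact one_not_mem_pE (by simpa using this)

include hv0 hv hχ hlift hhmap in
lemma sum_chi_eq {r : ℤ} {U : Finset S.GG} (hU : S.IsReps (S.Nk (-r)) (S.Nk (1 - r)) U) :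
    ∑ u ∈ U with u ∉ S.Nk (1 - r), χ (hE (S.ϖ ^ r * S.mat u 0 2))
      = ∑ᶠ z ∈ {z : S.kE × S.kE | z ∈ S.Lr r ∧ z ≠ 0}, χ (hmap z.2) := by
  rw [← finsum_mem_coe_finset]
  refine finsum_mem_eq_of_bijOn (resN r) hU.bijOn_resN fun u hu => ?_
  obtain ⟨hu, hu1⟩ := Finset.mem_filter.1 (Finset.mem_coe.1 hu)
  obtain ⟨h1, h2⟩ := resN_snd_ne (hU.1 hu) hu1
  exact (chi_hmap_res hv0 hv hχ hlift hhmap h1 h2).symm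

include hv0 hv hχ hlift hhmap in
/-- If the character sum over `N_{-r}/N_{1-r}` is nonzero, its terms are all equal. -/
lemma chi_const (hp : (S.p : 𝔽) = 0) {r : ℤ}
    (hd : ∑ᶠ z ∈ {z : S.kE × S.kE | z ∈ S.Lr r ∧ z ≠ 0}, χ (hmap z.2) ≠ 0)
    {u v : S.GG} (hu : u ∈ S.Nk (-r)) (hu1 : u ∉ S.Nk (1 - r)) (hw : v ∈ S.Nk (-r))
    (hw1 : v ∉ S.Nk (1 - r)) :
    χ (hE (S.ϖ ^ r * S.mat u 0 2)) = χ (hE (S.ϖ ^ r * S.mat v 0 2)) := by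
  have hr1 : res (1 : S.E) = 1 := by rw [res_of_mem one_mem_pE]; exact map_one S.resmap
  have hone : χ (hmap 1) = χ (hE 1) := by
    rw [← hr1]
    exact chi_hmap_res hv0 hv hχ hlift hhmap one_mem_pE (by rw [hr1]; exact one_ne_zero)
  obtain ⟨h1, h2⟩ := resN_snd_ne hu hu1
  obtain ⟨h3, h4⟩ := resN_snd_ne hw hw1
  rw [← chi_hmap_res hv0 hv hχ hlift hhmap h1 h2, ← chi_hmap_res hv0 hv hχ hlift hhmap h3 h4]
  refine theta_const (θ := fun t => χ (hmap t)) hp ?_ ?_ r hd (resN r u) (resN_mem hu)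
    ((resN_ne_zero hu).2 hu1) (resN r v) (resN_mem hw) ((resN_ne_zero hw).2 hw1)
  · simp only [hone]
    exact chi_hE_one hv0 hχ
  · intro s t hs ht
    obtain ⟨a, ha, rfl⟩ := res_surjective s
    obtain ⟨b, hb, rfl⟩ := res_surjective t
    obtain ⟨ha0, ha'⟩ := unit_of_res_ne ha hs
    obtain ⟨hb0, hb'⟩ := unit_of_res_ne hb ht
    have hst := mul_ne_zero hs ht
    rw [← res_mul ha hb] at hst ⊢
    simp only [hone]
    rw [chi_hmap_res hv0 hv hχ hlift hhmap ha hs, chi_hmap_res hv0 hv hχ hlift hhmap hb ht,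
      chi_hmap_res hv0 hv hχ hlift hhmap (pE_mul ha hb (by ring)) hst]
    exact chi_hE_mul hv0 hχ ha ha' ha0 hb hb' hb0

lemma Lof_tK : S.Lof C.tK = S.Lr C.s := by
  rcases C.cases with ⟨-, -, -, -, -, -, h, -, h'⟩ | ⟨-, -, -, -, -, -, h, -, h'⟩ <;>
    simp [Lof, Lr, Chamber.s, h, h']

lemma Lof_four_sub_tK : S.Lof (4 - C.tK) = S.Lr (-(C.s + 1)) := by
  rcases C.cases with ⟨-, -, -, -, -, -, h, -, h'⟩ | ⟨-, -, -, -, -, -, h, -, h'⟩ <;>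
    simp [Lof, Lr, Chamber.s, h, h']

variable {ff : ℤ → ↥(IndSub C 𝔽 W σ)} (hff : IsFFamily C 𝔽 W σ v0 ff)

lemma coe_sum_indRep (U : Finset S.GG) (b : S.GG → S.GG) (f : ↥(IndSub C 𝔽 W σ)) (x : S.GG) :
    (↑(∑ u ∈ U, indRep C 𝔽 W σ (b u) f) : S.GG → W) x = ∑ u ∈ U, (f : S.GG → W) (x * b u) := by
  rw [Submodule.coe_sum, Finset.sum_apply]
  rfl

lemma ind_K (f : ↥(IndSub C 𝔽 W σ)) (k : S.GG) (hk : k ∈ C.K) (x : S.GG) :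
    (f : S.GG → W) (k * x) = sigma' C 𝔽 W σ k ((f : S.GG → W) x) := by
  rw [sigma', dif_pos hk]
  exact f.2.1 k hk x

include hff in
lemma ff_mul (n : ℤ) (x : S.GG) {g : S.GG} (hg : g ∈ C.I1) :
    (ff n : S.GG → W) (x * g) = (ff n : S.GG → W) x :=
  congrFun (congrArg Subtype.val (hff.2.2.1 n g hg)) x

lemma H0_comm_alpha {h : S.GG} (hh : h ∈ C.H0) (j : ℤ) : S.alphaE ^ j * h = h * S.alphaE ^ j := by
  obtain ⟨a, m, ha, hm, -, -, rfl⟩ := Chamber.eq_dE_of_H0 hh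
  exact alpha_zpow_mul_dE j a m ha hm

include hv0 hv hχ hlift hhmap hff in
lemma SK_ff_neg (hp : (S.p : 𝔽) = 0) {n : ℤ} (hn : 1 ≤ n) {U : Finset S.GG}
    (hU : S.IsReps (S.Nk C.nK) (S.Nk (C.nK + 1)) U) :
    ∑ u ∈ U, indRep C 𝔽 W σ (u * C.βK) (ff (-n)) =
      (∑ᶠ z ∈ {z : S.kE × S.kE | z ∈ S.Lof C.tK ∧ z ≠ 0}, χ (hmap z.2)) • ff (-n) := by
  rw [C.nK_eq, neg_add_eq_sub] at hU
  refine Subtype.ext (funext fun x => ?_)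
  rw [coe_sum_indRep, Lof_tK, ← sum_chi_eq hv0 hv hχ hlift hhmap hU, C.βK_eq]
  simp only [← mul_assoc]
  have hs := C.s_nonneg
  have hs' := C.s_le_one
  refine hecke_eigen (j := n) hv hχ hp (ind_K _) (fun x g hg => ff_mul hff _ x (Chamber.N_mem_I1 hg))
    (fun x g hg => ff_mul hff _ x (Chamber.N'_mem_I1 hg)) ?_ ?_ (by omega) hU x
  · intro x hx
    obtain ⟨k, hk, i, hi, rfl⟩ := hff.2.2.2.1 (-n) x hx
    obtain ⟨n', hn', h, hh, m, hm, rfl⟩ := Chamber.I1_dec hi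
    refine ⟨k * (S.alphaE ^ n * n' * S.alphaE ^ (-n)) * h, ?_, m, hm, ?_⟩
    · refine C.K.mul_mem (C.K.mul_mem hk ?_) (Chamber.mem_K_of_IK hh.2)
      exact Chamber.mem_K_of_I1 (Chamber.N'_mem_I1 (N'k_mono (by omega) (alpha_conj_n' n hn')))
    · rw [neg_neg, show k * (S.alphaE ^ n * n' * S.alphaE ^ (-n)) * h * S.alphaE ^ n * m =
        k * (S.alphaE ^ n * n' * S.alphaE ^ (-n)) * (h * S.alphaE ^ n) * m by group,
        ← H0_comm_alpha hh]
      group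
  · have := hff.2.2.2.2.2 (-n) (by omega)
    rwa [neg_neg] at this

include hv0 hv hχ hlift hhmap hff in
lemma Sminus_ff (hp : (S.p : 𝔽) = 0) {n : ℤ} (hn : 1 ≤ n) {U : Finset S.GG}
    (hU : S.IsReps (S.N'k C.mK) (S.N'k (C.mK + 1)) U) :
    ∑ u ∈ U, indRep C 𝔽 W σ (u * C.βK * S.alphaE⁻¹) (ff n) =
      (∑ᶠ z ∈ {z : S.kE × S.kE | z ∈ S.Lof (4 - C.tK) ∧ z ≠ 0}, χ (hmap z.2)) • ff n := by
  have hb := bE_mul_bE (S := S) 0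
  have hbi := bE_inv (S := S) 0
  have hinvol : ∀ g, S.bE 0 * (S.bE 0 * g * S.bE 0) * S.bE 0 = g := fun g => by
    rw [show S.bE 0 * (S.bE 0 * g * S.bE 0) * S.bE 0 = (S.bE 0 * S.bE 0) * g * (S.bE 0 * S.bE 0) by
      group, hb, one_mul, mul_one]
  have hiff : ∀ k g, S.bE 0 * g * S.bE 0 ∈ S.Nk k ↔ g ∈ S.N'k k := by
    intro k g
    refine ⟨fun h => ?_, fun h => by simpa using bE_conj_n' 0 h⟩
    have := bE_conj_n 0 h
    rwa [hinvol, mul_zero, add_zero] at this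
  have hU' : S.IsReps (S.Nk (-(-(C.s + 1)))) (S.Nk (1 - -(C.s + 1)))
      (U.image (MulAut.conj (S.bE 0))) := by
    rw [C.mK_eq] at hU
    refine hU.map (MulAut.conj (S.bE 0)) (fun g => ?_) fun g => ?_
    · rw [MulAut.conj_apply, hbi, neg_neg, hiff]
    · rw [MulAut.conj_apply, hbi, hiff]
      rw [show 1 - -(C.s + 1) = C.s + 1 + 1 by ring]
  have hs := C.s_nonneg
  have hs' := C.s_le_one
  refine Subtype.ext (funext fun x => ?_)
  have key := hecke_eigen (f := fun y => (ff n : S.GG → W) (y * S.bE 0)) (j := n + C.s) hv hχ hp ?_ ?_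
    ?_ ?_ ?_ (by omega) hU' (x * S.bE 0)
  · rw [sum_chi_eq hv0 hv hχ hlift hhmap hU', Finset.sum_image (MulEquiv.injective _).injOn,
      ← Lof_four_sub_tK] at key
    simp only [mul_assoc x, hb, mul_one] at key
    rw [coe_sum_indRep]
    refine Eq.trans (Finset.sum_congr rfl fun u _ => ?_) key
    have e : S.bE C.s * S.alphaE⁻¹ = S.bE 0 * S.bE (-(C.s + 1)) * S.bE 0 := by
      have h1 := bE_mul_alpha (S := S) C.s (-1)
      have h2 : S.bE 0 * S.bE (-(C.s + 1)) = S.alphaE ^ (C.s + 1) := by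
        rw [show S.bE (-(C.s + 1)) = S.bE 0 * S.alphaE ^ (C.s + 1) by rw [bE_mul_alpha]; congr 1; ring,
          ← mul_assoc, hb, one_mul]
      rw [zpow_neg_one] at h1
      rw [h1, h2, alpha_mul_bE]
      congr 1; ring
    rw [C.βK_eq, mul_assoc u, e, MulAut.conj_apply, hbi]
    simp only [mul_assoc]
    rw [← mul_assoc (S.bE 0) (S.bE 0), hb, one_mul]
  · intro k hk y
    simp only [mul_assoc]
    exact ind_K _ k hk _
  · intro y m hm
    rw [neg_neg] at hm
    have := ff_mul hff n (y * S.bE 0) (Chamber.N'_mem_I1 (by simpa using bE_conj_n 0 hm))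
    simp only [mul_assoc] at this ⊢
    rw [← this, ← mul_assoc (S.bE 0) (S.bE 0), hb, one_mul]
  · intro y m hm
    have := ff_mul hff n (y * S.bE 0) (Chamber.N_mem_I1 ((hiff _ _).2
      (by rwa [show -(C.s + 1) + 1 = -C.s by ring] at hm)))
    simp only [mul_assoc] at this ⊢
    rw [← this, ← mul_assoc (S.bE 0) (S.bE 0), hb, one_mul]
  · intro y hy
    obtain ⟨k, hk, i, hi, e⟩ := hff.2.2.2.1 n _ hy
    obtain ⟨n', hn', h, hh, m, hm, he⟩ := Chamber.IK_dec (C.ISub.inv_mem (Chamber.mem_IK_of_I1 hi))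
    have hi' : i = m⁻¹ * h⁻¹ * n'⁻¹ := by rw [← inv_inv i, he]; group
    have hm' : m⁻¹ ∈ S.Nk (-C.s) := (S.NS (-C.s)).inv_mem hm
    have hh' : h⁻¹ * S.alphaE ^ (-n) = S.alphaE ^ (-n) * h⁻¹ := by
      have := congrArg (fun z => h⁻¹ * z * h⁻¹) (H0_comm_alpha hh (-n))
      simpa [mul_assoc] using this
    have hc := bE_conj_n' 0 (bE_conj_n n hm')
    have ec : S.bE 0 * (S.bE n * m⁻¹ * S.bE n) * S.bE 0 = S.alphaE ^ (-n) * m⁻¹ * S.alphaE ^ n := by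
      have h1 : S.bE n * S.bE 0 = S.alphaE ^ n := by
        rw [show S.bE n = S.alphaE ^ n * S.bE 0 by rw [alpha_mul_bE]; congr 1; ring, mul_assoc, hb,
          mul_one]
      have h2 : S.bE 0 * S.bE n = S.alphaE ^ (-n) := by
        rw [zpow_neg, ← h1, mul_inv_rev, bE_inv, bE_inv]
      rw [← h1, ← h2]; group
    rw [ec] at hc
    have hmem : S.alphaE ^ (-n) * m⁻¹ * S.alphaE ^ n ∈ C.K :=
      Chamber.mem_K_of_I1 (Chamber.N_mem_I1 (Nk_mono (by omega) hc))
    refine ⟨k * (S.alphaE ^ (-n) * m⁻¹ * S.alphaE ^ n) * h⁻¹ * S.bE C.s, ?_, S.bE 0 * n'⁻¹ * S.bE 0,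
      ?_, ?_⟩
    · exact C.K.mul_mem (C.K.mul_mem (C.K.mul_mem hk hmem) (C.K.inv_mem (Chamber.mem_K_of_IK hh.2)))
        Chamber.bE_mem_K
    · rw [neg_neg]
      refine (S.NS (C.s + 1)).inv_mem_iff.1 ?_
      rw [mul_inv_rev, mul_inv_rev, inv_inv, hbi, ← mul_assoc]
      exact (hiff _ _).2 hn'
    · have ey : y = k * S.alphaE ^ (-n) * i * S.bE 0 := by
        rw [← e, mul_assoc, hb, mul_one]
      have eb : S.bE C.s * S.alphaE ^ (n + C.s) * S.bE 0 = S.alphaE ^ (-n) := by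
        rw [bE_mul_alpha, show C.s - (n + C.s) = 0 + -n by ring, ← alpha_mul_bE, mul_assoc, hb, mul_one]
      rw [show k * (S.alphaE ^ (-n) * m⁻¹ * S.alphaE ^ n) * h⁻¹ * S.bE C.s * S.alphaE ^ (n + C.s) *
        (S.bE 0 * n'⁻¹ * S.bE 0) = k * (S.alphaE ^ (-n) * m⁻¹ * S.alphaE ^ n) * h⁻¹ *
        (S.bE C.s * S.alphaE ^ (n + C.s) * S.bE 0) * n'⁻¹ * S.bE 0 by group, eb, ey, hi',
        mul_assoc (k * (S.alphaE ^ (-n) * m⁻¹ * S.alphaE ^ n)), hh']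
      group
  · have h1 : S.alphaE ^ (n + C.s) * S.bE 0 = S.bE C.s * S.alphaE ^ (-n) := by
      rw [alpha_mul_bE, bE_mul_alpha]; congr 1; ring
    rw [h1, ind_K _ _ Chamber.bE_mem_K, hff.2.2.2.2.1 n (by omega), C.βK_eq, ← Module.End.mul_apply,
      ← sigma'_mul Chamber.bE_mem_K Chamber.bE_mem_K, bE_mul_bE, sigma'_one, Module.End.one_apply]

end Parts
end U21

namespace U21

section Fixed

variable {𝔽 : Type*} [Field 𝔽] {G V : Type*} [Group G] [AddCommGroup V] [Module 𝔽 V]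

/-- The `𝔽_p`-span of the orbit of a vector under finitely many operators, in the form of a
finite stable additive subgroup. -/
lemma exists_finite_stable {p : ℕ} [Fact p.Prime] [Module (ZMod p) V] (ρ : Representation 𝔽 G V)
    (U : Finset G) (hU : ∀ g, ∃ u ∈ U, ρ g = ρ u) (v : V) :
    ∃ X : AddSubgroup V, Finite X ∧ v ∈ X ∧ ∀ g, ∀ x ∈ X, ρ g x ∈ X := by
  have hfin : (Set.range fun g => ρ g v).Finite := by
    refine (U.finite_toSet.image fun g => ρ g v).subset ?_
    rintro _ ⟨g, rfl⟩
    obtain ⟨u, hu, e⟩ := hU g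
    exact ⟨u, hu, by simp only [e]⟩
  have hXf := Module.Finite.span_of_finite (ZMod p) hfin
  refine ⟨(Submodule.span (ZMod p) (Set.range fun g => ρ g v)).toAddSubgroup,
    Module.finite_of_finite (ZMod p) (M := Submodule.span (ZMod p) (Set.range fun g => ρ g v)),
    Submodule.subset_span ⟨1, by simp⟩, fun g x hx => ?_⟩
  have hle : Submodule.span (ZMod p) (Set.range fun g => ρ g v) ≤
      (Submodule.span (ZMod p) (Set.range fun g => ρ g v)).comap
        ((ρ g).toAddMonoidHom.toZModLinearMap p) := by
    refine Submodule.span_le.2 ?_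
    rintro _ ⟨g', rfl⟩
    refine Submodule.subset_span ⟨g * g', ?_⟩
    simp
  exact hle hx

/-- A representation in characteristic `p` which factors through a finite `p`-group has a nonzero
fixed vector. -/
lemma exists_fixed_vector {p : ℕ} (hp : p.Prime) (hp0 : (p : 𝔽) = 0) (ρ : Representation 𝔽 G V)
    (U : Finset G) (hU : ∀ g, ∃ u ∈ U, ρ g = ρ u) (hpow : ∀ g, ρ (g ^ p) = 1) {v : V}
    (hv : v ≠ 0) : ∃ w, w ≠ 0 ∧ ∀ g, ρ g w = w := by
  have hfact : Fact p.Prime := ⟨hp⟩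
  have hpV : ∀ x : V, p • x = 0 := fun x => by rw [← Nat.cast_smul_eq_nsmul 𝔽, hp0, zero_smul]
  let Q := G ⧸ MonoidHom.ker ρ
  let ρ' : Q →* Module.End 𝔽 V := QuotientGroup.lift (MonoidHom.ker ρ) ρ le_rfl
  have hρ' : ∀ g : G, ρ' (g : Q) = ρ g := fun g => QuotientGroup.lift_mk _ le_rfl g
  let _ : Module (ZMod p) V := AddCommGroup.zmodModule hpV
  obtain ⟨X, hX, hvX, hXs⟩ := exists_finite_stable (p := p) ρ U hU v
  have hstab : ∀ (q : Q) (x : V), x ∈ X → ρ' q x ∈ X := by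
    intro q x hx
    induction q using QuotientGroup.induction_on with
    | H g => rw [hρ']; exact hXs g x hx
  let _ : MulAction Q X :=
    { smul := fun q x => ⟨ρ' q x, hstab q x x.2⟩
      one_smul := fun x => Subtype.ext (by
        show ρ' 1 (x : V) = x
        rw [map_one, Module.End.one_apply])
      mul_smul := fun a b x => Subtype.ext (by
        show ρ' (a * b) (x : V) = ρ' a (ρ' b x)
        rw [map_mul, Module.End.mul_apply]) }
  have hQ : IsPGroup p Q := by
    intro q
    induction q using QuotientGroup.induction_on with
    | H g =>
    exact ⟨1, by rw [pow_one, ← QuotientGroup.mk_pow]; exact (QuotientGroup.eq_one_iff _).2 (hpow g)⟩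
  have hx0 : (⟨v, hvX⟩ : X) ≠ 0 := fun h => hv (congrArg Subtype.val h)
  have hdvd : p ∣ Nat.card X := by
    rw [← addOrderOf_eq_prime (p := p) (Subtype.ext (hpV v)) hx0]
    exact addOrderOf_dvd_natCard _
  obtain ⟨b, hb, hb0⟩ := hQ.exists_fixed_point_of_prime_dvd_card_of_fixed_point X hdvd
    (a := 0) (fun q => Subtype.ext (map_zero (ρ' q)))
  refine ⟨b, fun h => hb0 (Subtype.ext h.symm), fun g => ?_⟩
  rw [← hρ']
  exact congrArg Subtype.val (hb (g : Q))

end Fixed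

/-- A group with a split `BN`-pair of rank one, up to a subgroup `A1` of the positive unipotent
subgroup `A` whose conjugates are meant to act trivially. -/
structure RankOne (Γ : Type*) [Group Γ] where
  A : Subgroup Γ
  A1 : Subgroup Γ
  H : Subgroup Γ
  I : Subgroup Γ
  β : Γ
  tor : Γ → Γ
  U : Finset Γ
  p : ℕ
  prime : p.Prime
  β_mul : β * β = 1
  A1_le : A1 ≤ A
  A_le : A ≤ I
  H_le : H ≤ I
  β_notMem : β ∉ I
  conj_A1 : ∀ a ∈ A, ∀ b ∈ A1, a * b * a⁻¹ ∈ A1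
  conj_H : ∀ h ∈ H, ∀ a ∈ A, h * a * h⁻¹ ∈ A
  conj_H1 : ∀ h ∈ H, ∀ a ∈ A1, h * a * h⁻¹ ∈ A1
  β_conj : ∀ h ∈ H, β * h * β ∈ H
  core : ∀ a ∈ A1, ∀ x, x * a * x⁻¹ ∈ I
  tor_mem : ∀ u ∈ A, u ∉ A1 → tor u ∈ H
  dec : ∀ u ∈ A, u ∉ A1 → ∃ u1 ∈ A, u1 ∉ A1 ∧ ∃ u2 ∈ A, u * β = β * u1 * β * tor u * u2
  bruhat : ∀ k ∉ I, ∃ u ∈ A, ∃ b ∈ I, k = u * β * b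
  I_dec : ∀ k ∈ I, ∃ a1 ∈ A1, ∃ h ∈ H, ∃ a ∈ A, k = β * a1 * β * h * a
  pow_mem : ∀ a ∈ A, a ^ p ∈ A1
  U_sub : ∀ u ∈ U, u ∈ A
  reps : ∀ a ∈ A, ∃! u, u ∈ U ∧ a⁻¹ * u ∈ A1
  p_dvd : p ∣ U.card
  tor_inv : ∃ u ∈ A, u ∉ A1 ∧ ∃ u' ∈ A, u' ∉ A1 ∧ tor u * tor u' = 1

namespace RankOne

variable {Γ : Type*} [Group Γ] (R : RankOne Γ)

lemma β_inv : R.β⁻¹ = R.β := inv_eq_of_mul_eq_one_left R.β_mul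

lemma β_cancel (x : Γ) : R.β * (R.β * x) = x := by rw [← mul_assoc, R.β_mul, one_mul]

lemma exists_rep_one : ∃ u ∈ R.U, u ∈ R.A1 := by
  obtain ⟨u, ⟨h1, h2⟩, -⟩ := R.reps 1 R.A.one_mem
  exact ⟨u, h1, by simpa using h2⟩

lemma rep_eq {u u' : Γ} (hu : u ∈ R.U) (hu' : u' ∈ R.U) (h : u⁻¹ * u' ∈ R.A1) : u = u' :=
  (R.reps u (R.U_sub u hu)).unique ⟨hu, by simp [R.A1.one_mem]⟩ ⟨hu', h⟩

lemma filter_mem_A1 : ∃ u0 ∈ R.A1, R.U.filter (· ∈ R.A1) = {u0} := by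
  obtain ⟨u0, h0, h1⟩ := R.exists_rep_one
  refine ⟨u0, h1, Finset.ext fun u => ?_⟩
  rw [Finset.mem_filter, Finset.mem_singleton]
  constructor
  · rintro ⟨hu, hu1⟩
    exact (R.rep_eq h0 hu (R.A1.mul_mem (R.A1.inv_mem h1) hu1)).symm
  · rintro rfl
    exact ⟨h0, h1⟩

lemma sum_reindex {X : Type*} [AddCommMonoid X] (φ : Γ → X)
    (hφ : ∀ a ∈ R.A, ∀ b ∈ R.A1, φ (a * b) = φ a) (e : Γ → Γ) (heA : ∀ a ∈ R.A, e a ∈ R.A)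
    (he : ∀ a ∈ R.A, ∀ b ∈ R.A, (e a)⁻¹ * e b ∈ R.A1 → a⁻¹ * b ∈ R.A1) :
    ∑ u ∈ R.U, φ (e u) = ∑ u ∈ R.U, φ u := by
  choose! r hr _ using R.reps
  have hinj : Set.InjOn (fun u => r (e u)) (R.U : Set Γ) := by
    intro u hu u' hu' h
    have hu := Finset.mem_coe.1 hu
    have hu' := Finset.mem_coe.1 hu'
    have h1 := (hr (e u) (heA u (R.U_sub u hu))).2
    have h2 := (hr (e u') (heA u' (R.U_sub u' hu'))).2
    refine R.rep_eq hu hu' (he u (R.U_sub u hu) u' (R.U_sub u' hu') ?_)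
    have := R.A1.mul_mem h1 (R.A1.inv_mem h2)
    rw [show r (e u) = r (e u') from h] at this
    simpa [mul_assoc] using this
  have hmaps : Set.MapsTo (fun u => r (e u)) (R.U : Set Γ) R.U := fun u hu =>
    (hr (e u) (heA u (R.U_sub u hu))).1
  refine Finset.sum_nbij (fun u => r (e u)) hmaps hinj
    (Finset.surjOn_of_injOn_of_card_le _ hmaps hinj le_rfl) fun u hu => ?_
  have h2 := hr (e u) (heA u (R.U_sub u hu))
  rw [← hφ _ (heA u (R.U_sub u hu)) _ h2.2, mul_inv_cancel_left]

lemma sum_left {X : Type*} [AddCommMonoid X] (φ : Γ → X)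
    (hφ : ∀ a ∈ R.A, ∀ b ∈ R.A1, φ (a * b) = φ a) {a : Γ} (ha : a ∈ R.A) :
    ∑ u ∈ R.U, φ (a * u) = ∑ u ∈ R.U, φ u :=
  R.sum_reindex φ hφ (a * ·) (fun _ h => R.A.mul_mem ha h) fun x _ y _ h => by
    simpa [mul_assoc] using h

lemma sum_right {X : Type*} [AddCommMonoid X] (φ : Γ → X)
    (hφ : ∀ a ∈ R.A, ∀ b ∈ R.A1, φ (a * b) = φ a) {a : Γ} (ha : a ∈ R.A) :
    ∑ u ∈ R.U, φ (u * a) = ∑ u ∈ R.U, φ u :=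
  R.sum_reindex φ hφ (· * a) (fun _ h => R.A.mul_mem h ha) fun x _ y _ h => by
    have := R.conj_A1 a ha _ h
    simpa [mul_assoc] using this

lemma sum_conj {X : Type*} [AddCommMonoid X] (φ : Γ → X)
    (hφ : ∀ a ∈ R.A, ∀ b ∈ R.A1, φ (a * b) = φ a) {h : Γ} (hh : h ∈ R.H) :
    ∑ u ∈ R.U, φ (h * u * h⁻¹) = ∑ u ∈ R.U, φ u :=
  R.sum_reindex φ hφ (fun u => h * u * h⁻¹) (R.conj_H h hh) fun x _ y _ hxy => by
    have := R.conj_H1 _ (R.H.inv_mem hh) _ hxy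
    simpa [mul_assoc] using this

/-- The cell `A β I` meets `I` trivially. -/
lemma mem_A1_of_conj_mem_I {u : Γ} (hu : u ∈ R.A) (h : R.β * u * R.β ∈ R.I) : u ∈ R.A1 := by
  by_contra hu1
  obtain ⟨u1, h1, -, u2, h2, e⟩ := R.dec u hu hu1
  refine R.β_notMem ?_
  have e2 : R.β = u1⁻¹ * (R.β * u * R.β) * u2⁻¹ * (R.tor u)⁻¹ := by
    rw [mul_assoc R.β u, e]
    simp only [mul_assoc, R.β_cancel]
    group
  rw [e2]
  have hI := fun {x : Γ} => R.I.inv_mem (x := x)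
  exact R.I.mul_mem (R.I.mul_mem (R.I.mul_mem (hI (R.A_le h1)) h) (hI (R.A_le h2)))
    (hI (R.H_le (R.tor_mem u hu hu1)))

lemma conj_mem_I {u : Γ} (hu : u ∈ R.A1) : R.β * u * R.β ∈ R.I := by
  have := R.core u hu R.β
  rwa [R.β_inv] at this

lemma mul_β_notMem {u : Γ} (hu : u ∈ R.A) : u * R.β ∉ R.I := fun h => R.β_notMem <| by
  have := R.I.mul_mem (R.I.inv_mem (R.A_le hu)) h
  rwa [inv_mul_cancel_left] at this

/-- Induction principle for subsets of `Γ` which are stable under multiplication. -/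
lemma gen_induction {P : Γ → Prop} (hmul : ∀ x y, P x → P y → P (x * y)) (hA : ∀ a ∈ R.A, P a)
    (hH : ∀ h ∈ R.H, P h) (hβ : P R.β) (x : Γ) : P x := by
  have hI : ∀ k ∈ R.I, P k := by
    intro k hk
    obtain ⟨a1, h1, h, hh, a, ha, rfl⟩ := R.I_dec k hk
    exact hmul _ _ (hmul _ _ (hmul _ _ (hmul _ _ hβ (hA _ (R.A1_le h1))) hβ) (hH _ hh)) (hA _ ha)
  by_cases hx : x ∈ R.I
  · exact hI x hx
  · obtain ⟨u, hu, b, hb, rfl⟩ := R.bruhat x hx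
    exact hmul _ _ (hmul _ _ (hA _ hu) hβ) (hI _ hb)

end RankOne

end U21

namespace U21
namespace RankOne

variable {Γ : Type*} [Group Γ] (R : RankOne Γ) {𝔽 : Type*} [Field 𝔽] {W : Type*} [AddCommGroup W]
  [Module 𝔽 W] (σ : Representation 𝔽 Γ W)

/-- An irreducible representation in characteristic `p`, trivial on the conjugates of `A1`,
together with an `A`-fixed line on which `H` acts through `χ`. -/
structure IsRep (v0 : W) (χ : Γ → 𝔽) : Prop where
  cast_p : (R.p : 𝔽) = 0
  triv : ∀ a ∈ R.A1, ∀ x, σ (x * a * x⁻¹) = 1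
  irr : ∀ N : Submodule 𝔽 W, (∀ k, ∀ w ∈ N, σ k w ∈ N) → N = ⊥ ∨ N = ⊤
  v0_ne : v0 ≠ 0
  v0_A : ∀ a ∈ R.A, σ a v0 = v0
  chi : ∀ h ∈ R.H, σ h v0 = χ h • v0

/-- The operator `w ↦ ∑ u β w`, `u` running through representatives of `A / A1`. -/
def T : W →ₗ[𝔽] W := ∑ u ∈ R.U, σ (u * R.β)

lemma T_apply (w : W) : R.T σ w = ∑ u ∈ R.U, σ (u * R.β) w := LinearMap.sum_apply _ _ _

variable {R σ} {v0 : W} {χ : Γ → 𝔽} (hR : R.IsRep σ v0 χ)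

lemma σ_mul (a b : Γ) (w : W) : σ (a * b) w = σ a (σ b w) := by
  rw [map_mul, Module.End.mul_apply]

namespace IsRep
include hR

lemma triv_A1 {a : Γ} (ha : a ∈ R.A1) : σ a = 1 := by simpa using hR.triv a ha 1

lemma triv_β {a : Γ} (ha : a ∈ R.A1) : σ (R.β * a * R.β) = 1 := by
  have := hR.triv a ha R.β
  rwa [R.β_inv] at this

lemma σ_mul_β {a b : Γ} (hb : b ∈ R.A1) : σ (a * b * R.β) = σ (a * R.β) := by
  have e : a * b * R.β = a * R.β * (R.β * b * R.β) := by simp only [mul_assoc, R.β_cancel]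
  rw [e, map_mul, hR.triv_β hb, mul_one]

lemma card_smul (w : W) : R.U.card • w = 0 := by
  obtain ⟨k, hk⟩ := R.p_dvd
  rw [← Nat.cast_smul_eq_nsmul 𝔽, hk, Nat.cast_mul, hR.cast_p, zero_mul, zero_smul]

lemma T_fixed (w : W) {a : Γ} (ha : a ∈ R.A) : σ a (R.T σ w) = R.T σ w := by
  rw [T_apply, map_sum]
  refine Eq.trans (Finset.sum_congr rfl fun u _ => ?_)
    (R.sum_left (fun u => σ (u * R.β) w) (fun a _ b hb => by simp only [hR.σ_mul_β hb]) ha)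
  rw [← σ_mul, mul_assoc]

lemma T_conj (w : W) {a : Γ} (ha : a ∈ R.A) : R.T σ (σ (R.β * a * R.β) w) = R.T σ w := by
  rw [T_apply, T_apply]
  refine Eq.trans (Finset.sum_congr rfl fun u _ => ?_)
    (R.sum_right (fun u => σ (u * R.β) w) (fun a _ b hb => by simp only [hR.σ_mul_β hb]) ha)
  rw [← σ_mul]
  simp only [mul_assoc, R.β_cancel]

lemma σ_T (w : W) {h : Γ} (hh : h ∈ R.H) : σ h (R.T σ w) = R.T σ (σ (R.β * h * R.β) w) := by
  rw [T_apply, T_apply, map_sum, ← R.sum_conj (fun u => σ (u * R.β) (σ (R.β * h * R.β) w))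
    (fun a _ b hb => by simp only [hR.σ_mul_β hb]) hh]
  refine Finset.sum_congr rfl fun u _ => ?_
  rw [← σ_mul, ← σ_mul]
  simp only [mul_assoc, R.β_cancel, inv_mul_cancel_left]

/-- The quadratic relation satisfied by the operator `T`. -/
lemma T_T {v : W} (hv : ∀ a ∈ R.A, σ a v = v) (hχ : ∀ h ∈ R.H, σ h v = χ h • v) :
    R.T σ (R.T σ v) = (∑ u ∈ R.U with u ∉ R.A1, χ (R.tor u)) • R.T σ v := by
  have key : ∀ w ∈ R.U, R.T σ (σ (w * R.β) v) =
      if w ∉ R.A1 then χ (R.tor w) • R.T σ v else 0 := by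
    intro w hw
    by_cases h : w ∉ R.A1
    · rw [if_pos h]
      obtain ⟨u1, h1, -, u2, h2, e⟩ := R.dec w (R.U_sub w hw) h
      rw [e, σ_mul, σ_mul, hv u2 h2, hχ _ (R.tor_mem w (R.U_sub w hw) h), map_smul, map_smul,
        hR.T_conj v h1]
    · rw [if_neg h]
      rw [not_not] at h
      have e : w * R.β = R.β * (R.β * w * R.β) := by simp only [mul_assoc, R.β_cancel]
      rw [e, map_mul, hR.triv_β h, mul_one, T_apply, ← hR.card_smul v, ← Finset.sum_const]
      refine Finset.sum_congr rfl fun u hu => ?_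
      rw [← σ_mul, mul_assoc, R.β_mul, mul_one, hv u (R.U_sub u hu)]
  rw [R.T_apply σ v, map_sum, Finset.sum_congr rfl key, ← Finset.sum_filter, ← R.T_apply σ v,
    Finset.sum_smul]

/-- A functional invariant under `β A β` and vanishing on a nonzero space of `A`-fixed vectors
stable under `T` and `H` vanishes. -/
lemma functional_eq_zero {N : Submodule 𝔽 W} {n : W} (hn : n ∈ N) (hn0 : n ≠ 0)
    (hNA : ∀ w ∈ N, ∀ a ∈ R.A, σ a w = w) (hNH : ∀ w ∈ N, ∀ h ∈ R.H, σ h w ∈ N)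
    (hNT : ∀ w ∈ N, R.T σ w ∈ N) {l : W →ₗ[𝔽] 𝔽}
    (hl : ∀ a ∈ R.A, ∀ w, l (σ (R.β * a * R.β) w) = l w) (hlN : ∀ w ∈ N, l w = 0) : l = 0 := by
  set M : Submodule 𝔽 W := Submodule.span 𝔽 {x | ∃ a ∈ R.A, ∃ w ∈ N, x = σ (R.β * a * R.β) w}
    with hM
  have hmem : ∀ a ∈ R.A, ∀ w ∈ N, σ (R.β * a * R.β) w ∈ M := fun a ha w hw =>
    Submodule.subset_span ⟨a, ha, w, hw, rfl⟩
  have hNM : ∀ w ∈ N, w ∈ M := fun w hw => by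
    have := hmem 1 R.A.one_mem w hw
    rwa [mul_one, R.β_mul, map_one, Module.End.one_apply] at this
  have stab : ∀ g, (∀ a ∈ R.A, ∀ w ∈ N, σ g (σ (R.β * a * R.β) w) ∈ M) → ∀ w ∈ M, σ g w ∈ M := by
    intro g hg
    have : M ≤ M.comap (σ g) := Submodule.span_le.2 (by
      rintro _ ⟨a, ha, w, hw, rfl⟩
      exact hg a ha w hw)
    exact this
  have hnew : ∀ u ∈ R.A, u ∉ R.A1 → ∀ w ∈ N, σ (u * R.β) w ∈ M := by
    intro u hu hu1 w hw
    obtain ⟨u1, h1, -, u2, h2, e⟩ := R.dec u hu hu1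
    rw [e, σ_mul, σ_mul, hNA w hw u2 h2]
    exact hmem u1 h1 _ (hNH w hw _ (R.tor_mem u hu hu1))
  have hA1 : ∀ u ∈ R.A1, σ (u * R.β) = σ R.β := fun u hu => by
    rw [← one_mul u, hR.σ_mul_β hu, one_mul]
  have hβ1 : ∀ w ∈ N, σ R.β w ∈ M := by
    intro w hw
    obtain ⟨u0, h0, hf⟩ := R.filter_mem_A1
    have h1 := hNM _ (hNT w hw)
    rw [T_apply, ← Finset.sum_filter_add_sum_filter_not _ (· ∈ R.A1), hf, Finset.sum_singleton,
      hA1 u0 h0] at h1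
    refine (M.add_mem_iff_left (M.sum_mem fun u hu => ?_)).1 h1
    rw [Finset.mem_filter] at hu
    exact hnew u (R.U_sub u hu.1) hu.2 w hw
  have hβ : ∀ w ∈ M, σ R.β w ∈ M := by
    refine stab _ fun a ha w hw => ?_
    rw [← σ_mul, mul_assoc, R.β_cancel]
    by_cases h : a ∈ R.A1
    · rw [hA1 a h]
      exact hβ1 w hw
    · exact hnew a ha h w hw
  have hA' : ∀ a ∈ R.A, ∀ w ∈ M, σ (R.β * a * R.β) w ∈ M := fun a ha => stab _ fun b hb w hw => by
    rw [← σ_mul, show R.β * a * R.β * (R.β * b * R.β) = R.β * (a * b) * R.β by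
      simp only [mul_assoc, R.β_cancel]]
    exact hmem _ (R.A.mul_mem ha hb) w hw
  have hall : ∀ k, ∀ w ∈ M, σ k w ∈ M := by
    refine R.gen_induction (fun x y hx hy w hw => ?_) (fun a ha w hw => ?_) (fun h hh => ?_) hβ
    · rw [σ_mul]
      exact hx _ (hy _ hw)
    · have := hβ _ (hA' a ha _ (hβ w hw))
      rw [← σ_mul, ← σ_mul] at this
      simpa only [mul_assoc, R.β_cancel, R.β_mul, mul_one] using this
    · refine stab _ fun a ha w hw => ?_
      have e : h * (R.β * a * R.β) = R.β * ((R.β * h * R.β) * a * (R.β * h * R.β)⁻¹) * R.β * h := by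
        rw [mul_inv_rev, mul_inv_rev, R.β_inv]
        simp only [mul_assoc, R.β_cancel, inv_mul_cancel, mul_one]
      rw [← σ_mul, e, σ_mul]
      exact hmem _ (R.conj_H _ (R.β_conj h hh) a ha) _ (hNH w hw h hh)
  have htop : M = ⊤ := (hR.irr M hall).resolve_left fun h => hn0 (by
    have := hNM n hn
    rwa [h, Submodule.mem_bot] at this)
  have hle : M ≤ LinearMap.ker l := Submodule.span_le.2 (by
    rintro _ ⟨a, ha, w, hw, rfl⟩
    exact (hl a ha w).trans (hlN w hw))
  rw [htop] at hle
  exact LinearMap.ker_eq_top.1 (top_le_iff.1 hle)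

lemma exists_functional : ∃ l : W →ₗ[𝔽] 𝔽, l ≠ 0 ∧
    ∀ a ∈ R.A, ∀ w, l (σ (R.β * a * R.β) w) = l w := by
  let ρ : Representation 𝔽 R.A (Module.Dual 𝔽 W) :=
    σ.dual.comp ((MulAut.conj R.β).toMonoidHom.comp R.A.subtype)
  have hρ : ∀ (a : R.A) (l : Module.Dual 𝔽 W) w,
      ρ a l w = l (σ (R.β * (a : Γ)⁻¹ * R.β) w) := by
    intro a l w
    show l (σ (R.β * a * R.β⁻¹)⁻¹ w) = _
    congr 3
    rw [mul_inv_rev, mul_inv_rev, inv_inv, R.β_inv, mul_assoc]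
  obtain ⟨l0, hl0⟩ : ∃ l : Module.Dual 𝔽 W, l ≠ 0 := by
    by_contra! h
    exact hR.v0_ne ((Module.forall_dual_apply_eq_zero_iff 𝔽 v0).1 fun l => by rw [h l]; rfl)
  have hU : ∀ a, ∃ u ∈ R.U.subtype (· ∈ R.A), ρ a = ρ u := by
    intro a
    obtain ⟨u, ⟨hu, h1⟩, -⟩ := R.reps a a.2
    refine ⟨⟨u, R.U_sub u hu⟩, by simpa using hu, LinearMap.ext fun l => LinearMap.ext fun w => ?_⟩
    rw [hρ, hρ]
    have e : R.β * u⁻¹ * R.β = R.β * ((a : Γ)⁻¹ * u)⁻¹ * R.β * (R.β * (a : Γ)⁻¹ * R.β) := by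
      rw [mul_inv_rev, inv_inv]
      simp only [mul_assoc, R.β_cancel, mul_inv_cancel_left]
    rw [e, σ_mul (R.β * _ * R.β) (R.β * _ * R.β), hR.triv_β (R.A1.inv_mem h1), Module.End.one_apply]
  have hpow : ∀ a, ρ (a ^ R.p) = 1 := by
    refine fun a => LinearMap.ext fun l => LinearMap.ext fun w => ?_
    rw [hρ, SubmonoidClass.coe_pow, hR.triv_β (R.A1.inv_mem (R.pow_mem a a.2))]
    rfl
  obtain ⟨l, hl, hl'⟩ := exists_fixed_vector R.prime hR.cast_p ρ _ hU hpow hl0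
  refine ⟨l, hl, fun a ha w => ?_⟩
  have := congrArg (fun m : Module.Dual 𝔽 W => m w) (hl' ⟨a⁻¹, R.A.inv_mem ha⟩)
  simpa only [hρ, inv_inv] using this

lemma T_eigen_v0 {h : Γ} (hh : h ∈ R.H) : σ h (R.T σ v0) = χ (R.β * h * R.β) • R.T σ v0 := by
  rw [hR.σ_T v0 hh, hR.chi _ (R.β_conj h hh), map_smul]

/-- The space of `A`-fixed vectors is a line. -/
lemma fixed_eq_smul {v : W} (hv : ∀ a ∈ R.A, σ a v = v) : ∃ c : 𝔽, v = c • v0 := by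
  obtain ⟨w0, hw0, hw0A, hw0H, c0, hw0T⟩ : ∃ w0, w0 ≠ 0 ∧ (∀ a ∈ R.A, σ a w0 = w0) ∧
      (∀ h ∈ R.H, ∃ c : 𝔽, σ h w0 = c • w0) ∧ ∃ c : 𝔽, R.T σ w0 = c • w0 := by
    by_cases h0 : R.T σ v0 = 0
    · exact ⟨v0, hR.v0_ne, hR.v0_A, fun h hh => ⟨_, hR.chi h hh⟩, 0, by rw [h0, zero_smul]⟩
    · exact ⟨R.T σ v0, h0, fun a ha => hR.T_fixed v0 ha, fun h hh => ⟨_, hR.T_eigen_v0 hh⟩,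
        _, hR.T_T hR.v0_A hR.chi⟩
  choose! cH hcH using hw0H
  obtain ⟨l, hl0, hl⟩ := hR.exists_functional
  have uniq : ∀ m : W →ₗ[𝔽] 𝔽, (∀ a ∈ R.A, ∀ w, m (σ (R.β * a * R.β) w) = m w) →
      m w0 = 0 → m = 0 := by
    intro m hm hm0
    have hsp : ∀ w ∈ Submodule.span 𝔽 {w0}, ∃ c : 𝔽, w = c • w0 := fun w hw => by
      obtain ⟨c, rfl⟩ := Submodule.mem_span_singleton.1 hw
      exact ⟨c, rfl⟩
    refine hR.functional_eq_zero (N := Submodule.span 𝔽 {w0}) (Submodule.mem_span_singleton_self w0)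
      hw0 ?_ ?_ ?_ hm ?_
    all_goals
      intro w hw
      obtain ⟨c, rfl⟩ := hsp w hw
    · intro a ha
      rw [map_smul, hw0A a ha]
    · intro h hh
      rw [map_smul, hcH h hh]
      exact Submodule.smul_mem _ _ (Submodule.smul_mem _ _ (Submodule.mem_span_singleton_self w0))
    · rw [map_smul, hw0T]
      exact Submodule.smul_mem _ _ (Submodule.smul_mem _ _ (Submodule.mem_span_singleton_self w0))
    · rw [map_smul, hm0, smul_zero]
  have hlw0 : l w0 ≠ 0 := fun h => hl0 (uniq l hl h)
  have scal : ∀ (B : W →ₗ[𝔽] W) (c : 𝔽), B w0 = c • w0 →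
      (∀ a ∈ R.A, ∀ w, l (B (σ (R.β * a * R.β) w)) = l (B w)) → ∀ w, l (B w) = c * l w := by
    intro B c hB hBA w
    have := uniq (l ∘ₗ B - c • l) (fun a ha w => by
      simp only [LinearMap.sub_apply, LinearMap.comp_apply, LinearMap.smul_apply, hBA a ha, hl a ha])
      (by simp [hB])
    have := congrArg (fun m : W →ₗ[𝔽] 𝔽 => m w) this
    simpa [sub_eq_zero] using this
  have lT := scal (R.T σ) c0 hw0T fun a ha w => by rw [hR.T_conj w ha]
  have lH : ∀ h ∈ R.H, ∀ w, l (σ h w) = cH h * l w := fun h hh =>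
    scal (σ h) _ (hcH h hh) fun a ha w => by
      have e : h * (R.β * a * R.β) = R.β * ((R.β * h * R.β) * a * (R.β * h * R.β)⁻¹) * R.β * h := by
        rw [mul_inv_rev, mul_inv_rev, R.β_inv]
        simp only [mul_assoc, R.β_cancel, inv_mul_cancel, mul_one]
      rw [← σ_mul, e, σ_mul, hl _ (R.conj_H _ (R.β_conj h hh) a ha)]
  have small : ∀ w, (∀ a ∈ R.A, σ a w = w) → l w = 0 → w = 0 := by
    intro w hw hlw
    by_contra hw'
    let N : Submodule 𝔽 W :=
      { carrier := {w | (∀ a ∈ R.A, σ a w = w) ∧ l w = 0}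
        add_mem' := fun {x y} hx hy => ⟨fun a ha => by rw [map_add, hx.1 a ha, hy.1 a ha], by
          rw [map_add, hx.2, hy.2, add_zero]⟩
        zero_mem' := ⟨fun a _ => map_zero _, map_zero _⟩
        smul_mem' := fun c x hx => ⟨fun a ha => by rw [map_smul, hx.1 a ha], by
          rw [map_smul, hx.2, smul_zero]⟩ }
    refine hl0 (hR.functional_eq_zero (N := N) (n := w) ⟨hw, hlw⟩ hw' (fun x hx => hx.1) ?_ ?_ hl
      fun x hx => hx.2)
    · refine fun x hx h hh => ⟨fun a ha => ?_, by rw [lH h hh, hx.2, mul_zero]⟩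
      rw [← σ_mul, show a * h = h * (h⁻¹ * a * h⁻¹⁻¹) by group, σ_mul,
        hx.1 _ (R.conj_H _ (R.H.inv_mem hh) a ha)]
    · exact fun x hx => ⟨fun a ha => hR.T_fixed x ha, by rw [lT, hx.2, mul_zero]⟩
  have line : ∀ w, (∀ a ∈ R.A, σ a w = w) → l w0 • w = l w • w0 := by
    intro w hw
    refine sub_eq_zero.1 (small _ (fun a ha => ?_) ?_)
    · rw [map_sub, map_smul, map_smul, hw a ha, hw0A a ha]
    · rw [map_sub, map_smul, map_smul, smul_eq_mul, smul_eq_mul, mul_comm, sub_self]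
  have h1 := line v hv
  have h2 := line v0 hR.v0_A
  have h3 : l v0 ≠ 0 := fun h => by
    rw [h, zero_smul] at h2
    exact hR.v0_ne ((smul_eq_zero.1 h2).resolve_left hlw0)
  refine ⟨(l v0)⁻¹ * l v, ?_⟩
  have : w0 = ((l v0)⁻¹ * l w0) • v0 := by rw [mul_smul, h2, smul_smul, inv_mul_cancel₀ h3, one_smul]
  have h4 : v = ((l w0)⁻¹ * l v) • w0 := by
    rw [mul_smul, ← h1, smul_smul, inv_mul_cancel₀ hlw0, one_smul]
  rw [h4]
  nth_rewrite 2 [this]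
  rw [smul_smul]
  congr 1
  rw [map_smul, smul_eq_mul]
  field_simp

lemma exists_T_v0 : ∃ μ : 𝔽, R.T σ v0 = μ • v0 ∧
    (μ = 0 ∨ μ = ∑ u ∈ R.U with u ∉ R.A1, χ (R.tor u)) := by
  obtain ⟨μ, hμ⟩ := hR.fixed_eq_smul fun a ha => hR.T_fixed v0 ha
  refine ⟨μ, hμ, or_iff_not_imp_left.2 fun h0 => ?_⟩
  have := hR.T_T hR.v0_A hR.chi
  rw [hμ, map_smul, hμ, smul_smul, smul_smul] at this
  exact mul_right_cancel₀ h0 (smul_left_injective 𝔽 hR.v0_ne this)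

end IsRep
end RankOne
end U21

namespace U21
namespace RankOne

variable {Γ : Type*} [Group Γ] {R : RankOne Γ} {𝔽 : Type*} [Field 𝔽] {W : Type*} [AddCommGroup W]
  [Module 𝔽 W] {σ : Representation 𝔽 Γ W} {v0 : W} {χ : Γ → 𝔽} (hR : R.IsRep σ v0 χ)
  {P : Submodule 𝔽 (Γ → 𝔽)} (hP : ∀ f, f ∈ P ↔ ∀ b ∈ R.I, ∀ x, f (b * x) = f x)

namespace IsRep

include hR in
lemma sum_tor_of_const {c : 𝔽} (hc : ∀ u ∈ R.A, u ∉ R.A1 → χ (R.tor u) = c) :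
    ∑ u ∈ R.U with u ∉ R.A1, χ (R.tor u) = -c := by
  have h1 : ∑ u ∈ R.U with u ∉ R.A1, χ (R.tor u) = ∑ u ∈ R.U with u ∉ R.A1, c :=
    Finset.sum_congr rfl fun u hu => by
      rw [Finset.mem_filter] at hu
      exact hc u (R.U_sub u hu.1) hu.2
  obtain ⟨u0, -, hf⟩ := R.filter_mem_A1
  have h2 := Finset.sum_filter_add_sum_filter_not R.U (· ∈ R.A1) (fun _ => c)
  obtain ⟨k, hk⟩ := R.p_dvd
  rw [hf, Finset.sum_singleton, Finset.sum_const c (s := R.U), hk, nsmul_eq_mul, Nat.cast_mul,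
    hR.cast_p, zero_mul, zero_mul] at h2
  rw [h1]
  exact eq_neg_of_add_eq_zero_right h2

include hP in
lemma indicator_mem : (fun x => if x ∈ R.I then (1 : 𝔽) else 0) ∈ P :=
  (hP _).2 fun b hb x => by simp only [R.I.mul_mem_cancel_left hb]

include hP in
lemma translate_mem {f : Γ → 𝔽} (hf : f ∈ P) (k : Γ) : (fun x => f (x * k)) ∈ P :=
  (hP _).2 fun b hb x => by rw [mul_assoc]; exact (hP f).1 hf b hb _

include hR hP in
lemma T_of_steinberg (c : Γ →* 𝔽ˣ) (φ : P →ₗ[𝔽] W)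
    (hker : ∀ f : P, φ f = 0 ↔ ∃ cc : 𝔽, (f : Γ → 𝔽) = fun _ => cc)
    (heq : ∀ (k : Γ) (f f' : P), ((f' : Γ → 𝔽) = fun x => (f : Γ → 𝔽) (x * k)) →
      φ f' = (c k : 𝔽) • σ k (φ f)) {u : Γ} (hu : u ∈ R.A) (hu1 : u ∉ R.A1) :
    R.T σ v0 = (-χ (R.tor u)) • v0 := by
  have : CharP 𝔽 R.p := (CharP.charP_iff_prime_eq_zero R.prime).2 hR.cast_p
  have : Fact R.p.Prime := ⟨R.prime⟩
  set ind : P := ⟨_, indicator_mem hP⟩ with hind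
  have hind1 : ∀ x ∈ R.I, (ind : Γ → 𝔽) x = 1 := fun x hx => if_pos hx
  have hind0 : ∀ x ∉ R.I, (ind : Γ → 𝔽) x = 0 := fun x hx => if_neg hx
  have hw0 : φ ind ≠ 0 := fun h => by
    obtain ⟨cc, h⟩ := (hker ind).1 h
    have h1 := (hind1 1 R.I.one_mem).symm.trans (congrFun h 1)
    have h2 := (hind0 _ R.β_notMem).symm.trans (congrFun h R.β)
    exact one_ne_zero (h1.trans h2.symm)
  have hwI : ∀ b ∈ R.I, φ ind = (c b : 𝔽) • σ b (φ ind) := fun b hb =>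
    heq b ind ind (funext fun x => by
      show (if x ∈ R.I then (1 : 𝔽) else 0) = if x * b ∈ R.I then 1 else 0
      simp only [R.I.mul_mem_cancel_right hb])
  have hcA : ∀ a ∈ R.A, c a = 1 := by
    intro a ha
    have h1 := hwI (a ^ R.p) (R.I.pow_mem (R.A_le ha) _)
    rw [hR.triv_A1 (R.pow_mem a ha), Module.End.one_apply] at h1
    have h2 : ((c (a ^ R.p) : 𝔽ˣ) : 𝔽) = 1 := by
      refine smul_left_injective 𝔽 hw0 ?_
      simp only [one_smul]
      exact h1.symm
    rw [map_pow, Units.val_pow_eq_pow_val] at h2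
    have h3 : ((c a : 𝔽) - 1) ^ R.p = 0 := by rw [sub_pow_char, h2, one_pow, sub_self]
    exact Units.ext (sub_eq_zero.1 (pow_eq_zero_iff R.prime.ne_zero |>.1 h3))
  obtain ⟨κ, hκ⟩ := hR.fixed_eq_smul (v := φ ind) fun a ha => by
    have := hwI a (R.A_le ha)
    rw [hcA a ha, Units.val_one, one_smul] at this
    exact this.symm
  have hκ0 : κ ≠ 0 := by
    rintro rfl
    exact hw0 (by rw [hκ, zero_smul])
  have hcH : ∀ h ∈ R.H, (c h : 𝔽) * χ h = 1 := by
    intro h hh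
    have h1 := hwI h (R.H_le hh)
    rw [hκ, map_smul, hR.chi h hh, smul_smul, smul_smul] at h1
    have := smul_left_injective 𝔽 hR.v0_ne h1
    rw [mul_right_comm] at this
    exact (mul_right_cancel₀ hκ0 ((one_mul κ).trans this)).symm
  have hcβ : ∀ w ∈ R.A, w ∉ R.A1 → χ (R.tor w) = c R.β := by
    intro w hw hw1
    obtain ⟨u1, h1, -, u2, h2, e⟩ := R.dec w hw hw1
    have := congrArg c e
    simp only [map_mul, hcA w hw, hcA u1 h1, hcA u2 h2, one_mul, mul_one] at this
    rw [mul_assoc] at this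
    have h3 := congrArg Units.val (mul_left_cancel ((mul_one (c R.β)).trans this))
    rw [Units.val_one, Units.val_mul] at h3
    have h4 := hcH _ (R.tor_mem w hw hw1)
    rw [mul_comm] at h4
    exact (eq_inv_of_mul_eq_one_left h4).trans (eq_inv_of_mul_eq_one_left h3.symm).symm
  obtain ⟨μ, hμ, hμd⟩ := hR.exists_T_v0
  have hμ0 : μ ≠ 0 := by
    rintro rfl
    rw [zero_smul] at hμ
    let f : Γ → P := fun k => ⟨_, translate_mem hP ind.2 k⟩
    have hF : φ (∑ u ∈ R.U, f (u * R.β)) = 0 := by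
      have : ∀ u ∈ R.U, φ (f (u * R.β)) = ((c R.β : 𝔽) * κ) • σ (u * R.β) v0 := fun u hu => by
        rw [heq (u * R.β) ind (f (u * R.β)) rfl, hκ, map_mul, hcA u (R.U_sub u hu), one_mul,
          map_smul, smul_smul]
      rw [map_sum, Finset.sum_congr rfl this, ← Finset.smul_sum, ← T_apply, hμ, smul_zero]
    obtain ⟨cc, hcc⟩ := (hker _).1 hF
    have hval : ∀ x, ∑ u ∈ R.U, (ind : Γ → 𝔽) (x * (u * R.β)) = cc := fun x => by
      have := congrFun hcc x
      rw [Submodule.coe_sum, Finset.sum_apply] at this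
      exact this
    have h1 := hval 1
    rw [Finset.sum_eq_zero fun u hu => by
      rw [one_mul, hind0 _ (R.mul_β_notMem (R.U_sub u hu))]] at h1
    have h2 := hval R.β
    obtain ⟨u0, h0, hf⟩ := R.filter_mem_A1
    rw [← Finset.sum_filter_add_sum_filter_not _ (· ∈ R.A1), hf, Finset.sum_singleton,
      Finset.sum_eq_zero (s := R.U.filter fun u => u ∉ R.A1) fun u hu => by
        rw [Finset.mem_filter] at hu
        refine hind0 _ fun h => hu.2 (R.mem_A1_of_conj_mem_I (R.U_sub u hu.1) ?_)
        rwa [← mul_assoc] at h, hind1 _ (by rw [← mul_assoc]; exact R.conj_mem_I h0), ← h1] at h2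
    simp at h2
  rw [hμ, hμd.resolve_left hμ0, hR.sum_tor_of_const hcβ, hcβ u hu hu1]

end IsRep
end RankOne
end U21

namespace U21
namespace RankOne

variable {Γ : Type*} [Group Γ] {R : RankOne Γ} {𝔽 : Type*} [Field 𝔽] {W : Type*} [AddCommGroup W]
  [Module 𝔽 W] {σ : Representation 𝔽 Γ W} {v0 : W} {χ : Γ → 𝔽} (hR : R.IsRep σ v0 χ)
  {P : Submodule 𝔽 (Γ → 𝔽)} (hP : ∀ f, f ∈ P ↔ ∀ b ∈ R.I, ∀ x, f (b * x) = f x)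

namespace IsRep

include hR in
/-- The character of `I` on the line of `v0` extends to the whole group if it is invariant under
`β` and constant on the torus parts of the elements of `A \ A1`. -/
lemma exists_character {c1 : 𝔽} (hβχ : ∀ h ∈ R.H, χ (R.β * h * R.β) = χ h)
    (hc1 : ∀ u ∈ R.A, u ∉ R.A1 → χ (R.tor u) = c1) :
    ∃ c : Γ →* 𝔽ˣ, ∀ b ∈ R.I, σ b v0 = (c b : 𝔽) • v0 := by
  have inj : ∀ {x y : 𝔽}, x • v0 = y • v0 → x = y := fun h => smul_left_injective 𝔽 hR.v0_ne h
  have hsq : c1 * c1 = 1 := by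
    obtain ⟨u, hu, hu1, u', hu', hu1', e⟩ := R.tor_inv
    have := σ_mul (σ := σ) (R.tor u) (R.tor u') v0
    rw [e, map_one, Module.End.one_apply, hR.chi _ (R.tor_mem u' hu' hu1'), map_smul,
      hR.chi _ (R.tor_mem u hu hu1), smul_smul, hc1 u hu hu1, hc1 u' hu' hu1'] at this
    exact (inj ((one_smul 𝔽 v0).trans this)).symm
  have hI : ∀ b ∈ R.I, ∃ x : 𝔽, σ b v0 = x • v0 := by
    intro b hb
    obtain ⟨a1, h1, h, hh, a, ha, rfl⟩ := R.I_dec b hb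
    exact ⟨χ h, by rw [σ_mul, σ_mul, hR.v0_A a ha, hR.chi h hh, hR.triv_β h1, Module.End.one_apply]⟩
  choose! θ hθ using hI
  have θ_eq : ∀ b ∈ R.I, ∀ x : 𝔽, σ b v0 = x • v0 → θ b = x := fun b hb x hx =>
    inj ((hθ b hb).symm.trans hx)
  have θ_mul : ∀ b ∈ R.I, ∀ b' ∈ R.I, θ (b * b') = θ b * θ b' := fun b hb b' hb' =>
    θ_eq _ (R.I.mul_mem hb hb') _ (by
      rw [σ_mul, hθ b' hb', map_smul, hθ b hb, smul_smul, mul_comm])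
  have θ_one : ∀ b ∈ R.I, σ b v0 = v0 → θ b = 1 := fun b hb h =>
    θ_eq b hb 1 (by rw [h, one_smul])
  have θ_H : ∀ h ∈ R.H, θ h = χ h := fun h hh => θ_eq h (R.H_le hh) _ (hR.chi h hh)
  have θ_A : ∀ a ∈ R.A, θ a = 1 := fun a ha => θ_one a (R.A_le ha) (hR.v0_A a ha)
  have θ_β : ∀ a ∈ R.A1, θ (R.β * a * R.β) = 1 := fun a ha =>
    θ_one _ (R.conj_mem_I ha) (by rw [hR.triv_β ha, Module.End.one_apply])
  choose! ub hub bb hbb hk using R.bruhat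
  let c : Γ → 𝔽 := fun k => if k ∈ R.I then θ k else c1 * θ (bb k)
  have c_I : ∀ b ∈ R.I, c b = θ b := fun b hb => if_pos hb
  have cell : ∀ u ∈ R.A, ∀ b ∈ R.I, u * R.β * b ∉ R.I := fun u hu b hb h =>
    R.mul_β_notMem hu ((R.I.mul_mem_cancel_right hb).1 h)
  have c_cell : ∀ u ∈ R.A, ∀ b ∈ R.I, c (u * R.β * b) = c1 * θ b := by
    intro u hu b hb
    have hn := cell u hu b hb
    have e := hk _ hn
    set u' := ub (u * R.β * b)
    set b' := bb (u * R.β * b) with hb'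
    have hu' : u' ∈ R.A := hub _ hn
    have hbI : b' ∈ R.I := hbb _ hn
    have e2 : b' = R.β * (u'⁻¹ * u) * R.β * b := by
      have : u'⁻¹ * (u * R.β * b) = R.β * b' := by rw [e]; group
      calc b' = R.β * (R.β * b') := (R.β_cancel b').symm
        _ = _ := by rw [← this]; group
    have hA1 : u'⁻¹ * u ∈ R.A1 := R.mem_A1_of_conj_mem_I (R.A.mul_mem (R.A.inv_mem hu') hu) (by
      rw [e2] at hbI
      exact (R.I.mul_mem_cancel_right hb).1 hbI)
    show (if _ then _ else _) = _
    rw [if_neg hn, ← hb', e2, θ_mul _ (R.conj_mem_I hA1) _ hb, θ_β _ hA1, one_mul]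
  have c_A : ∀ a ∈ R.A, ∀ k, c (a * k) = c k := by
    intro a ha k
    by_cases hkI : k ∈ R.I
    · rw [c_I _ hkI, c_I _ (R.I.mul_mem (R.A_le ha) hkI), θ_mul _ (R.A_le ha) _ hkI, θ_A a ha,
        one_mul]
    · obtain ⟨u, hu, b, hb, rfl⟩ := R.bruhat k hkI
      rw [c_cell u hu b hb, ← c_cell (a * u) (R.A.mul_mem ha hu) b hb]
      congr 1
      group
  have c_H : ∀ h ∈ R.H, ∀ k, c (h * k) = χ h * c k := by
    intro h hh k
    by_cases hkI : k ∈ R.I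
    · rw [c_I _ hkI, c_I _ (R.I.mul_mem (R.H_le hh) hkI), θ_mul _ (R.H_le hh) _ hkI, θ_H h hh]
    · obtain ⟨u, hu, b, hb, rfl⟩ := R.bruhat k hkI
      have hβ := R.β_conj h hh
      rw [c_cell u hu b hb, show h * (u * R.β * b) = (h * u * h⁻¹) * R.β * ((R.β * h * R.β) * b) by
        simp only [mul_assoc, R.β_cancel, inv_mul_cancel_left],
        c_cell _ (R.conj_H h hh u hu) _ (R.I.mul_mem (R.H_le hβ) hb), θ_mul _ (R.H_le hβ) _ hb,
        θ_H _ hβ, hβχ h hh, mul_left_comm]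
  have c_β : ∀ k, c (R.β * k) = c1 * c k := by
    intro k
    by_cases hkI : k ∈ R.I
    · rw [c_I _ hkI, ← c_cell 1 R.A.one_mem k hkI, one_mul]
    · obtain ⟨u, hu, b, hb, rfl⟩ := R.bruhat k hkI
      rw [c_cell u hu b hb, ← mul_assoc c1 c1, hsq, one_mul]
      by_cases hu1 : u ∈ R.A1
      · rw [show R.β * (u * R.β * b) = (R.β * u * R.β) * b by group,
          c_I _ (R.I.mul_mem (R.conj_mem_I hu1) hb), θ_mul _ (R.conj_mem_I hu1) _ hb, θ_β u hu1,
          one_mul]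
      · obtain ⟨u1, h1, -, u2, h2, e⟩ := R.dec u hu hu1
        have ht := R.tor_mem u hu hu1
        have hI2 := R.I.mul_mem (R.A_le h2) hb
        rw [e, show R.β * (R.β * u1 * R.β * R.tor u * u2 * b) =
          u1 * R.β * (R.tor u * (u2 * b)) by simp only [mul_assoc, R.β_cancel],
          c_cell u1 h1 _ (R.I.mul_mem (R.H_le ht) hI2), θ_mul _ (R.H_le ht) _ hI2,
          θ_mul _ (R.A_le h2) _ hb, θ_A u2 h2, θ_H _ ht, hc1 u hu hu1, one_mul, ← mul_assoc, hsq,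
          one_mul]
  have c_one : c 1 = 1 := by
    rw [c_I 1 R.I.one_mem, θ_A 1 R.A.one_mem]
  have c_mul : ∀ x k, c (x * k) = c x * c k := by
    refine R.gen_induction (P := fun x => ∀ k, c (x * k) = c x * c k) (fun x y hx hy k => ?_)
      (fun a ha k => ?_) (fun h hh k => ?_) (fun k => ?_)
    · rw [mul_assoc, hx, hy, hx, mul_assoc]
    · rw [c_A a ha, c_I a (R.A_le ha), θ_A a ha, one_mul]
    · rw [c_H h hh, c_I h (R.H_le hh), θ_H h hh]
    · have := c_β 1
      rw [mul_one, c_one, mul_one] at this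
      rw [c_β, this]
  refine ⟨MonoidHom.toHomUnits { toFun := c, map_one' := c_one, map_mul' := c_mul },
    fun b hb => ?_⟩
  rw [MonoidHom.coe_toHomUnits]
  show _ = c b • v0
  rw [c_I b hb]
  exact hθ b hb

lemma finite_quotient (R : RankOne Γ) : Finite (Γ ⧸ R.I) := by
  refine Set.finite_univ_iff.1 (Set.Finite.subset (((insert 1 (R.U.image (· * R.β)) :
    Finset Γ).image (QuotientGroup.mk : Γ → Γ ⧸ R.I)).finite_toSet) ?_)
  intro q _
  induction q using QuotientGroup.induction_on with
  | H x =>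
  rw [Finset.mem_coe, Finset.mem_image]
  by_cases hx : x ∈ R.I
  · exact ⟨1, Finset.mem_insert_self _ _, QuotientGroup.eq.2 (by simpa using hx)⟩
  · obtain ⟨a, ha, b, hb, rfl⟩ := R.bruhat x hx
    obtain ⟨u, ⟨hu, h1⟩, -⟩ := R.reps a ha
    refine ⟨u * R.β, Finset.mem_insert_of_mem (Finset.mem_image_of_mem _ hu), QuotientGroup.eq.2 ?_⟩
    have := R.I.mul_mem (R.conj_mem_I (R.A1.inv_mem h1)) hb
    rw [show R.β * (a⁻¹ * u)⁻¹ * R.β * b = (u * R.β)⁻¹ * (a * R.β * b) by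
      rw [mul_inv_rev, mul_inv_rev, R.β_inv, inv_inv]; group] at this
    exact this

include hP in
lemma apply_mul_of_mem_A1 {f : Γ → 𝔽} (hf : f ∈ P) (x : Γ) {a : Γ} (ha : a ∈ R.A1) :
    f (x * a) = f x := by
  have := (hP f).1 hf _ (R.core a ha x) x
  rwa [inv_mul_cancel_right] at this

include hR hP in
/-- If the character of `I` on `v0` extends to the group and `T v0` does not vanish, then the
representation is a twist of the quotient of the functions on `I \ Γ` by the constants. -/
lemma exists_steinberg (c : Γ →* 𝔽ˣ) (hc : ∀ b ∈ R.I, σ b v0 = (c b : 𝔽) • v0)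
    (hT : R.T σ v0 ≠ 0) :
    ∃ (c : Γ →* 𝔽ˣ) (φ : P →ₗ[𝔽] W), Function.Surjective φ ∧
      (∀ f : P, φ f = 0 ↔ ∃ cc : 𝔽, (f : Γ → 𝔽) = fun _ => cc) ∧
      ∀ (k : Γ) (f f' : P), ((f' : Γ → 𝔽) = fun x => (f : Γ → 𝔽) (x * k)) →
        φ f' = (c k : 𝔽) • σ k (φ f) := by
  have := finite_quotient R
  have := Fintype.ofFinite (Γ ⧸ R.I)
  let d : Γ →* 𝔽ˣ := c⁻¹
  have hdc : ∀ x, (d x : 𝔽) * c x = 1 := fun x => by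
    rw [← Units.val_mul, MonoidHom.inv_apply, inv_mul_cancel, Units.val_one]
  let w : Γ → W := fun x => (d x : 𝔽) • σ x v0
  have w_mul : ∀ x b, b ∈ R.I → w (x * b) = w x := fun x b hb => by
    show (d (x * b) : 𝔽) • σ (x * b) v0 = (d x : 𝔽) • σ x v0
    rw [σ_mul, hc b hb, map_smul, smul_smul, map_mul, Units.val_mul, mul_assoc, hdc, mul_one]
  have w_left : ∀ k x, w (k * x) = (d k : 𝔽) • σ k (w x) := fun k x => by
    show (d (k * x) : 𝔽) • σ (k * x) v0 = (d k : 𝔽) • σ k ((d x : 𝔽) • σ x v0)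
    rw [σ_mul, map_smul, smul_smul, map_mul, Units.val_mul]
  let F : P → Γ ⧸ R.I → W := fun f q => (f : Γ → 𝔽) q.out⁻¹ • w q.out
  have F_mk : ∀ (f : P) (x : Γ), F f (x : Γ ⧸ R.I) = (f : Γ → 𝔽) x⁻¹ • w x := by
    intro f x
    obtain ⟨b, hb⟩ := QuotientGroup.mk_out_eq_mul R.I x
    show (f : Γ → 𝔽) _⁻¹ • w _ = _
    rw [hb, w_mul x b b.2, mul_inv_rev, (hP f).1 f.2 _ (R.I.inv_mem b.2)]
  let φ : P →ₗ[𝔽] W :=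
    { toFun := fun f => ∑ q, F f q
      map_add' := fun f g => by
        rw [← Finset.sum_add_distrib]
        exact Finset.sum_congr rfl fun q _ => add_smul _ _ _
      map_smul' := fun r f => by
        rw [RingHom.id_apply, Finset.smul_sum]
        exact Finset.sum_congr rfl fun q _ => mul_smul _ _ _ }
  have φ_def : ∀ f, φ f = ∑ q, F f q := fun f => rfl
  have heq : ∀ (k : Γ) (f f' : P), ((f' : Γ → 𝔽) = fun x => (f : Γ → 𝔽) (x * k)) →
      φ f' = (d k : 𝔽) • σ k (φ f) := by
    intro k f f' h
    rw [φ_def f, ← Equiv.sum_comp (MulAction.toPerm k⁻¹ : Equiv.Perm (Γ ⧸ R.I)), map_sum,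
      Finset.smul_sum]
    refine Finset.sum_congr rfl fun q _ => ?_
    induction q using QuotientGroup.induction_on with
    | H x =>
    have e : (MulAction.toPerm k⁻¹ : Equiv.Perm (Γ ⧸ R.I)) (x : Γ ⧸ R.I) =
      ((k⁻¹ * x : Γ) : Γ ⧸ R.I) := rfl
    rw [e, F_mk, F_mk, h, map_smul, smul_comm (d k : 𝔽), ← w_left, mul_inv_cancel_left, mul_inv_rev,
      inv_inv]
  let ind : P := ⟨_, indicator_mem hP⟩
  have hind : φ ind = v0 := by
    rw [φ_def, Finset.sum_eq_single ((1 : Γ) : Γ ⧸ R.I)]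
    · rw [F_mk]
      show (if (1 : Γ)⁻¹ ∈ R.I then (1 : 𝔽) else 0) • (d 1 : 𝔽) • σ 1 v0 = v0
      rw [inv_one, if_pos R.I.one_mem, map_one, map_one, Units.val_one, one_smul, one_smul,
        Module.End.one_apply]
    · intro q _ hq
      induction q using QuotientGroup.induction_on with
      | H x =>
      rw [F_mk]
      show (if x⁻¹ ∈ R.I then (1 : 𝔽) else 0) • _ = _
      rw [if_neg fun h => hq (QuotientGroup.eq.2 (by simpa using h)), zero_smul]
    · exact fun h => absurd (Finset.mem_univ _) h
  have hσφ : ∀ k f, σ k (φ f) = (c k : 𝔽) • φ ⟨_, translate_mem hP f.2 k⟩ := fun k f => by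
    rw [heq k f ⟨_, translate_mem hP f.2 k⟩ rfl, smul_smul, mul_comm, hdc, one_smul]
  have hsurj : Function.Surjective φ := by
    refine LinearMap.range_eq_top.1 ((hR.irr (LinearMap.range φ) ?_).resolve_left fun h => ?_)
    · rintro k _ ⟨f, rfl⟩
      rw [hσφ]
      exact Submodule.smul_mem _ _ (LinearMap.mem_range_self _ _)
    · have := LinearMap.mem_range_self φ ind
      rw [h, Submodule.mem_bot, hind] at this
      exact hR.v0_ne this
  let one : P := ⟨fun _ => 1, (hP _).2 fun _ _ _ => rfl⟩
  have hone : φ one = 0 := by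
    by_contra h0
    have hinv : ∀ k, σ k (φ one) = (c k : 𝔽) • φ one := fun k => hσφ k one
    have htop := (hR.irr (Submodule.span 𝔽 {φ one}) (fun k x hx => by
      obtain ⟨r, rfl⟩ := Submodule.mem_span_singleton.1 hx
      rw [map_smul, hinv]
      exact Submodule.smul_mem _ _ (Submodule.smul_mem _ _ (Submodule.mem_span_singleton_self _)))
      ).resolve_left fun h => h0 (Submodule.span_singleton_eq_bot.1 h)
    have hall : ∀ k x, σ k x = (c k : 𝔽) • x := fun k x => by
      obtain ⟨r, rfl⟩ := Submodule.mem_span_singleton.1 (htop.symm ▸ Submodule.mem_top (x := x))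
      rw [map_smul, hinv, smul_comm]
    refine hT ?_
    rw [T_apply, ← smul_zero (c R.β : 𝔽), ← hR.card_smul v0, ← Finset.sum_const, Finset.smul_sum]
    refine Finset.sum_congr rfl fun u hu => ?_
    rw [map_mul, Module.End.mul_apply, hall R.β, map_smul, hR.v0_A u (R.U_sub u hu)]
  let K0 : Submodule 𝔽 P := LinearMap.ker φ ⊓ LinearMap.ker ((LinearMap.proj 1).comp P.subtype)
  have mem_K0 : ∀ f : P, f ∈ K0 ↔ φ f = 0 ∧ (f : Γ → 𝔽) 1 = 0 := fun f => Iff.rfl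
  have hK0 : ∀ f ∈ K0, f = 0 := by
    intro f hf
    by_contra hf0
    let ρ : Representation 𝔽 R.A K0 :=
      { toFun := fun a =>
          { toFun := fun f => ⟨⟨_, translate_mem hP f.1.2 a⟩, (mem_K0 _).2 ⟨by
              rw [heq a f.1 ⟨_, translate_mem hP f.1.2 a⟩ rfl, ((mem_K0 _).1 f.2).1, map_zero, smul_zero], by
              have := (hP f.1).1 f.1.2 a (R.A_le a.2) 1
              show (f.1 : Γ → 𝔽) (1 * a) = 0
              rw [one_mul, ← mul_one (a : Γ), this]
              exact ((mem_K0 _).1 f.2).2⟩⟩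
            map_add' := fun _ _ => rfl
            map_smul' := fun _ _ => rfl }
        map_one' := LinearMap.ext fun f => Subtype.ext (Subtype.ext (funext fun x => by
          show (f.1 : Γ → 𝔽) (x * 1) = _
          rw [mul_one]; rfl))
        map_mul' := fun a b => LinearMap.ext fun f => Subtype.ext (Subtype.ext (funext fun x => by
          show (f.1 : Γ → 𝔽) (x * (a * b)) = (f.1 : Γ → 𝔽) (x * a * b)
          rw [mul_assoc])) }
    have hρ : ∀ (a : R.A) (f : K0) (x : Γ), ((ρ a f).1 : Γ → 𝔽) x = (f.1 : Γ → 𝔽) (x * a) :=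
      fun _ _ _ => rfl
    have hU : ∀ a, ∃ u ∈ R.U.subtype (· ∈ R.A), ρ a = ρ u := by
      intro a
      obtain ⟨u, ⟨hu, h1⟩, -⟩ := R.reps a a.2
      refine ⟨⟨u, R.U_sub u hu⟩, by simpa using hu,
        LinearMap.ext fun f => Subtype.ext (Subtype.ext (funext fun x => ?_))⟩
      rw [hρ, hρ, ← apply_mul_of_mem_A1 hP f.1.2 _ h1, mul_assoc, mul_inv_cancel_left]
    have hpow : ∀ a, ρ (a ^ R.p) = 1 := fun a =>
      LinearMap.ext fun f => Subtype.ext (Subtype.ext (funext fun x => by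
        rw [hρ, SubmonoidClass.coe_pow, apply_mul_of_mem_A1 hP f.1.2 _ (R.pow_mem a a.2)]; rfl))
    obtain ⟨g, hg0, hg⟩ := exists_fixed_vector R.prime hR.cast_p ρ _ hU hpow
      (v := ⟨f, hf⟩) fun h => hf0 (congrArg Subtype.val h)
    obtain ⟨hg1, hg2⟩ := (mem_K0 g.1).1 g.2
    have hgA : ∀ a ∈ R.A, ∀ x, (g.1 : Γ → 𝔽) (x * a) = (g.1 : Γ → 𝔽) x := fun a ha x => by
      rw [← hρ ⟨a, ha⟩ g x, hg]
    have hgI : ∀ b ∈ R.I, (g.1 : Γ → 𝔽) b = 0 := fun b hb => by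
      rw [← mul_one b, (hP g.1).1 g.1.2 b hb, hg2]
    have hgβ : ∀ x ∉ R.I, (g.1 : Γ → 𝔽) x = (g.1 : Γ → 𝔽) R.β := by
      intro x hx
      obtain ⟨u, hu, b, hb, e⟩ := R.bruhat x⁻¹ (fun h => hx (R.I.inv_mem_iff.1 h))
      rw [← inv_inv x, e, mul_inv_rev, (hP g.1).1 g.1.2 _ (R.I.inv_mem hb), mul_inv_rev,
        hgA _ (R.A.inv_mem hu), R.β_inv]
    have hge : g.1 = (g.1 : Γ → 𝔽) R.β • (one - ind) := Subtype.ext (funext fun x => by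
      show _ = (g.1 : Γ → 𝔽) R.β * (1 - if x ∈ R.I then (1 : 𝔽) else 0)
      by_cases hx : x ∈ R.I
      · rw [if_pos hx, sub_self, mul_zero, hgI x hx]
      · rw [if_neg hx, sub_zero, mul_one, hgβ x hx])
    have hgβ0 : (g.1 : Γ → 𝔽) R.β = 0 := by
      have h := hg1
      rw [hge, map_smul, map_sub, hone, hind, zero_sub] at h
      exact (smul_eq_zero.1 h).resolve_right (neg_ne_zero.2 hR.v0_ne)
    rw [hgβ0, zero_smul] at hge
    exact hg0 (Subtype.ext hge)
  refine ⟨d, φ, hsurj, fun f => ⟨fun h => ?_, ?_⟩, heq⟩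
  · refine ⟨(f : Γ → 𝔽) 1, ?_⟩
    have := hK0 (f - (f : Γ → 𝔽) 1 • one) ((mem_K0 _).2 ⟨by
      rw [map_sub, map_smul, hone, h, smul_zero, sub_zero], by
      show (f : Γ → 𝔽) 1 - (f : Γ → 𝔽) 1 * 1 = 0
      rw [mul_one, sub_self]⟩)
    rw [sub_eq_zero.1 this]
    funext x
    show (f : Γ → 𝔽) 1 * 1 = (f : Γ → 𝔽) 1 * 1
    rfl
  · rintro ⟨cc, hcc⟩
    have : f = cc • one := Subtype.ext (hcc.trans (funext fun _ => (mul_one cc).symm))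
    rw [this, map_smul, hone, smul_zero]

include hR hP in
lemma T_of_not_steinberg
    (hconst : ∑ u ∈ R.U with u ∉ R.A1, χ (R.tor u) ≠ 0 → ∀ u ∈ R.A, u ∉ R.A1 → ∀ u' ∈ R.A,
      u' ∉ R.A1 → χ (R.tor u) = χ (R.tor u'))
    (hnot : ¬ ∃ (c : Γ →* 𝔽ˣ) (φ : P →ₗ[𝔽] W), Function.Surjective φ ∧
      (∀ f : P, φ f = 0 ↔ ∃ cc : 𝔽, (f : Γ → 𝔽) = fun _ => cc) ∧
      ∀ (k : Γ) (f f' : P), ((f' : Γ → 𝔽) = fun x => (f : Γ → 𝔽) (x * k)) →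
        φ f' = (c k : 𝔽) • σ k (φ f)) : R.T σ v0 = 0 := by
  by_contra hT
  obtain ⟨μ, hμ, hμd⟩ := hR.exists_T_v0
  have hμ0 : μ ≠ 0 := by
    rintro rfl
    exact hT (by rw [hμ, zero_smul])
  have hd := hconst (hμd.resolve_left hμ0 ▸ hμ0)
  have hβχ : ∀ h ∈ R.H, χ (R.β * h * R.β) = χ h := fun h hh => by
    have := hR.T_eigen_v0 hh
    rw [hμ, map_smul, hR.chi h hh, smul_comm, smul_smul, smul_smul] at this
    exact (mul_right_cancel₀ hμ0 (smul_left_injective 𝔽 hR.v0_ne this)).symm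
  obtain ⟨u0, hu0, hu01, -⟩ := R.tor_inv
  obtain ⟨c, hc⟩ := hR.exists_character (c1 := χ (R.tor u0)) hβχ fun u hu hu1 =>
    hd u hu hu1 u0 hu0 hu01
  exact hnot (exists_steinberg hR hP c hc hT)

end IsRep
end RankOne
end U21

namespace U21

namespace Setting

variable {S : Setting}

lemma dE_conj_n {a m : S.E} {ha : a ≠ 0} {hm : m * S.conj m = 1} (h0 : a ∈ S.pE 0) {k : ℤ}
    {g : S.GG} (hg : g ∈ S.Nk k) : dE a m ha hm * g * (dE a m ha hm)⁻¹ ∈ S.Nk k := by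
  obtain ⟨x, y, h, hy, rfl⟩ := eq_nE hg
  have hca := conj_ne_zero ha
  have hm0 : m ≠ 0 := left_ne_zero_of_mul_eq_one hm
  have hcm : S.conj m⁻¹ = m := by rw [map_inv₀]; exact inv_eq_of_mul_eq_one_left hm
  have hr : S.Rel (a * x * m⁻¹) (a * y * S.conj a) := by
    unfold Setting.Rel at h ⊢
    simp only [map_mul, hcm, S.conj_invol]
    field_simp
    linear_combination a * S.conj a * h
  have e : dE a m ha hm * nE x y h * (dE a m ha hm)⁻¹ = nE _ _ hr := by
    rw [mul_inv_eq_iff_eq_mul]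
    refine mat_inj ?_
    rw [mat_mul, mat_mul, mat_nE, mat_nE, mat_dE]
    ext i j
    fin_cases i <;> fin_cases j <;>
      simp [nM, Matrix.mul_apply, Fin.sum_univ_three, hm0, hca]
    rw [← map_inv₀, hcm]
    field_simp
  rw [e]
  refine nE_mem _ (pE_mul (pE_mul h0 hy rfl) (pE_conj h0) ?_)
  omega

lemma bE_conj_dE {r : ℤ} {a m : S.E} {ha : a ≠ 0} {hm : m * S.conj m = 1} :
    S.bE r * dE a m ha hm * S.bE r = dE (S.conj a)⁻¹ m (inv_ne_zero (conj_ne_zero ha)) hm := by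
  refine mat_inj ?_
  rw [mat_mul, mat_mul, mat_bE, mat_dE, mat_dE]
  ext i j
  fin_cases i <;> fin_cases j <;>
    simp [Matrix.mul_apply, Fin.sum_univ_three, Matrix.vecHead, Matrix.vecTail,
      S.conj_invol]
  · rw [mul_right_comm, inv_mul_cancel₀ (zpow_ne_zero _ S.unif_ne), one_mul]
  · rw [mul_right_comm, mul_inv_cancel₀ (zpow_ne_zero _ S.unif_ne), one_mul]

lemma hE_mul_hE_inv {a : S.E} (ha : a ≠ 0) (h : S.conj a = -a) : hE a * hE a⁻¹ = 1 := by
  refine mat_inj ?_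
  rw [mat_mul, mat_one, mat_hE ha, mat_hE (inv_ne_zero ha)]
  ext i j
  fin_cases i <;> fin_cases j <;>
    simp [hM, Matrix.mul_apply, Fin.sum_univ_three, h, ha]

end Setting

namespace Chamber

variable {S : Setting} (C : Chamber S)
open Setting

/-- The torus `H₀` as a subgroup. -/
def HSub : Subgroup S.GG where
  carrier := C.H0
  mul_mem' := by
    intro g h hg hh
    obtain ⟨a, m, ha, hm, h0, h1, rfl⟩ := eq_dE_of_H0 hg
    obtain ⟨b, n, hb, hn, h2, h3, rfl⟩ := eq_dE_of_H0 hh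
    rw [dE_mul]
    exact dE_mem_H0 _ _ (pE_mul h0 h2 rfl) (by rw [mul_inv]; exact pE_mul h1 h3 rfl)
  one_mem' := by
    have e : dE (1 : S.E) 1 one_ne_zero (by rw [map_one, one_mul]) = 1 := by
      refine mat_inj ?_
      rw [mat_dE, mat_one, map_one, inv_one, Matrix.one_fin_three]
    rw [← e]
    exact dE_mem_H0 _ _ one_mem_pE (by rw [inv_one]; exact one_mem_pE)
  inv_mem' := by
    intro g hg
    obtain ⟨a, m, ha, hm, h0, h1, rfl⟩ := eq_dE_of_H0 hg
    have hm0 : m ≠ 0 := left_ne_zero_of_mul_eq_one hm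
    have e : (dE a m ha hm)⁻¹ = dE a⁻¹ m⁻¹ (inv_ne_zero ha) (by
        rw [map_inv₀, ← mul_inv, hm, inv_one]) := by
      refine inv_eq_of_mul_eq_one_right (mat_inj ?_)
      rw [dE_mul, mat_dE, mat_one, mul_inv_cancel₀ ha, mul_inv_cancel₀ hm0, map_one, inv_one,
        Matrix.one_fin_three]
    rw [e]
    exact dE_mem_H0 _ _ h1 (by rwa [inv_inv])

variable {C}

lemma H0_conj_n {h : S.GG} (hh : h ∈ C.H0) {k : ℤ} {g : S.GG} (hg : g ∈ S.Nk k) :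
    h * g * h⁻¹ ∈ S.Nk k := by
  obtain ⟨a, m, ha, hm, h0, -, rfl⟩ := eq_dE_of_H0 hh
  exact dE_conj_n h0 hg

lemma bE_conj_H0 {h : S.GG} (hh : h ∈ C.H0) (r : ℤ) : S.bE r * h * S.bE r ∈ C.H0 := by
  obtain ⟨a, m, ha, hm, h0, h1, rfl⟩ := eq_dE_of_H0 hh
  rw [bE_conj_dE]
  refine dE_mem_H0 _ _ ?_ ?_
  · rw [← map_inv₀]; exact pE_conj h1
  · rw [inv_inv]; exact pE_conj h0

lemma mem_K_of_N {g : S.GG} (hg : g ∈ S.Nk (-C.s)) : g ∈ C.K := mem_K_of_I1 (N_mem_I1 hg)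

variable (C) in
/-- The torus part of the big cell component of `u * bE s`, for `u` in `N_{-s} \ N_{1-s}`. -/
def tor (u : C.K) : C.K :=
  if h : hE (S.ϖ ^ C.s * S.mat u 0 2) ∈ C.K then ⟨_, h⟩ else 1

lemma lead_mem_H0 {u : S.GG} (hu : u ∈ S.Nk (-C.s)) (hu1 : u ∉ S.Nk (1 - C.s)) :
    hE (S.ϖ ^ C.s * S.mat u 0 2) ∈ C.H0 := by
  obtain ⟨h0, h1, h⟩ := lead_unit hu hu1
  exact hE_mem_H0 h h0 h1

lemma coe_tor {u : C.K} (hu : (u : S.GG) ∈ S.Nk (-C.s)) (hu1 : (u : S.GG) ∉ S.Nk (1 - C.s)) :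
    (C.tor u : S.GG) = hE (S.ϖ ^ C.s * S.mat u 0 2) := by
  rw [tor, dif_pos (mem_K_of_IK (mem_IK_of_H0 (lead_mem_H0 hu hu1)))]

lemma exists_nE {t : S.E} (h0 : t ∈ S.pE 0) (h1 : t ∉ S.pE 1) (ht : S.conj t = -t) :
    ∃ u : C.K, (u : S.GG) ∈ S.Nk (-C.s) ∧ (u : S.GG) ∉ S.Nk (1 - C.s) ∧
      S.ϖ ^ C.s * S.mat u 0 2 = t := by
  have hr : S.Rel 0 (S.ϖ ^ (-C.s) * t) := by
    unfold Setting.Rel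
    rw [map_mul, conj_zpow_unif, ht]
    ring
  have hz := zpow_unif_mem (S := S) (-C.s)
  have hmem : nE 0 _ hr ∈ S.Nk (-C.s) := nE_mem _ (pE_mul hz h0 (by omega))
  refine ⟨⟨_, mem_K_of_N hmem⟩, hmem, fun h => h1 ?_, ?_⟩
  · have := pE_mul (zpow_unif_mem (S := S) C.s) ((mem_Nk_mk (h := hr)).1 h) (l := 1) (by omega)
    rwa [← mul_assoc, zpow_unif_mul, add_neg_cancel, zpow_zero, one_mul] at this
  · show _ * S.mat (nE 0 _ hr) 0 2 = t
    rw [mat_nE]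
    show S.ϖ ^ C.s * (S.ϖ ^ (-C.s) * t) = t
    rw [← mul_assoc, zpow_unif_mul, add_neg_cancel, zpow_zero, one_mul]

end Chamber

section Weight

variable {S : Setting} {C : Chamber S}
open Setting Chamber

/-- The rank one datum of `K` given by representatives of `N_{-s} / N_{1-s}`. -/
def rankOne {U : Finset S.GG} (hU : S.IsReps (S.Nk (-C.s)) (S.Nk (1 - C.s)) U) :
    RankOne C.K where
  A := (S.NS (-C.s)).subgroupOf C.K
  A1 := (S.NS (1 - C.s)).subgroupOf C.K
  H := C.HSub.subgroupOf C.K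
  I := C.ISub.subgroupOf C.K
  β := ⟨S.bE C.s, bE_mem_K⟩
  tor := C.tor
  U := U.subtype (· ∈ C.K)
  p := S.p
  prime := S.hp
  β_mul := Subtype.ext (bE_mul_bE _)
  A1_le := fun a ha => NS_mono (by omega) ha
  A_le := fun a ha => mem_IK_of_I1 (N_mem_I1 ha)
  H_le := fun h hh => mem_IK_of_H0 hh
  β_notMem := bE_not_mem_IK
  conj_A1 := fun a ha b hb => by
    have e : 1 - C.s = -C.s + 1 := by ring
    rw [e] at hb ⊢
    exact NS_conj ha hb
  conj_H := fun h hh a ha => H0_conj_n hh ha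
  conj_H1 := fun h hh a ha => H0_conj_n hh ha
  β_conj := fun h hh => bE_conj_H0 hh _
  core := fun a ha x => conj_Kone_mem_IK x.2 (N_mem_Kone ha) a.2
  tor_mem := fun u hu hu1 => by
    show (C.tor u : S.GG) ∈ C.H0
    rw [coe_tor hu hu1]
    exact lead_mem_H0 hu hu1
  dec := fun u hu hu1 => by
    obtain ⟨n', hn', n, hn, hn1, e⟩ := rank_one_rel (u := (u : S.GG)) hu hu1
    have h1 := bE_conj_n' C.s hn'
    rw [show C.s - 2 * C.s = -C.s by ring] at h1
    have e1 : S.bE C.s * (S.bE C.s * n' * S.bE C.s) * S.bE C.s = n' := by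
      simp only [mul_assoc, bE_mul_bE, mul_one]
      rw [← mul_assoc, bE_mul_bE, one_mul]
    refine ⟨⟨_, mem_K_of_N h1⟩, h1, fun h => hn1 ?_, ⟨n, mem_K_of_N hn⟩, hn, Subtype.ext ?_⟩
    · have := bE_conj_n C.s h
      rw [show 1 - C.s + 2 * C.s = C.s + 1 by ring] at this
      rwa [← e1]
    · show (u : S.GG) * S.bE C.s = S.bE C.s * (S.bE C.s * n' * S.bE C.s) * S.bE C.s * C.tor u * n
      rw [e1, coe_tor hu hu1]
      exact e
  bruhat := fun k hk => by
    obtain ⟨u, hu, b, hb, e⟩ := Chamber.bruhat k.2 hk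
    exact ⟨⟨u, mem_K_of_N hu⟩, hu, ⟨b, mem_K_of_IK hb⟩, hb, Subtype.ext e⟩
  I_dec := fun k hk => by
    obtain ⟨n', hn', h, hh, n, hn, e⟩ := IK_dec hk
    have h1 := bE_conj_n' C.s hn'
    rw [show C.s + 1 - 2 * C.s = 1 - C.s by ring] at h1
    refine ⟨⟨_, mem_K_of_N (Nk_mono (by omega) h1)⟩, h1, ⟨h, mem_K_of_IK (mem_IK_of_H0 hh)⟩, hh,
      ⟨n, mem_K_of_N hn⟩, hn, Subtype.ext (e.trans ?_)⟩
    show n' * h * n = S.bE C.s * (S.bE C.s * n' * S.bE C.s) * S.bE C.s * h * n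
    congr 2
    simp only [mul_assoc, bE_mul_bE, mul_one]
    rw [← mul_assoc, bE_mul_bE, one_mul]
  pow_mem := fun a ha => by
    have e : 1 - C.s = -C.s + 1 := by ring
    rw [e]
    exact NS_pow_p ha
  U_sub := fun u hu => hU.1 (Finset.mem_subtype.1 hu)
  reps := fun a ha => by
    obtain ⟨u, ⟨hu, h1⟩, h2⟩ := hU.2 a ha
    exact ⟨⟨u, mem_K_of_N (hU.1 hu)⟩, ⟨Finset.mem_subtype.2 hu, h1⟩, fun v hv =>
      Subtype.ext (h2 v ⟨Finset.mem_subtype.1 hv.1, hv.2⟩)⟩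
  p_dvd := by
    rw [Finset.card_subtype, Finset.filter_true_of_mem fun u hu => mem_K_of_N (hU.1 hu)]
    rw [show 1 - C.s = -C.s + 1 by ring] at hU
    exact hU.p_dvd_card
  tor_inv := by
    obtain ⟨t, h0, h1, ht⟩ := exists_trace_zero_unit (S := S)
    have ht0 := ne_zero_of_not_mem h1
    obtain ⟨u, hu, hu1, e⟩ := exists_nE (C := C) h0 h1 ht
    obtain ⟨v, hv, hv1, e'⟩ := exists_nE (C := C) (t := t⁻¹)
      (by simpa using inv_mem_of_not_mem (n := 0) h1)
      (by
        have := not_mem_of_inv_mem (S := S) (x := t⁻¹) (inv_ne_zero ht0) (n := 0) (by simpa using h0)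
        simpa using this)
      (by rw [map_inv₀, ht, inv_neg])
    refine ⟨u, hu, hu1, v, hv, hv1, Subtype.ext ?_⟩
    show (C.tor u : S.GG) * C.tor v = 1
    rw [coe_tor hu hu1, coe_tor hv hv1, e, e', hE_mul_hE_inv ht0 ht]

variable {𝔽 : Type} [Field 𝔽] {W : Type} [AddCommGroup W] [Module 𝔽 W]
  {σ : Representation 𝔽 C.K W} {v0 : W} {χ : S.GG → 𝔽}

lemma sigma'_of_mem {g : S.GG} (hg : g ∈ C.K) : sigma' C 𝔽 W σ g = σ ⟨g, hg⟩ := dif_pos hg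

lemma rankOne_isRep {U : Finset S.GG} (hU : S.IsReps (S.Nk (-C.s)) (S.Nk (1 - C.s)) U)
    (hσ : IsWeight C 𝔽 W σ) (hv0 : v0 ≠ 0) (hv : ∀ g ∈ C.I1, sigma' C 𝔽 W σ g v0 = v0)
    (hχ : IsChi C 𝔽 W σ v0 χ) (hp : (S.p : 𝔽) = 0) :
    (rankOne hU).IsRep σ v0 fun k => χ k where
  cast_p := hp
  triv := fun a ha x => by
    rw [map_mul, map_mul, hσ.2.2.2 a a.2 (N_mem_Kone ha), ← Module.End.one_eq_id, mul_one,
      ← map_mul, mul_inv_cancel, map_one]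
  irr := hσ.2.2.1
  v0_ne := hv0
  v0_A := fun a ha => by
    rw [← sigma'_of_mem a.2]
    exact hv a (N_mem_I1 ha)
  chi := fun h hh => by
    rw [← sigma'_of_mem h.2]
    exact hχ h hh

lemma mem_PS1sub {U : Finset S.GG} (hU : S.IsReps (S.Nk (-C.s)) (S.Nk (1 - C.s)) U)
    (f : C.K → 𝔽) : f ∈ PS1sub C 𝔽 ↔ ∀ b ∈ (rankOne hU).I, ∀ x, f (b * x) = f x := by
  constructor
  · rintro ⟨h1, h2, -⟩ b hb x
    obtain ⟨n', hn', h, hh, n, hn, e⟩ := IK_dec hb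
    have hn'1 := N'_mem_I1 hn'
    have hn1 := N_mem_I1 hn
    rw [show b = ⟨n', mem_K_of_I1 hn'1⟩ * ⟨h, mem_K_of_IK (mem_IK_of_H0 hh)⟩ *
      ⟨n, mem_K_of_I1 hn1⟩ from Subtype.ext e, mul_assoc, mul_assoc, h1 _ hn'1, h2 _ hh, one_mul,
      h1 _ hn1]
  · intro h
    refine ⟨fun b hb => h b (mem_IK_of_I1 hb), fun b hb x => ?_, fun z hz x => ?_⟩
    · rw [one_mul]
      exact h b (mem_IK_of_H0 hb) x
    · rw [← h (x * z * x⁻¹) (conj_Kone_mem_IK x.2 hz z.2) x, inv_mul_cancel_right]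

lemma sum_tor_eq {U : Finset S.GG} (hU : S.IsReps (S.Nk (-C.s)) (S.Nk (1 - C.s)) U) :
    ∑ u ∈ (rankOne hU).U with u ∉ (rankOne hU).A1, χ ((rankOne hU).tor u : C.K) =
      ∑ u ∈ U with u ∉ S.Nk (1 - C.s), χ (hE (S.ϖ ^ C.s * S.mat u 0 2)) := by
  refine Finset.sum_bij (fun u _ => (u : S.GG)) (fun u hu => ?_) (fun _ _ _ _ h => Subtype.ext h)
    (fun u hu => ?_) (fun u hu => ?_)
  · rw [Finset.mem_filter] at hu ⊢
    exact ⟨Finset.mem_subtype.1 hu.1, hu.2⟩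
  · rw [Finset.mem_filter] at hu
    exact ⟨⟨u, mem_K_of_N (hU.1 hu.1)⟩, Finset.mem_filter.2 ⟨Finset.mem_subtype.2 hu.1, hu.2⟩, rfl⟩
  · rw [Finset.mem_filter] at hu
    rw [← coe_tor (hU.1 (Finset.mem_subtype.1 hu.1)) hu.2]
    rfl

/-- `S_K` acts on `f_0` in the same way as the operator `T` acts on `v_0`. -/
lemma SK_ff_zero {U : Finset S.GG} (hU : S.IsReps (S.Nk (-C.s)) (S.Nk (1 - C.s)) U)
    {ff : ℤ → ↥(IndSub C 𝔽 W σ)} (hff : IsFFamily C 𝔽 W σ v0 ff) {c : 𝔽}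
    (h : (rankOne hU).T σ v0 = c • v0) :
    ∑ u ∈ U, indRep C 𝔽 W σ (u * C.βK) (ff 0) = c • ff 0 := by
  have ff_K : ∀ x (hx : x ∈ C.K), (ff 0 : S.GG → W) x = σ ⟨x, hx⟩ v0 := fun x hx => by
    have := hff.2.2.2.2.2 0 le_rfl
    rw [neg_zero, zpow_zero] at this
    rw [← sigma'_of_mem, ← this, ← ind_K _ x hx, mul_one]
  have ff_notK : ∀ x ∉ C.K, (ff 0 : S.GG → W) x = 0 := fun x hx => by
    by_contra h0
    obtain ⟨k, hk, i, hi, rfl⟩ := hff.2.2.2.1 0 x h0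
    rw [neg_zero, zpow_zero, mul_one] at hx
    exact hx (C.K.mul_mem hk (mem_K_of_I1 hi))
  have hK : ∀ u ∈ U, u * C.βK ∈ C.K := fun u hu => C.K.mul_mem (mem_K_of_N (hU.1 hu)) βK_mem_K
  refine Subtype.ext (funext fun x => ?_)
  rw [coe_sum_indRep]
  show _ = c • (ff 0 : S.GG → W) x
  by_cases hx : x ∈ C.K
  · rw [ff_K x hx, ← map_smul, ← h, RankOne.T_apply, map_sum]
    symm
    refine Finset.sum_bij (fun u _ => (u : S.GG)) (fun u hu => ?_)
      (fun _ _ _ _ h => Subtype.ext h) (fun u hu => ?_) (fun u hu => ?_)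
    · exact Finset.mem_subtype.1 hu
    · exact ⟨⟨u, mem_K_of_N (hU.1 hu)⟩, Finset.mem_subtype.2 hu, rfl⟩
    · rw [ff_K _ (C.K.mul_mem hx (hK u (Finset.mem_subtype.1 hu))), ← RankOne.σ_mul]
      congr 2
      refine Subtype.ext ?_
      show x * (u * S.bE C.s) = x * (u * C.βK)
      rw [C.βK_eq]
  · rw [ff_notK x hx, smul_zero]
    exact Finset.sum_eq_zero fun u hu => ff_notK _ fun h =>
      hx ((C.K.mul_mem_cancel_right (hK u hu)).1 h)

lemma SK_ff_zero_steinberg {U : Finset S.GG}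
    (hU : S.IsReps (S.Nk (-C.s)) (S.Nk (1 - C.s)) U) (hσ : IsWeight C 𝔽 W σ) (hv0 : v0 ≠ 0)
    (hv : ∀ g ∈ C.I1, sigma' C 𝔽 W σ g v0 = v0) (hχ : IsChi C 𝔽 W σ v0 χ) (hp : (S.p : 𝔽) = 0)
    {ff : ℤ → ↥(IndSub C 𝔽 W σ)} (hff : IsFFamily C 𝔽 W σ v0 ff)
    (hst : IsTwistSteinberg C 𝔽 W σ) {t : S.E} (h0 : t ∈ S.pE 0) (h1 : t ∉ S.pE 1)
    (ht : S.conj t = -t) :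
    ∑ u ∈ U, indRep C 𝔽 W σ (u * C.βK) (ff 0) = (-χ (hE t)) • ff 0 := by
  obtain ⟨c, φ, -, hker, heq⟩ := hst
  obtain ⟨u, hu, hu1, e⟩ := exists_nE (C := C) h0 h1 ht
  refine SK_ff_zero hU hff ?_
  rw [(rankOne_isRep hU hσ hv0 hv hχ hp).T_of_steinberg (mem_PS1sub hU) c φ hker heq hu hu1, ← e,
    ← coe_tor hu hu1]
  rfl

lemma SK_ff_zero_not_steinberg {U : Finset S.GG}
    (hU : S.IsReps (S.Nk (-C.s)) (S.Nk (1 - C.s)) U) (hσ : IsWeight C 𝔽 W σ) (hv0 : v0 ≠ 0)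
    (hv : ∀ g ∈ C.I1, sigma' C 𝔽 W σ g v0 = v0) (hχ : IsChi C 𝔽 W σ v0 χ) (hp : (S.p : 𝔽) = 0)
    {lift : S.kE → S.O} (hlift : ∀ t, S.resmap (lift t) = t) {hmap : S.kE → S.GG}
    (hhmap : ∀ t, t ≠ 0 → S.mat (hmap t) = S.hM (lift t : S.E))
    {ff : ℤ → ↥(IndSub C 𝔽 W σ)} (hff : IsFFamily C 𝔽 W σ v0 ff)
    (hst : ¬ IsTwistSteinberg C 𝔽 W σ) :
    ∑ u ∈ U, indRep C 𝔽 W σ (u * C.βK) (ff 0) = 0 := by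
  rw [SK_ff_zero hU hff (c := 0), zero_smul]
  rw [zero_smul]
  refine (rankOne_isRep hU hσ hv0 hv hχ hp).T_of_not_steinberg (mem_PS1sub hU) (fun hd => ?_) hst
  rw [sum_tor_eq hU, sum_chi_eq hv0 hv hχ hlift hhmap hU] at hd
  intro u hu hu1 v hv' hv1
  have := chi_const (u := (u : S.GG)) (v := (v : S.GG)) hv0 hv hχ hlift hhmap hp hd hu hu1 hv' hv1
  rw [← coe_tor (u := u) hu hu1, ← coe_tor (u := v) hv' hv1] at this
  exact this

end Weight
end U21

namespace U21

/-- `S_-(f_n) = c_- f_n` (`n ≥ 1`), `S_K(f_{-n}) = d f_{-n}` (`n ≥ 1`),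
and `S_K(f_0) = d₀ f_0`, with the constants given by the indicated character sums over
`L_{q^{4-t_K}}` resp. `L_{q^{t_K}}`, and `d₀ = -χ_σ(h(𝔱))` or `0` according as `σ` is a
twist of the Steinberg weight or not. -/
theorem stmt18
    (S : Setting) (C : Chamber S)
    (𝔽 : Type) [Field 𝔽] [IsAlgClosed 𝔽] [Algebra (ZMod S.p) 𝔽]
    [Algebra.IsAlgebraic (ZMod S.p) 𝔽]
    (W : Type) [AddCommGroup W] [Module 𝔽 W]
    (σ : Representation 𝔽 ↥C.K W) (hσ : IsWeight C 𝔽 W σ)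
    (v0 : W) (hv0 : v0 ≠ 0) (hv0inv : ∀ g ∈ C.I1, sigma' C 𝔽 W σ g v0 = v0)
    (χ : S.GG → 𝔽) (hχ : IsChi C 𝔽 W σ v0 χ)
    (ff : ℤ → ↥(IndSub C 𝔽 W σ)) (hff : IsFFamily C 𝔽 W σ v0 ff)
    (lift : S.kE → S.O) (hlift : ∀ t, S.resmap (lift t) = t)
    (hmap : S.kE → S.GG) (hhmap : ∀ t : S.kE, t ≠ 0 → S.mat (hmap t) = S.hM ↑(lift t)) :
    (∀ n : ℤ, 1 ≤ n → ∀ U' : Finset S.GG, S.IsReps (S.N'k C.mK) (S.N'k (C.mK + 1)) U' →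
      ∑ u ∈ U', indRep C 𝔽 W σ (u * C.βK * S.alphaE⁻¹) (ff n) =
        (∑ᶠ z ∈ {z : S.kE × S.kE | z ∈ S.Lof (4 - C.tK) ∧ z ≠ 0}, χ (hmap z.2)) • ff n) ∧
    (∀ n : ℤ, 1 ≤ n → ∀ U : Finset S.GG, S.IsReps (S.Nk C.nK) (S.Nk (C.nK + 1)) U →
      ∑ u ∈ U, indRep C 𝔽 W σ (u * C.βK) (ff (-n)) =
        (∑ᶠ z ∈ {z : S.kE × S.kE | z ∈ S.Lof C.tK ∧ z ≠ 0}, χ (hmap z.2)) • ff (-n)) ∧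
    (∀ U : Finset S.GG, S.IsReps (S.Nk C.nK) (S.Nk (C.nK + 1)) U →
      (IsTwistSteinberg C 𝔽 W σ →
        ∀ tt : S.E, tt ∈ S.O → S.conj tt = -tt → tt ∉ S.pE 1 →
          ∀ tE : S.GG, S.mat tE = S.hM tt →
            ∑ u ∈ U, indRep C 𝔽 W σ (u * C.βK) (ff 0) = (- χ tE) • ff 0) ∧
      (¬ IsTwistSteinberg C 𝔽 W σ →
        ∑ u ∈ U, indRep C 𝔽 W σ (u * C.βK) (ff 0) = 0)) := by
  have hp : (S.p : 𝔽) = 0 := by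
    rw [← map_natCast (algebraMap (ZMod S.p) 𝔽), ZMod.natCast_self, map_zero]
  refine ⟨fun n hn U' hU' => Sminus_ff hv0 hv0inv hχ hlift hhmap hff hp hn hU',
    fun n hn U hU => SK_ff_neg hv0 hv0inv hχ hlift hhmap hff hp hn hU, fun U hU => ?_⟩
  rw [C.nK_eq, show -C.s + 1 = 1 - C.s by ring] at hU
  refine ⟨fun hst tt h0 ht h1 tE htE => ?_, fun hst =>
    SK_ff_zero_not_steinberg hU hσ hv0 hv0inv hχ hp hlift hhmap hff hst⟩
  rw [Setting.mat_inj (htE.trans (Setting.mat_hE (Setting.ne_zero_of_not_mem h1)).symm)]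
  exact SK_ff_zero_steinberg hU hσ hv0 hv0inv hχ hp hff hst (Setting.pE_zero.2 h0) h1 ht

end U21
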